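/- Let n ≥ 2 and let F ⊆ S^{2n−1} be nonempty. If the direction set F' is an F_σ set and S₀(F) has no regular leaf, then S₀(F) is not normal: there exists a formal power series S ∈ ℂ[[z₁,…,zₙ]] such that for each v ∈ F the one-variable series S(tv) has a positive radius of convergence, yet S does not converge uniformly on any neighborhood of the origin. -/

import Mathlib

open MeasureTheory Filter Metric Set
open scoped ENNReal

noncomputable section

/-- The nonnegative part of an extended real, as an element of `ℝ≥0∞`. -/
def erealToENNReal (x : EReal) : ℝ≥0∞ :=
  if x = ⊤ then ⊤ else ENNReal.ofReal x.toReal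

/-- Integral of an `EReal`-valued function: the integral of the positive part minus
the integral of the negative part (both computed as lower integrals). -/
def erealIntegral {α : Type*} [MeasurableSpace α] (μ : Measure α) (g : α → EReal) : EReal :=
  ((∫⁻ x, erealToENNReal (g x) ∂μ : ℝ≥0∞) : EReal)
    - ((∫⁻ x, erealToENNReal (-(g x)) ∂μ : ℝ≥0∞) : EReal)

/-- The mean of an `EReal`-valued function over the circle of radius `r` centered at `a`
along the complex line through `a` with direction `b`. -/
def circleLineMean {E : Type*} [AddCommGroup E] [Module ℂ E]
    (u : E → EReal) (a b : E) (r : ℝ) : EReal :=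
  (((2 * Real.pi)⁻¹ : ℝ) : EReal) *
    erealIntegral (volume.restrict (Set.Ioc (0:ℝ) (2 * Real.pi)))
      (fun θ : ℝ => u (a + (r * Complex.exp (θ * Complex.I)) • b))

/-- `u : ℂᵐ → [-∞,∞)` is plurisubharmonic: upper semicontinuous, not identically `-∞`,
never `+∞`, and satisfying the sub-mean value inequality over circles on every complex line. -/
def IsPSH {m : ℕ} (u : EuclideanSpace ℂ (Fin m) → EReal) : Prop :=
  UpperSemicontinuous u ∧ (∃ z, u z ≠ ⊥) ∧ (∀ z, u z ≠ ⊤) ∧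
    ∀ (a b : EuclideanSpace ℂ (Fin m)) (r : ℝ), 0 < r → u a ≤ circleLineMean u a b r

/-- A set `E ⊆ ℂᵐ` is pluripolar if it is contained in the `-∞` set of some
plurisubharmonic function. -/
def Pluripolar {m : ℕ} (E : Set (EuclideanSpace ℂ (Fin m))) : Prop :=
  ∃ u, IsPSH u ∧ ∀ z ∈ E, u z = ⊥

/-- The Lelong class `L_m` of plurisubharmonic functions of logarithmic growth. -/
def LelongClass (m : ℕ) : Set (EuclideanSpace ℂ (Fin m) → EReal) :=
  {u | IsPSH u ∧ ∃ C : ℝ, ∀ z, u z ≤ ((C + Real.log (1 + ‖z‖) : ℝ) : EReal)}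

/-- The Siciak extremal function `V_E`. -/
def extremalFn {m : ℕ} (E : Set (EuclideanSpace ℂ (Fin m))) (z : EuclideanSpace ℂ (Fin m)) :
    EReal :=
  sSup {x : EReal | ∃ u ∈ LelongClass m, (∀ w ∈ E, u w ≤ 0) ∧ x = u z}

/-- The upper regularization `V*_E(a) = limsup_{w → a} V_E(w)`. -/
def extremalFnStar {m : ℕ} (E : Set (EuclideanSpace ℂ (Fin m)))
    (a : EuclideanSpace ℂ (Fin m)) : EReal :=
  Filter.limsup (extremalFn E) (nhds a)

/-- `E` is L-regular at `a`. -/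
def LRegularAt {m : ℕ} (E : Set (EuclideanSpace ℂ (Fin m)))
    (a : EuclideanSpace ℂ (Fin m)) : Prop :=
  extremalFnStar E a = 0

/-- `E` is locally L-regular at `a`. -/
def LocallyLRegularAt {m : ℕ} (E : Set (EuclideanSpace ℂ (Fin m)))
    (a : EuclideanSpace ℂ (Fin m)) : Prop :=
  ∀ r : ℝ, 0 < r → LRegularAt (E ∩ Metric.ball a r) a

/-- The `i`-th direction set `F'_i ⊆ ℂ^{n-1}`. -/
def dirSetI {m : ℕ} (F : Set (EuclideanSpace ℂ (Fin (m + 1)))) (i : Fin (m + 1)) :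
    Set (EuclideanSpace ℂ (Fin m)) :=
  {w | ∃ z ∈ F, z i ≠ 0 ∧ ∀ j : Fin m, w j = z (i.succAbove j) / z i}

/-- The direction set `F' = ∪ᵢ F'_i`. -/
def dirSet {m : ℕ} (F : Set (EuclideanSpace ℂ (Fin (m + 1)))) :
    Set (EuclideanSpace ℂ (Fin m)) :=
  ⋃ i, dirSetI F i

/-- `v ∈ F̄` generates a regular leaf of `S₀(F)`. -/
def GeneratesRegularLeaf {m : ℕ} (F : Set (EuclideanSpace ℂ (Fin (m + 1))))
    (v : EuclideanSpace ℂ (Fin (m + 1))) : Prop :=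
  v ∈ closure F ∧ ∃ i : Fin (m + 1), v i ≠ 0 ∧
    LocallyLRegularAt (dirSetI F i)
      (WithLp.toLp 2 (fun j : Fin m => v (i.succAbove j) / v i : Fin m → ℂ) :
        EuclideanSpace ℂ (Fin m))

/-- The coefficients of the one-variable restriction `t ↦ S(tv)` of a formal power series. -/
def lineCoeff {n : ℕ} (S : MvPowerSeries (Fin n) ℂ) (v : EuclideanSpace ℂ (Fin n)) (k : ℕ) :
    ℂ :=
  ∑ I ∈ Finset.Nat.antidiagonalTuple n k,
    MvPowerSeries.coeff (Finsupp.equivFunOnFinite.symm I) S * ∏ i, v i ^ I i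

/-- A one-variable power series (given by its coefficients) has a positive radius of
convergence. -/
def HasPosRadius (c : ℕ → ℂ) : Prop :=
  ∃ r : ℝ, 0 < r ∧ Summable fun k => ‖c k‖ * r ^ k

/-- The degree-wise partial sums of a formal power series in `n` variables. -/
def partialSum {n : ℕ} (S : MvPowerSeries (Fin n) ℂ) (N : ℕ) (z : EuclideanSpace ℂ (Fin n)) :
    ℂ :=
  ∑ k ∈ Finset.range N, ∑ I ∈ Finset.Nat.antidiagonalTuple n k,
    MvPowerSeries.coeff (Finsupp.equivFunOnFinite.symm I) S * ∏ i, z i ^ I i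

/-- `S` converges uniformly on some neighborhood of the origin. -/
def ConvUnifNearZero {n : ℕ} (S : MvPowerSeries (Fin n) ℂ) : Prop :=
  ∃ r : ℝ, 0 < r ∧ ∃ g : EuclideanSpace ℂ (Fin n) → ℂ,
    TendstoUniformlyOn (partialSum S) g Filter.atTop
      (Metric.ball (0 : EuclideanSpace ℂ (Fin n)) r)

section
open scoped Topology ContDiff ComplexOrder
section
abbrev EE (m : ℕ) := EuclideanSpace ℂ (Fin m)
def cm {m : ℕ} (u : EE m → ℝ) (a b : EE m) : ℝ :=
  Real.circleAverage (fun ζ : ℂ => u (a + ζ • b)) 0 1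
structure LB {m : ℕ} (u : EE m → ℝ) : Prop where
  meas : Measurable u
  bdd : ∀ r : ℝ, ∃ C, ∀ z, ‖z‖ ≤ r → |u z| ≤ C
def SubM {m : ℕ} (u : EE m → ℝ) : Prop := ∀ a b, u a ≤ cm u a b
structure InLs {m : ℕ} (c : ℝ) (u : EE m → ℝ) : Prop where
  usc : UpperSemicontinuous u
  lo : ∃ C, ∀ z, -C ≤ u z
  up : ∃ C, ∀ z, u z ≤ C + c * Real.log (1 + ‖z‖)
  sub : SubM u
section
variable {m : ℕ} {u v : EE m → ℝ} {c d : ℝ}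
lemma log1_nonneg (z : EE m) : 0 ≤ Real.log (1 + ‖z‖) :=
  Real.log_nonneg (by linarith [norm_nonneg z])
lemma log1_mono {z : EE m} {r : ℝ} (h : ‖z‖ ≤ r) : Real.log (1 + ‖z‖) ≤ Real.log (1 + r) :=
  Real.log_le_log (by linarith [norm_nonneg z]) (by linarith)
lemma InLs.lb (h : InLs c u) : LB u := by
  refine ⟨h.usc.measurable, fun r => ?_⟩
  obtain ⟨C, hC⟩ := h.lo
  obtain ⟨D, hD⟩ := h.up
  refine ⟨|C| + |D| + |c| * Real.log (1 + r), fun z hz => ?_⟩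
  have h1 := log1_nonneg z
  have h2 := log1_mono hz
  have h3 : c * Real.log (1 + ‖z‖) ≤ |c| * Real.log (1 + r) :=
    (mul_le_mul_of_nonneg_right (le_abs_self c) h1).trans
      (mul_le_mul_of_nonneg_left h2 (abs_nonneg c))
  have h4 : 0 ≤ |c| * Real.log (1 + r) := mul_nonneg (abs_nonneg c) (h1.trans h2)
  rw [abs_le]
  constructor
  · linarith [hC z, le_abs_self C, abs_nonneg D]
  · linarith [hD z, le_abs_self D, abs_nonneg C]
lemma Continuous.lb (h : Continuous u) : LB u := by
  refine ⟨h.measurable, fun r => ?_⟩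
  obtain ⟨C, hC⟩ := (isCompact_closedBall (0 : EE m) r).exists_bound_of_continuousOn h.continuousOn
  exact ⟨C, fun z hz => by simpa using hC z (by simpa using hz)⟩
lemma LB.bound (h : LB u) (a b : EE m) : ∃ C, ∀ ζ : ℂ, ‖ζ‖ = 1 → |u (a + ζ • b)| ≤ C := by
  obtain ⟨C, hC⟩ := h.bdd (‖a‖ + ‖b‖)
  refine ⟨C, fun ζ hζ => hC _ ((norm_add_le _ _).trans ?_)⟩
  rw [norm_smul, hζ, one_mul]
lemma norm_circ (θ : ℝ) : ‖circleMap 0 1 θ‖ = 1 := by simp [circleMap]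
lemma LB.cint (h : LB u) (a b : EE m) : CircleIntegrable (fun ζ : ℂ => u (a + ζ • b)) 0 1 := by
  obtain ⟨C, hC⟩ := h.bound a b
  unfold CircleIntegrable
  rw [intervalIntegrable_iff]
  refine Measure.integrableOn_of_bounded (M := C) (measure_Ioc_lt_top.ne) ?_ ?_
  · refine (h.meas.comp ?_).aestronglyMeasurable
    have : Continuous fun θ : ℝ => a + circleMap 0 1 θ • b := by fun_prop
    exact this.measurable
  · exact Eventually.of_forall fun θ => by simpa using hC _ (norm_circ θ)
lemma cm_mono (hu : LB u) (hv : LB v) {a b : EE m}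
    (h : ∀ ζ : ℂ, ‖ζ‖ = 1 → u (a + ζ • b) ≤ v (a + ζ • b)) : cm u a b ≤ cm v a b :=
  Real.circleAverage_mono (hu.cint a b) (hv.cint a b) (fun ζ hζ => h ζ (by simpa using hζ))
lemma cm_le (hu : LB u) {a b : EE m} {M : ℝ}
    (h : ∀ ζ : ℂ, ‖ζ‖ = 1 → u (a + ζ • b) ≤ M) : cm u a b ≤ M :=
  Real.circleAverage_mono_on_of_le_circle (hu.cint a b) (fun ζ hζ => h ζ (by simpa using hζ))
lemma cm_add (hu : LB u) (hv : LB v) (a b : EE m) :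
    cm (fun z => u z + v z) a b = cm u a b + cm v a b :=
  Real.circleAverage_fun_add (hu.cint a b) (hv.cint a b)
lemma cm_smul (t : ℝ) (u : EE m → ℝ) (a b : EE m) :
    cm (fun z => t * u z) a b = t * cm u a b := by
  simpa [cm] using Real.circleAverage_fun_smul (a := t) (f := fun ζ : ℂ => u (a + ζ • b)) (c := 0) (R := 1)
lemma cm_const (t : ℝ) (a b : EE m) : cm (fun _ => t) a b = t := by
  simp [cm, Real.circleAverage_const]
lemma LB.add (hu : LB u) (hv : LB v) : LB fun z => u z + v z := by
  refine ⟨hu.meas.add hv.meas, fun r => ?_⟩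
  obtain ⟨C, hC⟩ := hu.bdd r
  obtain ⟨D, hD⟩ := hv.bdd r
  exact ⟨C + D, fun z hz => (abs_add_le _ _).trans (add_le_add (hC z hz) (hD z hz))⟩
lemma LB.smul (t : ℝ) (hu : LB u) : LB fun z => t * u z := by
  refine ⟨hu.meas.const_mul t, fun r => ?_⟩
  obtain ⟨C, hC⟩ := hu.bdd r
  exact ⟨|t| * C, fun z hz => by rw [abs_mul]; exact mul_le_mul_of_nonneg_left (hC z hz) (abs_nonneg t)⟩
lemma LB.const (t : ℝ) : LB (fun _ : EE m => t) := continuous_const.lb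
lemma LB.max (hu : LB u) (hv : LB v) : LB fun z => max (u z) (v z) := by
  refine ⟨hu.meas.max hv.meas, fun r => ?_⟩
  obtain ⟨C, hC⟩ := hu.bdd r
  obtain ⟨D, hD⟩ := hv.bdd r
  exact ⟨_, fun z hz => abs_max_le_max_abs_abs.trans (max_le_max (hC z hz) (hD z hz))⟩
lemma SubM.max (su : SubM u) (sv : SubM v) (hu : LB u) (hv : LB v) :
    SubM fun z => max (u z) (v z) := fun a b => max_le
  ((su a b).trans (cm_mono hu (hu.max hv) fun _ _ => le_max_left _ _))
  ((sv a b).trans (cm_mono hv (hu.max hv) fun _ _ => le_max_right _ _))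
lemma InLs.smul {t : ℝ} (ht : 0 ≤ t) (hu : InLs c u) : InLs (t * c) fun z => t * u z := by
  obtain ⟨C, hC⟩ := hu.lo
  obtain ⟨D, hD⟩ := hu.up
  refine ⟨?_, ⟨t * C, fun z => by nlinarith [hC z]⟩,
    ⟨t * D, fun z => by nlinarith [hD z]⟩, fun a b => ?_⟩
  · exact (continuous_const.mul continuous_id).comp_upperSemicontinuous hu.usc
      (fun x y h => mul_le_mul_of_nonneg_left h ht)
  · rw [cm_smul]
    exact mul_le_mul_of_nonneg_left (hu.sub a b) ht
lemma InLs.comp (hu : InLs c u) (hc : 0 ≤ c) (h : EE m) : InLs c fun z => u (z + h) := by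
  obtain ⟨C, hC⟩ := hu.lo
  obtain ⟨D, hD⟩ := hu.up
  refine ⟨hu.usc.comp (by fun_prop), ⟨C, fun z => hC _⟩,
    ⟨D + c * Real.log (1 + ‖h‖), fun z => (hD _).trans ?_⟩, fun a b => ?_⟩
  · rw [add_assoc, ← mul_add, ← Real.log_mul (by positivity) (by positivity)]
    gcongr
    nlinarith [norm_add_le z h, mul_nonneg (norm_nonneg h) (norm_nonneg z)]
  · have := hu.sub (a + h) b
    simpa [cm, add_right_comm] using this
lemma lelong_max {w : EE m → EReal} (hw : w ∈ LelongClass m) :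
    InLs 1 (fun z => (max (w z) 0).toReal) ∧ ∀ z, ((max (w z) 0).toReal : EReal) = max (w z) 0 := by
  obtain ⟨⟨husc, -, hnt, hsub⟩, C, hC⟩ := hw
  have hbot : ∀ z, max (w z) 0 ≠ ⊥ := fun z h => by
    have := le_max_right (w z) 0; rw [h] at this; simp at this
  have htop : ∀ z, max (w z) 0 ≠ ⊤ := fun z h => by
    rcases max_choice (w z) 0 with h' | h' <;> rw [h'] at h
    · exact hnt z h
    · simp at h
  have hco : ∀ z, ((max (w z) 0).toReal : EReal) = max (w z) 0 :=
    fun z => EReal.coe_toReal (htop z) (hbot z)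
  have h0 : ∀ z, 0 ≤ (max (w z) 0).toReal := fun z => EReal.toReal_nonneg (le_max_right _ _)
  have hU : UpperSemicontinuous (fun z => (max (w z) 0).toReal) := by
    have h1 : UpperSemicontinuous fun z => max (w z) 0 :=
      husc.sup continuous_const.upperSemicontinuous
    intro z y hy
    have h2 : max (w z) 0 < (y : EReal) := by rw [← hco]; exact_mod_cast hy
    filter_upwards [h1 z y h2] with x hx
    rw [← hco] at hx; exact_mod_cast hx
  have hL : LB (fun z => (max (w z) 0).toReal) := by
    refine ⟨hU.measurable, fun r => ⟨max (C + Real.log (1 + r)) 0, fun z hz => ?_⟩⟩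
    rw [abs_of_nonneg (h0 z), ← EReal.coe_le_coe_iff, hco]
    refine max_le ((hC z).trans ?_) (by exact_mod_cast le_max_right _ _)
    exact_mod_cast le_max_of_le_left (add_le_add_right (log1_mono hz) C)
  refine ⟨⟨hU, ⟨0, fun z => by simpa using h0 z⟩, ⟨max C 0, fun z => ?_⟩, fun a b => ?_⟩, hco⟩
  · rw [← EReal.coe_le_coe_iff, hco]
    refine max_le ((hC z).trans ?_) ?_
    · norm_cast; linarith [le_max_left C 0]
    · norm_cast; linarith [le_max_right C 0, log1_nonneg z]
  · rw [← EReal.coe_le_coe_iff, hco]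
    have hcm : 0 ≤ cm (fun z => (max (w z) 0).toReal) a b :=
      Real.circleAverage_nonneg_of_nonneg fun _ _ => h0 _
    refine max_le ((hsub a b 1 one_pos).trans ?_) (by exact_mod_cast hcm)
    have hi : (∫⁻ θ in Set.Ioc (0:ℝ) (2 * Real.pi), erealToENNReal (w (a + ((1:ℝ) * Complex.exp (θ * Complex.I)) • b)))
        ≤ ENNReal.ofReal (∫ θ in Set.Ioc (0:ℝ) (2 * Real.pi), (max (w (a + ((1:ℝ) * Complex.exp (θ * Complex.I)) • b)) 0).toReal) := by
      have hint := hL.cint a b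
      unfold CircleIntegrable at hint
      rw [intervalIntegrable_iff, Set.uIoc_of_le (by positivity)] at hint
      rw [ofReal_integral_eq_lintegral_ofReal]
      · refine lintegral_mono fun θ => ?_
        unfold erealToENNReal
        rw [if_neg (hnt _)]
        refine ENNReal.ofReal_le_ofReal ?_
        by_cases hb : w (a + ((1:ℝ) * Complex.exp (θ * Complex.I)) • b) = ⊥
        · rw [hb]; simp
        · exact EReal.toReal_le_toReal (le_max_left _ _) hb (htop _)
      · simpa [circleMap, IntegrableOn] using hint
      · exact Eventually.of_forall fun θ => h0 _
    unfold circleLineMean erealIntegral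
    have h3 : cm (fun z => (max (w z) 0).toReal) a b = (2 * Real.pi)⁻¹ *
        ∫ θ in Set.Ioc (0:ℝ) (2 * Real.pi), (max (w (a + ((1:ℝ) * Complex.exp (θ * Complex.I)) • b)) 0).toReal := by
      simp [cm, Real.circleAverage_def, circleMap, intervalIntegral.integral_of_le Real.two_pi_pos.le]
    rw [h3, EReal.coe_mul]
    refine mul_le_mul_of_nonneg_left ?_ (by exact_mod_cast (by positivity : (0:ℝ) ≤ (2 * Real.pi)⁻¹))
    refine (EReal.sub_le_sub le_rfl (EReal.coe_ennreal_nonneg _)).trans ?_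
    rw [sub_zero]
    refine (EReal.coe_ennreal_le_coe_ennreal_iff.2 hi).trans ?_
    rw [EReal.coe_ennreal_ofReal, max_eq_left (integral_nonneg fun θ => h0 _)]
end
end
section
section
variable {m : ℕ} {u v : EE m → ℝ} {c d : ℝ}
lemma circleAverage_lt {f : ℂ → ℝ} {M : ℝ} (hf : CircleIntegrable f 0 1)
    (hle : ∀ ζ : ℂ, ‖ζ‖ = 1 → f ζ ≤ M) (hlt : ∀ᶠ ζ in 𝓝 (-1 : ℂ), f ζ < M) :
    Real.circleAverage f 0 1 < M := by
  rw [← Real.circleAverage_const M (0:ℂ) 1, Real.circleAverage_def, Real.circleAverage_def]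
  refine smul_lt_smul_of_pos_left ?_ (by positivity)
  refine intervalIntegral.integral_lt_integral_of_ae_le_of_measure_setOfPred_lt_ne_zero
    Real.two_pi_pos.le hf (by simp) (Eventually.of_forall fun θ => hle _ (norm_circ θ)) ?_
  have hc : ContinuousAt (fun θ : ℝ => circleMap 0 1 θ) Real.pi := (continuous_circleMap 0 1).continuousAt
  have h2 : ∀ᶠ θ in 𝓝 Real.pi, f (circleMap 0 1 θ) < M := hc.eventually (p := fun ζ => f ζ < M) (by simpa [circleMap] using hlt)
  have h3 : {θ | f (circleMap 0 1 θ) < M} ∩ Ioc 0 (2 * Real.pi) ∈ 𝓝 Real.pi :=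
    inter_mem h2 (Ioc_mem_nhds Real.pi_pos (by linarith [Real.pi_pos]))
  have h4 := Measure.measure_pos_of_mem_nhds volume h3
  refine (h4.trans_le ?_).ne'
  exact Measure.le_restrict_apply _ _
lemma log_mean {t ρ : ℝ} (h : 0 < ρ) (ht : ρ < t) :
    Real.circleAverage (fun ζ : ℂ => Real.log ‖(t : ℂ) + ρ * ζ‖) 0 1 = Real.log t := by
  have := circleAverage_log_norm_sub_const_eq_log_radius_add_posLog (a := 0) (c := (t:ℂ)) h.ne'
  rw [Real.circleAverage_eq_circleAverage_zero_one] at this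
  simp only [sub_zero] at this
  have e : (fun ζ : ℂ => Real.log ‖(t : ℂ) + ρ * ζ‖) = fun ζ : ℂ => Real.log ‖(ρ:ℂ) * ζ + t‖ := by
    funext ζ; rw [add_comm]
  have ht0 : 0 < t := h.trans ht
  rw [e, this, Real.posLog_eq_log (by simp [abs_of_pos ht0, abs_of_pos h]; rw [inv_mul_eq_div, one_le_div h]; exact ht.le),
    ← Real.log_mul h.ne' (by simp [h.ne', ht0.ne'])]
  congr 1
  simp [abs_of_pos ht0]; field_simp
lemma BW (hu : InLs 1 u) {s M : ℝ} (hs : 0 < s) (hM : ∀ z, ‖z‖ = s → u z ≤ M)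
    {z : EE m} (hz : s ≤ ‖z‖) : u z ≤ M + Real.log (‖z‖ / s) := by
  obtain ⟨C, hC⟩ := hu.up
  have key : ∀ κ > 0, u z ≤ M + (1 + κ) * Real.log (‖z‖ / s) := by
    intro κ hκ
    by_contra! hlt
    have hz0 : 0 < ‖z‖ := hs.trans_le hz
    set b : EE m := ((‖z‖⁻¹ : ℝ) : ℂ) • z with hb
    have hb1 : ‖b‖ = 1 := by
      rw [hb, norm_smul, Complex.norm_real, norm_inv, norm_norm, inv_mul_cancel₀ hz0.ne']
    set F : ℂ → ℝ := fun ζ => u (ζ • b) - (1 + κ) * Real.log ‖ζ‖ with hF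
    have hFz : F ‖z‖ = u z - (1 + κ) * Real.log ‖z‖ := by
      simp only [hF, hb, smul_smul, ← Complex.ofReal_mul, mul_inv_cancel₀ hz0.ne']; simp
    clear_value b
    set C' := C + Real.log ((1 + s) / s)
    have hup : ∀ ζ : ℂ, s ≤ ‖ζ‖ → F ζ ≤ C' - κ * Real.log ‖ζ‖ := by
      intro ζ hζ
      have h1 := hC (ζ • b)
      rw [norm_smul, hb1, mul_one] at h1
      have h2 : Real.log (1 + ‖ζ‖) ≤ Real.log ‖ζ‖ + Real.log ((1 + s) / s) := by
        have : 0 < ‖ζ‖ := hs.trans_le hζ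
        rw [← Real.log_mul this.ne' (by positivity)]
        refine Real.log_le_log (by positivity) ?_
        rw [mul_div_assoc', le_div_iff₀ hs]
        nlinarith
      simp only [hF, C']
      linarith
    set T := max ‖z‖ (Real.exp ((C' - F ‖z‖) / κ))
    have hT : ∀ ζ : ℂ, s ≤ ‖ζ‖ → T ≤ ‖ζ‖ → F ζ ≤ F ‖z‖ := by
      intro ζ h1 h2
      have h3 : (C' - F ‖z‖) / κ ≤ Real.log ‖ζ‖ := by
        rw [Real.le_log_iff_exp_le (hs.trans_le h1)]
        exact (le_max_right _ _).trans h2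
      rw [div_le_iff₀ hκ] at h3
      linarith [hup ζ h1]
    have husc : ∀ ζ : ℂ, ζ ≠ 0 → UpperSemicontinuousAt F ζ := by
      intro ζ h
      have h1 : UpperSemicontinuousAt (fun ζ : ℂ => u (ζ • b)) ζ :=
        (hu.usc.comp (by fun_prop)) ζ
      have h2 : ContinuousAt (fun ζ : ℂ => -((1 + κ) * Real.log ‖ζ‖)) ζ := by
        have : ‖ζ‖ ≠ 0 := by simpa using h
        fun_prop (disch := assumption)
      simpa [hF, sub_eq_add_neg] using h1.add h2.upperSemicontinuousAt
    have hA : IsCompact {ζ : ℂ | s ≤ ‖ζ‖ ∧ ‖ζ‖ ≤ T} := by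
      refine (isCompact_closedBall (0:ℂ) T).of_isClosed_subset ?_ fun ζ h => by simpa using h.2
      exact (isClosed_le continuous_const continuous_norm).inter (isClosed_le continuous_norm continuous_const)
    obtain ⟨ζ0, h0, hmax⟩ := UpperSemicontinuousOn.exists_isMaxOn (f := F)
      (s := {ζ : ℂ | s ≤ ‖ζ‖ ∧ ‖ζ‖ ≤ T})
      ⟨(‖z‖ : ℂ), by simpa using ⟨hz, le_max_left _ _⟩⟩ hA
      (fun ζ h => (husc ζ (by rintro rfl; simp at h; linarith [h.1])).upperSemicontinuousWithinAt _)
    have hz1 : F ‖z‖ ≤ F ζ0 := hmax (by simpa using ⟨hz, le_max_left _ _⟩)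
    have hall : ∀ ζ : ℂ, s ≤ ‖ζ‖ → F ζ ≤ F ζ0 := by
      intro ζ h
      rcases le_total ‖ζ‖ T with h' | h'
      · exact hmax ⟨h, h'⟩
      · exact (hT ζ h h').trans hz1
    have hin : ∀ ζ : ℂ, ‖ζ‖ = s → F ζ < F ζ0 := by
      intro ζ h
      refine lt_of_lt_of_le ?_ hz1
      have := hM (ζ • b) (by rw [norm_smul, hb1, h, mul_one])
      rw [hFz]; simp only [hF, h]
      rw [Real.log_div hz0.ne' hs.ne'] at hlt
      nlinarith
    have h0s : s < ‖ζ0‖ := lt_of_le_of_ne h0.1 fun h => (hin ζ0 h.symm).false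
    set ρ := ‖ζ0‖ - s
    have hρ : 0 < ρ := sub_pos.2 h0s
    have hζ0 : 0 < ‖ζ0‖ := hs.trans h0s
    set e : ℂ := ζ0 / ‖ζ0‖
    have he : ‖e‖ = 1 := by simp [e, hζ0.ne']
    have he0 : (‖ζ0‖ : ℂ) * e = ζ0 := by
      simp only [e]; rw [mul_div_cancel₀]; exact_mod_cast hζ0.ne'
    set G : ℂ → ℝ := fun ζ => F (((‖ζ0‖ : ℂ) + ρ * ζ) * e)
    have hG1 : ∀ ζ : ℂ, ‖ζ‖ = 1 → G ζ ≤ F ζ0 := by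
      intro ζ h
      refine hall _ ?_
      rw [norm_mul, he, mul_one]
      have := norm_sub_norm_le ((‖ζ0‖ : ℂ)) (-(ρ * ζ))
      rw [norm_neg, norm_mul, h, sub_neg_eq_add] at this
      simp [abs_of_pos hρ] at this
      have h3 : ρ = ‖ζ0‖ - s := rfl
      linarith
    have hGe : ∀ ζ, G ζ = u (ζ0 • b + ζ • ((ρ * e) • b)) - (1 + κ) * Real.log ‖(‖ζ0‖ : ℂ) + ρ * ζ‖ := by
      intro ζ
      simp only [G, hF]
      rw [norm_mul, he, mul_one, smul_smul, ← add_smul, add_mul, he0]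
      congr 4; ring
    have hi1 := hu.lb.cint (ζ0 • b) ((ρ * e) • b)
    have hi2 : CircleIntegrable (fun ζ : ℂ => (1 + κ) * Real.log ‖(‖ζ0‖ : ℂ) + ρ * ζ‖) 0 1 := by
      refine ContinuousOn.circleIntegrable zero_le_one ?_
      intro ζ hζ
      have : ‖(‖ζ0‖ : ℂ) + ρ * ζ‖ ≠ 0 := by
        rw [norm_ne_zero_iff]; intro h
        have h2 := congrArg norm (eq_neg_of_add_eq_zero_left h)
        simp at hζ; simp [hζ, abs_of_pos hρ] at h2
        have h3 : ρ = ‖ζ0‖ - s := rfl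
        linarith
      refine ContinuousAt.continuousWithinAt ?_
      fun_prop (disch := assumption)
    have hGi : CircleIntegrable G 0 1 := by
      have := hi1.sub hi2
      exact this.congr (fun ζ _ => by rw [hGe]; rfl)
    have hav := circleAverage_lt hGi hG1 (by
      have h1 : UpperSemicontinuousAt G (-1) := by
        refine UpperSemicontinuousAt.comp (f := F) (g := fun ζ : ℂ => ((‖ζ0‖ : ℂ) + ρ * ζ) * e) (husc _ ?_) (by fun_prop)
        have : e ≠ 0 := by rw [← norm_ne_zero_iff, he]; simp
        have : (s:ℂ) ≠ 0 := by exact_mod_cast hs.ne'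
        simp [ρ, *]
      refine h1 _ (hin _ ?_)
      rw [norm_mul, he]; simp [ρ, abs_of_pos hs])
    have : Real.circleAverage G 0 1 = cm u (ζ0 • b) ((ρ * e) • b) - (1 + κ) * Real.log ‖ζ0‖ := by
      have e1 : G = fun ζ => (fun ζ : ℂ => u (ζ0 • b + ζ • ((ρ * e) • b))) ζ - (fun ζ : ℂ => (1 + κ) * Real.log ‖(‖ζ0‖ : ℂ) + ρ * ζ‖) ζ :=
        funext hGe
      rw [e1, Real.circleAverage_fun_sub hi1 hi2]
      have h3 := Real.circleAverage_fun_smul (a := 1 + κ) (f := fun ζ : ℂ => Real.log ‖(‖ζ0‖ : ℂ) + ρ * ζ‖) (c := 0) (R := 1)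
      simp only [smul_eq_mul] at h3
      rw [h3, log_mean hρ (by simp [ρ, hs])]; rfl
    have h5 := hu.sub (ζ0 • b) ((ρ * e) • b)
    have h6 : F ζ0 = u (ζ0 • b) - (1 + κ) * Real.log ‖ζ0‖ := rfl
    linarith
  have hl : 0 ≤ Real.log (‖z‖ / s) := Real.log_nonneg (by rwa [one_le_div hs])
  refine le_of_forall_pos_le_add fun ε hε => ?_
  have h1 := key (ε / (1 + Real.log (‖z‖ / s))) (by positivity)
  have h2 : ε / (1 + Real.log (‖z‖ / s)) * Real.log (‖z‖ / s) ≤ ε := by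
    rw [div_mul_eq_mul_div, div_le_iff₀ (by positivity)]; nlinarith
  linarith
lemma BW1 (hu : InLs 1 u) {M : ℝ} (hM : ∀ z ∈ ball (0 : EE m) 1, u z ≤ M) (z : EE m) :
    u z ≤ M + 1 + Real.log (1 + ‖z‖) := by
  rcases lt_or_ge ‖z‖ (1/2) with h | h
  · linarith [hM z (by simp; linarith), log1_nonneg z]
  · have := BW hu (by norm_num) (fun w hw => hM w (by simp; rw [hw]; norm_num)) h
    refine this.trans ?_
    rw [div_div_eq_mul_div, div_one, Real.log_mul (by linarith) (by norm_num)]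
    have h2 : Real.log ‖z‖ ≤ Real.log (1 + ‖z‖) := Real.log_le_log (by linarith) (by linarith)
    linarith [Real.log_two_lt_d9]
end
end
section
section
variable {m : ℕ} {u v : EE m → ℝ} {c d : ℝ}
lemma int_clin (T : EE m →ₗ[ℂ] EE m) (hT : LinearMap.det T ≠ 0) (f : EE m → ℝ) :
    ∫ y, f (T y) = (‖LinearMap.det T‖ ^ 2)⁻¹ * ∫ y, f y := by
  have hd : LinearMap.det (T.restrictScalars ℝ) = ‖LinearMap.det T‖ ^ 2 := by
    rw [LinearMap.det_restrictScalars, Algebra.norm_complex_apply, Complex.normSq_eq_norm_sq]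
  have hd0 : LinearMap.det (T.restrictScalars ℝ) ≠ 0 := by rw [hd]; simpa using hT
  have h1 := Measure.map_linearMap_addHaar_eq_smul_addHaar (μ := (volume : Measure (EE m))) hd0
  have hemb : MeasurableEmbedding (T.restrictScalars ℝ) :=
    ((LinearEquiv.ofIsUnitDet (f := T.restrictScalars ℝ) (v := Module.finBasis ℝ _)
      (v' := Module.finBasis ℝ _) (by rw [LinearMap.det_toMatrix]; exact hd0.isUnit)).toContinuousLinearEquiv.toHomeomorph).measurableEmbedding
  have h2 := hemb.integral_map (μ := volume) f
  rw [h1, integral_smul_measure, hd, ENNReal.toReal_ofReal (abs_nonneg _), abs_of_nonneg (by positivity)] at h2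
  exact h2.symm
lemma int_rot (ζ : ℂ) (hζ : ‖ζ‖ = 1) (f : EE m → ℝ) : ∫ y, f (ζ • y) = ∫ y, f y := by
  have h := int_clin (m := m) (ζ • LinearMap.id) (by
    rw [LinearMap.det_smul]; simp; rintro rfl; simp at hζ) f
  simpa [LinearMap.det_smul, hζ] using h
lemma cswap {G : ℂ → EE m → ℝ} (hm : Measurable (Function.uncurry G)) {C R : ℝ}
    (hb : ∀ ζ y, ‖ζ‖ = 1 → |G ζ y| ≤ C) (hs : ∀ ζ y, R < ‖y‖ → G ζ y = 0) :
    Real.circleAverage (fun ζ => ∫ y, G ζ y) 0 1 = ∫ y, Real.circleAverage (fun ζ => G ζ y) 0 1 := by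
  simp only [Real.circleAverage_def, smul_eq_mul, integral_const_mul,
    intervalIntegral.integral_of_le Real.two_pi_pos.le]
  congr 1
  refine integral_integral_swap ?_
  have hR : ∀ ζ y, G ζ y = (closedBall (0 : EE m) R).indicator (G ζ) y := by
    intro ζ y
    by_cases h : y ∈ closedBall (0 : EE m) R
    · simp [h]
    · rw [indicator_of_notMem h, hs ζ y (by simpa using h)]
  have hmeas : Measurable (Function.uncurry fun (θ : ℝ) y => G (circleMap 0 1 θ) y) := by
    refine hm.comp (f := fun p : ℝ × EE m => (circleMap 0 1 p.1, p.2)) ?_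
    exact ((continuous_circleMap 0 1).measurable.comp measurable_fst).prodMk measurable_snd
  have : (Function.uncurry fun (θ : ℝ) y => G (circleMap 0 1 θ) y) =
      (Set.univ ×ˢ closedBall (0 : EE m) R).indicator (Function.uncurry fun (θ : ℝ) y => G (circleMap 0 1 θ) y) := by
    funext ⟨θ, y⟩
    by_cases h : y ∈ closedBall (0 : EE m) R
    · simp [indicator, h]
    · rw [indicator_of_notMem (by simpa using h)]; exact hs _ y (by simpa using h)
  rw [this, integrable_indicator_iff (MeasurableSet.univ.prod measurableSet_closedBall)]
  refine Measure.integrableOn_of_bounded (M := C) ?_ hmeas.aestronglyMeasurable ?_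
  · rw [Measure.prod_prod]
    exact ENNReal.mul_ne_top (by simpa using ENNReal.mul_ne_top (by simp) (by simp)) (measure_closedBall_lt_top.ne)
  · exact Eventually.of_forall fun p => hb _ _ (norm_circ _)
lemma LB.locInt (hu : LB u) : LocallyIntegrable u volume := by
  intro x
  refine ⟨closedBall x 1, closedBall_mem_nhds x one_pos, ?_⟩
  obtain ⟨C, hC⟩ := hu.bdd (‖x‖ + 1)
  refine Measure.integrableOn_of_bounded (M := C) measure_closedBall_lt_top.ne hu.meas.aestronglyMeasurable ?_
  refine (ae_restrict_iff' measurableSet_closedBall).2 (Eventually.of_forall fun y hy => hC y ?_)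
  have := norm_sub_norm_le y x
  rw [← dist_eq_norm] at this
  linarith [mem_closedBall.1 hy]
lemma LB.shift (hu : LB u) (a : EE m) (τ : ℝ) : LB fun y => u (a + τ • y) := by
  refine ⟨hu.meas.comp (by fun_prop), fun r => ?_⟩
  obtain ⟨C, hC⟩ := hu.bdd (‖a‖ + |τ| * r)
  refine ⟨C, fun y hy => hC _ ((norm_add_le _ _).trans ?_)⟩
  rw [norm_smul, Real.norm_eq_abs]
  gcongr
lemma LB.mul (hu : LB u) (hv : LB v) : LB fun z => u z * v z := by
  refine ⟨hu.meas.mul hv.meas, fun r => ?_⟩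
  obtain ⟨C, hC⟩ := hu.bdd r
  obtain ⟨D, hD⟩ := hv.bdd r
  refine ⟨C * D, fun z hz => ?_⟩
  rw [abs_mul]
  exact mul_le_mul (hC z hz) (hD z hz) (abs_nonneg _) ((abs_nonneg _).trans (hC z hz))
lemma LB.int (hu : LB u) {R : ℝ} (hs : ∀ y, R < ‖y‖ → u y = 0) : Integrable u := by
  have h : u = (closedBall (0 : EE m) R).indicator u := by
    funext y
    by_cases h : y ∈ closedBall (0 : EE m) R
    · simp [h]
    · rw [indicator_of_notMem h, hs y (by simpa using h)]
  rw [h, integrable_indicator_iff measurableSet_closedBall]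
  exact (hu.locInt.integrableOn_isCompact (isCompact_closedBall _ _))
lemma mean_weight (hu : LB u) (su : SubM u) {w : EE m → ℝ} (hw : LB w) (w0 : ∀ y, 0 ≤ w y)
    {R : ℝ} (hs : ∀ y, R < ‖y‖ → w y = 0) (hc : ∀ (ζ : ℂ) y, ‖ζ‖ = 1 → w (ζ • y) = w y) (a : EE m) :
    u a * ∫ y, w y ≤ ∫ y, w y * u (a + y) := by
  have hua : LB fun y => u (a + y) := by simpa using hu.shift a 1
  obtain ⟨C, hC⟩ := hw.bdd R
  obtain ⟨D, hD⟩ := hu.bdd (‖a‖ + R)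
  have hC0 : 0 ≤ |C| * |D| := by positivity
  have key : ∫ y, w y * u (a + y) = ∫ y, w y * cm u a y := by
    have h1 : ∀ ζ : ℂ, ‖ζ‖ = 1 → ∫ y, w y * u (a + ζ • y) = ∫ y, w y * u (a + y) := by
      intro ζ hζ
      rw [← int_rot ζ hζ (fun y => w y * u (a + y))]
      simp only [hc ζ _ hζ]
    have h2 : Real.circleAverage (fun ζ : ℂ => ∫ y, w y * u (a + ζ • y)) 0 1
        = ∫ y, w y * u (a + y) := by
      rw [Real.circleAverage_congr_sphere (f₂ := fun _ => ∫ y, w y * u (a + y)) (fun ζ hζ => h1 ζ (by simpa using hζ)),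
        Real.circleAverage_const]
    rw [← h2, cswap (C := |C| * |D|) (R := R)]
    · refine integral_congr_ae (Eventually.of_forall fun y => ?_)
      have := Real.circleAverage_fun_smul (a := w y) (f := fun ζ : ℂ => u (a + ζ • y)) (c := 0) (R := 1)
      simpa [cm] using this
    · exact (hw.meas.comp measurable_snd).mul (hu.meas.comp (by fun_prop))
    · intro ζ y hζ
      by_cases h : R < ‖y‖
      · rw [hs y h]; simpa using hC0
      · rw [abs_mul]
        refine mul_le_mul ((hC y (by linarith)).trans (le_abs_self C)) ((hD _ ?_).trans (le_abs_self D)) (abs_nonneg _) (abs_nonneg _)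
        refine (norm_add_le _ _).trans ?_
        rw [norm_smul, hζ]; linarith
    · intro ζ y h
      simp [hs y h]
  have hcm : Integrable fun y => w y * cm u a y := by
    have : LB fun y => w y * cm u a y := by
      refine hw.mul ⟨?_, fun r => ?_⟩
      · unfold cm
        simp only [Real.circleAverage_def, smul_eq_mul,
          intervalIntegral.integral_of_le Real.two_pi_pos.le]
        refine Measurable.const_mul ?_ _
        refine StronglyMeasurable.measurable ?_
        refine StronglyMeasurable.integral_prod_right (f := fun (y : EE m) (θ : ℝ) => u (a + circleMap 0 1 θ • y)) ?_
        refine (hu.meas.comp ?_).stronglyMeasurable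
        have : Continuous fun p : EE m × ℝ => a + circleMap 0 1 p.2 • p.1 := by fun_prop
        exact this.measurable
      · obtain ⟨K, hK⟩ := hu.bdd (‖a‖ + r)
        refine ⟨K, fun y hy => ?_⟩
        have hb : ∀ ζ : ℂ, ‖ζ‖ = 1 → |u (a + ζ • y)| ≤ K := fun ζ hζ => hK _ (by
          refine (norm_add_le _ _).trans ?_
          rw [norm_smul, hζ]; linarith)
        rw [abs_le]
        constructor
        · rw [← cm_const (-K) a y]
          exact cm_mono (LB.const _) hu fun ζ hζ => (abs_le.1 (hb ζ hζ)).1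
        · exact cm_le hu fun ζ hζ => (abs_le.1 (hb ζ hζ)).2
    exact this.int (R := R) fun y hy => by simp [hs y hy]
  rw [key, mul_comm, ← integral_mul_const]
  exact integral_mono ((hw.mul (LB.const (u a))).int (R := R) fun y hy => by simp [hs y hy]) hcm
    fun y => mul_le_mul_of_nonneg_left (su a y) (w0 y)
def krn0 (y : EE m) : ℝ := Real.smoothTransition (1 - ‖y‖ ^ 2)
lemma krn0_smooth : ContDiff ℝ ∞ (krn0 (m := m)) :=
  Real.smoothTransition.contDiff.comp (contDiff_const.sub (contDiff_norm_sq ℂ))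
lemma krn0_supp (y : EE m) (h : 1 ≤ ‖y‖) : krn0 y = 0 :=
  Real.smoothTransition.zero_of_nonpos (by nlinarith)
lemma krn0_pos : 0 < ∫ y, krn0 (m := m) y := by
  refine krn0_smooth.continuous.integral_pos_of_hasCompactSupport_nonneg_nonzero ?_ (fun y => Real.smoothTransition.nonneg _) (x := 0) ?_
  · exact HasCompactSupport.intro (isCompact_closedBall (0 : EE m) 1) fun y hy => krn0_supp y (by simp at hy; exact hy.le)
  · simp [krn0]
def krn (y : EE m) : ℝ := (∫ y, krn0 (m := m) y)⁻¹ * krn0 y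
lemma krn_smooth : ContDiff ℝ ∞ (krn (m := m)) := contDiff_const.mul krn0_smooth
lemma krn_supp (y : EE m) (h : 1 ≤ ‖y‖) : krn y = 0 := by simp [krn, krn0_supp y h]
lemma krn_nonneg (y : EE m) : 0 ≤ krn y :=
  mul_nonneg (inv_nonneg.2 krn0_pos.le) (Real.smoothTransition.nonneg _)
lemma krn_one : ∫ y, krn (m := m) y = 1 := by
  simp only [krn, integral_const_mul]; exact inv_mul_cancel₀ krn0_pos.ne'
lemma krn_lb : LB (krn (m := m)) := krn_smooth.continuous.lb
lemma krn_circ (ζ : ℂ) (y : EE m) (h : ‖ζ‖ = 1) : krn (ζ • y) = krn y := by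
  simp [krn, krn0, norm_smul, h]
lemma krn_neg (y : EE m) : krn (-y) = krn y := by simp [krn, krn0]
def mol (τ : ℝ) (u : EE m → ℝ) (z : EE m) : ℝ := ∫ y, krn y * u (z + τ • y)
lemma mol_int (hu : LB u) (τ : ℝ) (z : EE m) : Integrable fun y => krn y * u (z + τ • y) :=
  (krn_lb.mul (hu.shift z τ)).int (R := 1) fun y hy => by simp [krn_supp y hy.le]
lemma mol_mono_on (hu : LB u) (hv : LB v) {τ : ℝ} (hτ : 0 ≤ τ) {z : EE m}
    (h : ∀ y, dist y z ≤ τ → u y ≤ v y) :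
    mol τ u z ≤ mol τ v z := by
  refine integral_mono (mol_int hu τ z) (mol_int hv τ z) fun y => ?_
  rcases le_or_gt 1 ‖y‖ with h1 | h1
  · simp [krn_supp y h1]
  · refine mul_le_mul_of_nonneg_left (h _ ?_) (krn_nonneg y)
    rw [dist_eq_norm, add_sub_cancel_left, norm_smul, Real.norm_eq_abs, abs_of_nonneg hτ]
    nlinarith
lemma mol_const (τ t : ℝ) (z : EE m) : mol τ (fun _ => t) z = t := by
  simp [mol, integral_mul_const, krn_one]
lemma mol_le (hu : LB u) {τ S : ℝ} (hτ : 0 ≤ τ) {z : EE m} (h : ∀ y, dist y z ≤ τ → u y ≤ S) :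
    mol τ u z ≤ S := (mol_mono_on hu (LB.const S) hτ h).trans_eq (mol_const τ S z)
lemma le_mol' (hu : LB u) {τ S : ℝ} (hτ : 0 ≤ τ) {z : EE m} (h : ∀ y, dist y z ≤ τ → S ≤ u y) :
    S ≤ mol τ u z := (mol_const τ S z).symm.trans_le (mol_mono_on (LB.const S) hu hτ h)
lemma mol_add (hu : LB u) (hv : LB v) (τ : ℝ) (z : EE m) :
    mol τ (fun z => u z + v z) z = mol τ u z + mol τ v z := by
  simp only [mol, mul_add]
  exact integral_add (mol_int hu τ z) (mol_int hv τ z)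
lemma mol_smul (t : ℝ) (u : EE m → ℝ) (τ : ℝ) (z : EE m) :
    mol τ (fun z => t * u z) z = t * mol τ u z := by
  simp only [mol, ← integral_const_mul]; congr 1; funext y; ring
lemma le_mol (hu : LB u) (su : SubM u) (τ : ℝ) (z : EE m) : u z ≤ mol τ u z := by
  have h := mean_weight (u := fun y => u (z + τ • y)) (hu.shift z τ)
    (fun a b => by simpa [cm, add_assoc, smul_comm τ] using su (z + τ • a) (τ • b)) krn_lb krn_nonneg (R := 1)
    (fun y hy => krn_supp y hy.le) krn_circ 0
  simpa [krn_one, mol] using h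
lemma mol_eq_conv {τ : ℝ} (hτ : 0 < τ) (u : EE m → ℝ) (z : EE m) :
    mol τ u z = ∫ y, u y * ((τ ^ Module.finrank ℝ (EE m))⁻¹ * krn (τ⁻¹ • (z - y))) := by
  have h1 := Measure.integral_comp_smul_of_nonneg (volume : Measure (EE m))
    (fun y => u (z + y) * ((τ ^ Module.finrank ℝ (EE m))⁻¹ * krn (τ⁻¹ • -y))) τ (hR := hτ.le)
  have h2 : ∀ y : EE m, τ⁻¹ • -(τ • y) = -y := fun y => by rw [smul_neg, smul_smul, inv_mul_cancel₀ hτ.ne', one_smul]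
  simp only [h2, krn_neg] at h1
  have hp : τ ^ Module.finrank ℝ (EE m) ≠ 0 := by positivity
  have h3 : mol τ u z = τ ^ Module.finrank ℝ (EE m) * ∫ y, u (z + τ • y) * ((τ ^ Module.finrank ℝ (EE m))⁻¹ * krn y) := by
    rw [← integral_const_mul, mol]; congr 1; funext y; field_simp
  rw [h3, h1, smul_eq_mul, mul_inv_cancel_left₀ hp,
    ← integral_add_left_eq_self (fun y => u y * ((τ ^ Module.finrank ℝ (EE m))⁻¹ * krn (τ⁻¹ • (z - y)))) z]
  simp
lemma mol_smooth (hu : LB u) {τ : ℝ} (hτ : 0 < τ) : ContDiff ℝ ∞ (mol τ u) := by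
  have h : mol τ u = convolution u (fun y => (τ ^ Module.finrank ℝ (EE m))⁻¹ * krn (τ⁻¹ • y))
      (ContinuousLinearMap.mul ℝ ℝ) volume := by
    funext z; rw [mol_eq_conv hτ]; rfl
  rw [h]
  refine HasCompactSupport.contDiff_convolution_right _ ?_ hu.locInt ?_
  · refine HasCompactSupport.intro (isCompact_closedBall (0 : EE m) τ) fun y hy => ?_
    rw [krn_supp, mul_zero]
    simp at hy
    rw [norm_smul, norm_inv, Real.norm_eq_abs, abs_of_pos hτ, inv_mul_eq_div, one_le_div hτ]
    exact hy.le
  · exact contDiff_const.mul (krn_smooth.comp (contDiff_id.const_smul τ⁻¹))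
lemma mol_cont (hu : LB u) {τ : ℝ} (hτ : 0 < τ) : Continuous (mol τ u) := (mol_smooth hu hτ).continuous
lemma mol_sub (hu : LB u) (su : SubM u) (τ : ℝ) : SubM (mol τ u) := by
  intro a b
  obtain ⟨C, hC⟩ := krn_lb.bdd (m := m) 1
  obtain ⟨D, hD⟩ := hu.bdd (‖a‖ + ‖b‖ + |τ|)
  have hC0 : 0 ≤ |C| * |D| := by positivity
  have h : cm (mol τ u) a b = ∫ y, krn y * cm u (a + τ • y) b := by
    unfold cm mol
    rw [cswap (C := |C| * |D|) (R := 1)]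
    · refine integral_congr_ae (Eventually.of_forall fun y => ?_)
      have := Real.circleAverage_fun_smul (a := krn y) (f := fun ζ : ℂ => u (a + τ • y + ζ • b)) (c := 0) (R := 1)
      simpa [add_right_comm] using this
    · exact (krn_lb.meas.comp measurable_snd).mul (hu.meas.comp (by fun_prop))
    · intro ζ y hζ
      by_cases h : 1 < ‖y‖
      · rw [krn_supp y h.le]; simpa using hC0
      · rw [abs_mul]
        refine mul_le_mul ((hC y (by linarith)).trans (le_abs_self C)) ((hD _ ?_).trans (le_abs_self D)) (abs_nonneg _) (abs_nonneg _)
        refine (norm_add₃_le).trans ?_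
        rw [norm_smul, norm_smul, hζ, Real.norm_eq_abs]; nlinarith [abs_nonneg τ]
    · intro ζ y h
      simp [krn_supp y h.le]
  by_cases hi : Integrable fun y => krn y * cm u (a + τ • y) b
  · rw [h]
    exact integral_mono (mol_int hu τ a) hi fun y => mul_le_mul_of_nonneg_left (su _ b) (krn_nonneg y)
  · refine absurd ?_ hi
    have hm : Measurable fun y => cm u (a + τ • y) b := by
      unfold cm
      simp only [Real.circleAverage_def, smul_eq_mul,
        intervalIntegral.integral_of_le Real.two_pi_pos.le]
      refine Measurable.const_mul (StronglyMeasurable.measurable ?_) _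
      refine StronglyMeasurable.integral_prod_right (f := fun (y : EE m) (θ : ℝ) => u (a + τ • y + circleMap 0 1 θ • b)) ?_
      refine (hu.meas.comp ?_).stronglyMeasurable
      have : Continuous fun p : EE m × ℝ => a + τ • p.1 + circleMap 0 1 p.2 • b := by fun_prop
      exact this.measurable
    have hl : LB fun y => cm u (a + τ • y) b := by
      refine ⟨hm, fun r => ?_⟩
      obtain ⟨K, hK⟩ := hu.bdd (‖a‖ + |τ| * r + ‖b‖)
      refine ⟨K, fun y hy => ?_⟩
      have hb : ∀ ζ : ℂ, ‖ζ‖ = 1 → |u (a + τ • y + ζ • b)| ≤ K := fun ζ hζ => hK _ (by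
        refine (norm_add₃_le).trans ?_
        rw [norm_smul, norm_smul, hζ, Real.norm_eq_abs]; nlinarith [abs_nonneg τ])
      rw [abs_le]
      constructor
      · rw [← cm_const (-K) (a + τ • y) b]
        exact cm_mono (LB.const _) hu fun ζ hζ => (abs_le.1 (hb ζ hζ)).1
      · exact cm_le hu fun ζ hζ => (abs_le.1 (hb ζ hζ)).2
    exact (krn_lb.mul hl).int (R := 1) fun y hy => by simp [krn_supp y hy.le]
lemma mol_lim {z₀ : EE m} (hu : LB u) (su : SubM u) (h : UpperSemicontinuousAt u z₀) :
    Tendsto (fun τ => mol τ u z₀) (𝓝[>] 0) (𝓝 (u z₀)) := by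
  rw [tendsto_order]
  refine ⟨fun a ha => Eventually.of_forall fun τ => ha.trans_le (le_mol hu su τ z₀), fun a ha => ?_⟩
  obtain ⟨b, hb, hba⟩ := exists_between ha
  obtain ⟨δ, hδ, hh⟩ := Metric.eventually_nhds_iff.1 (h b hb)
  filter_upwards [Ioo_mem_nhdsGT hδ] with τ hτ
  exact (mol_le hu hτ.1.le fun y hy => (hh (hy.trans_lt hτ.2)).le).trans_lt hba
end
end
open Matrix
section
section alg
variable {ι A : Type*} [Fintype ι] [DecidableEq ι] [CommRing A]
open Matrix Polynomial
structure Dr (A : Type*) [CommRing A] extends A →+ A where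
  leib : ∀ a b : A, toFun (a * b) = a * toFun b + b * toFun a
instance : FunLike (Dr A) A A := ⟨fun d => d.toFun, fun a b h => by
  obtain ⟨a, _⟩ := a; obtain ⟨b, _⟩ := b; congr; exact DFunLike.coe_injective h⟩
instance : AddMonoidHomClass (Dr A) A A := { map_add := fun d => d.map_add', map_zero := fun d => d.map_zero' }
lemma Dr.leibniz (d : Dr A) (a b : A) : d (a * b) = a * d b + b * d a := d.leib a b
lemma Dr.one (d : Dr A) : d 1 = 0 := by simpa using d.leibniz 1 1
lemma der_prod {κ : Type*} [DecidableEq κ] (d : Dr A) (s : Finset κ) (f : κ → A) :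
    d (∏ i ∈ s, f i) = ∑ i ∈ s, ∏ j ∈ s, Function.update f i (d (f i)) j := by
  induction s using Finset.induction_on with
  | empty => simp [Dr.one]
  | insert a s ha ih =>
    rw [Finset.prod_insert ha, d.leibniz, ih, Finset.sum_insert ha, Finset.prod_insert ha]
    have h1 : ∏ j ∈ s, Function.update f a (d (f a)) j = ∏ j ∈ s, f j :=
      Finset.prod_congr rfl fun j hj => by rw [Function.update_of_ne (by rintro rfl; exact ha hj)]
    have h2 : ∀ i ∈ s, ∏ j ∈ insert a s, Function.update f i (d (f i)) j
        = f a * ∏ j ∈ s, Function.update f i (d (f i)) j := fun i hi => by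
      rw [Finset.prod_insert ha, Function.update_of_ne (by rintro rfl; exact ha hi)]
    rw [Finset.sum_congr rfl h2, ← Finset.mul_sum, h1]
    simp only [Function.update_self]
    ring
lemma der_det (d : Dr A) (M : Matrix ι ι A) :
    d M.det = ∑ l, (M.updateRow l fun j => d (M l j)).det := by
  have h : ∀ N : Matrix ι ι A, N.det = ∑ σ : Equiv.Perm ι, (Equiv.Perm.sign σ : ℤ) • ∏ i, N i (σ i) := fun N => by
    rw [← det_transpose, det_apply]; simp [Units.smul_def]
  rw [h, map_sum]
  simp only [h, map_zsmul, der_prod]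
  rw [Finset.sum_comm]
  refine Finset.sum_congr rfl fun σ _ => ?_
  rw [Finset.smul_sum]
  refine Finset.sum_congr rfl fun l _ => ?_
  congr 1
  refine Finset.prod_congr rfl fun j _ => ?_
  by_cases hj : j = l
  · subst hj; simp
  · rw [Function.update_of_ne hj, updateRow_ne hj]
lemma det_updateRow_adj (M : Matrix ι ι A) (l : ι) (w : ι → A) :
    (M.updateRow l w).det = ∑ j, adjugate M j l * w j := by
  rw [det_eq_sum_mul_adjugate_row _ l]
  refine Finset.sum_congr rfl fun j _ => ?_
  rw [updateRow_self, mul_comm, adjugate_apply, adjugate_apply, updateRow_idem]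
lemma der_det' (d : Dr A) (M : Matrix ι ι A) :
    d M.det = (adjugate M * M.map d).trace := by
  rw [der_det, trace]
  simp only [det_updateRow_adj, diag_apply, mul_apply, map_apply]
  rw [Finset.sum_comm]
lemma adj_div [Algebra ℂ A] (d : ι → Dr A) (M : Matrix ι ι A)
    (hs : ∀ l r j, d l (M r j) = d r (M l j)) (i : ι) : ∑ l, d l (adjugate M i l) = 0 := by
  set N : ι → ι → A := fun l r =>
    ((M.updateRow l (Pi.single i 1)).updateRow r fun j => d l (M.updateRow l (Pi.single i 1) r j)).det
  have h1 : ∀ l, d l (adjugate M i l) = ∑ r, N l r := fun l => by rw [adjugate_apply, der_det]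
  have h2 : ∀ l r, N l r = - N r l := by
    intro l r
    by_cases h : r = l
    · subst h
      have : N r r = 0 := by
        refine det_eq_zero_of_row_eq_zero r fun j => ?_
        rw [updateRow_self, updateRow_self]
        by_cases hj : j = i
        · subst hj; simp [Dr.one]
        · simp [hj]
      rw [this, neg_zero]
    · simp only [N]
      have e := det_permute (Equiv.swap l r) ((M.updateRow r (Pi.single i 1)).updateRow l fun j => d r (M.updateRow r (Pi.single i 1) l j))
      rw [Equiv.Perm.sign_swap (Ne.symm h)] at e
      have : - det ((M.updateRow r (Pi.single i 1)).updateRow l fun j => d r (M.updateRow r (Pi.single i 1) l j)) = (((M.updateRow r (Pi.single i 1)).updateRow l fun j => d r (M.updateRow r (Pi.single i 1) l j)).submatrix (Equiv.swap l r) id).det := by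
        rw [e]; simp
      rw [this]
      congr 1
      ext a b
      simp only [submatrix_apply, id]
      by_cases ha : a = l
      · subst ha; simp [updateRow_ne h, updateRow_ne (Ne.symm h)]
      · by_cases hb : a = r
        · subst hb; simp [updateRow_ne h, updateRow_ne (Ne.symm h), hs]
        · simp [Equiv.swap_apply_of_ne_of_ne ha hb, updateRow_ne ha, updateRow_ne hb]
  have h3 : ∑ l, d l (adjugate M i l) = - ∑ l, d l (adjugate M i l) := by
    simp only [h1]
    nth_rewrite 1 [Finset.sum_comm]
    rw [← Finset.sum_neg_distrib]
    refine Finset.sum_congr rfl fun l _ => ?_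
    rw [← Finset.sum_neg_distrib]
    exact Finset.sum_congr rfl fun r _ => h2 r l
  set S := ∑ l, d l (adjugate M i l)
  have h4 : (2 : ℂ) • S = 0 := by rw [two_smul]; nth_rewrite 1 [h3]; simp
  simpa using h4
def pen (P Q : Matrix ι ι A) : Matrix ι ι A[X] := (X : A[X]) • Q.map C + P.map C
def Tc (P Q : Matrix ι ι A) (i : ℕ) : Matrix ι ι A := (adjugate (pen P Q)).map (fun p => p.coeff i)
def dc (P Q : Matrix ι ι A) (i : ℕ) : A := (pen P Q).det.coeff i
lemma tr_coeff (N : Matrix ι ι A[X]) (Q : Matrix ι ι A) (i : ℕ) :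
    (N * Q.map C).trace.coeff i = (N.map (fun p => p.coeff i) * Q).trace := by
  simp [trace, mul_apply, finsetSum_coeff]
def dX : Dr A[X] where
  toFun := derivative
  map_zero' := by simp
  map_add' := by simp
  leib := fun a b => by rw [derivative_mul]; ring
def dCof (d : Dr A) (p : A[X]) : A[X] := ∑ n ∈ Finset.range (p.natDegree + 1), monomial n (d (p.coeff n))
lemma dCof_coeff (d : Dr A) (p : A[X]) (n : ℕ) : (dCof d p).coeff n = d (p.coeff n) := by
  simp only [dCof, finsetSum_coeff, coeff_monomial, Finset.sum_ite_eq', Finset.mem_range]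
  split_ifs with h
  · rfl
  · rw [coeff_eq_zero_of_natDegree_lt (by omega), map_zero]
def dCo (d : Dr A) : Dr A[X] where
  toFun p := dCof d p
  map_zero' := by ext n; simp [dCof_coeff]
  map_add' := fun p q => by ext n; simp [dCof_coeff]
  leib := fun p q => by
    ext n
    rw [dCof_coeff, coeff_add, coeff_mul, map_sum, coeff_mul, mul_comm q, coeff_mul, ← Finset.sum_add_distrib]
    refine Finset.sum_congr rfl fun x _ => ?_
    rw [dCof_coeff, dCof_coeff, d.leibniz]; ring
lemma dCo_coeff (d : Dr A) (p : A[X]) (n : ℕ) : (dCo d p).coeff n = d (p.coeff n) := dCof_coeff d p n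
lemma tr_TB (P Q : Matrix ι ι A) (i : ℕ) : (Tc P Q i * Q).trace = (i + 1) * dc P Q (i + 1) := by
  have h := der_det' (dX (A := A)) (pen P Q)
  have h2 : (pen P Q).map (dX (A := A)) = Q.map C := by
    ext1 a b
    change derivative (pen P Q a b) = _
    simp [pen]
  have h' : derivative (pen P Q).det = (adjugate (pen P Q) * Q.map C).trace := by
    rw [← h2]; exact h
  have h3 := congrArg (fun p => p.coeff i) h'
  simp only [tr_coeff] at h3
  rw [Tc, ← h3]
  simp [dc, coeff_derivative, mul_comm]
lemma tr_TA (P Q : Matrix ι ι A) (i : ℕ) : (Tc P Q i * P).trace = ((Fintype.card ι : A) - i) * dc P Q i := by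
  have h := congrArg Matrix.trace (adjugate_mul (pen P Q))
  have h1 : adjugate (pen P Q) * pen P Q = (X : A[X]) • (adjugate (pen P Q) * Q.map C) + adjugate (pen P Q) * P.map C := by
    rw [pen, mul_add, mul_smul_comm]
  rw [h1, trace_add, trace_smul, trace_smul, trace_one] at h
  have h3 := congrArg (fun p => p.coeff i) h
  simp only [coeff_add, tr_coeff, smul_eq_mul, coeff_mul_natCast] at h3
  have h4 : ((X : A[X]) * (adjugate (pen P Q) * Q.map C).trace).coeff i = i * dc P Q i := by
    cases i with
    | zero => simp
    | succ k => rw [coeff_X_mul, tr_coeff]; exact_mod_cast tr_TB P Q k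
  rw [h4] at h3
  change _ + (Tc P Q i * P).trace = dc P Q i * _ at h3
  linear_combination h3
lemma dc_zero (P Q : Matrix ι ι A) : dc P Q 0 = P.det := coeff_det_X_add_C_zero Q P
lemma dc_card (P Q : Matrix ι ι A) : dc P Q (Fintype.card ι) = Q.det := coeff_det_X_add_C_card Q P
lemma dc_eval (P Q : Matrix ι ι A) (t : A) :
    (P + t • Q).det = ∑ i ∈ Finset.range (Fintype.card ι + 1), dc P Q i * t ^ i := by
  have h := (evalRingHom t).map_det (pen P Q)
  have h2 : (evalRingHom t).mapMatrix (pen P Q) = P + t • Q := by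
    ext a b; simp [pen]; ring
  rw [h2] at h
  rw [← h, coe_evalRingHom]
  unfold pen
  rw [eval_eq_sum_range' (Nat.lt_succ_of_le (natDegree_det_X_add_C_le Q P))]
  rfl
lemma Tc_map {B : Type*} [CommRing B] (f : A →+* B) (P Q : Matrix ι ι A) (i : ℕ) :
    (Tc P Q i).map f = Tc (P.map f) (Q.map f) i := by
  have h := (mapRingHom f).map_adjugate (pen P Q)
  have h2 : (mapRingHom f).mapMatrix (pen P Q) = pen (P.map f) (Q.map f) := by
    ext1 a b; simp [pen]
  rw [h2] at h
  ext a b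
  have h3 := congrArg (fun N => (N a b).coeff i) h
  simpa [Tc] using h3
lemma dc_map {B : Type*} [CommRing B] (f : A →+* B) (P Q : Matrix ι ι A) (i : ℕ) :
    f (dc P Q i) = dc (P.map f) (Q.map f) i := by
  have h := (mapRingHom f).map_det (pen P Q)
  have h2 : (mapRingHom f).mapMatrix (pen P Q) = pen (P.map f) (Q.map f) := by
    ext1 a b; simp [pen]
  rw [h2] at h
  have h3 := congrArg (fun N => N.coeff i) h
  simpa [dc] using h3
lemma Tc_div [Algebra ℂ A] (d : ι → Dr A) (P Q : Matrix ι ι A)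
    (hP : ∀ l r j, d l (P r j) = d r (P l j)) (hQ : ∀ l r j, d l (Q r j) = d r (Q l j)) (k : ℕ) (i : ι) :
    ∑ l, d l (Tc P Q k i l) = 0 := by
  have h := adj_div (fun l => dCo (d l)) (pen P Q) (fun l r j => by
    ext n
    rw [dCo_coeff, dCo_coeff]
    cases n with
    | zero => simp [pen, hP l r j]
    | succ n => simp [pen, coeff_X_mul, coeff_C]; split_ifs <;> simp [hQ l r j]) i
  have h2 := congrArg (fun p => p.coeff k) h
  simpa [finsetSum_coeff, dCo_coeff, Tc] using h2
end alg
end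
section
section
variable {ι : Type*} [Fintype ι] [DecidableEq ι]
open Matrix Polynomial
lemma psd_spec (Q : Matrix ι ι ℂ) (hQ : Q.PosSemidef) : ∃ (U : Matrix ι ι ℂ) (d : ι → ℝ), (∀ i, 0 ≤ d i) ∧
    U * Uᴴ = 1 ∧ Q = U * diagonal (fun i => (d i : ℂ)) * Uᴴ := by
  refine ⟨hQ.isHermitian.eigenvectorUnitary, hQ.isHermitian.eigenvalues, hQ.eigenvalues_nonneg,
    (Matrix.mem_unitaryGroup_iff).1 (hQ.isHermitian.eigenvectorUnitary).2, ?_⟩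
  conv_lhs => rw [hQ.isHermitian.spectral_theorem]
  rfl
lemma psd_root (Q : Matrix ι ι ℂ) (hQ : Q.PosSemidef) : ∃ B : Matrix ι ι ℂ, Q = Bᴴ * B := by
  obtain ⟨U, d, hd, _, h⟩ := psd_spec Q hQ
  refine ⟨diagonal (fun i => (Real.sqrt (d i) : ℂ)) * Uᴴ, ?_⟩
  rw [h, conjTranspose_mul, conjTranspose_conjTranspose, diagonal_conjTranspose, Matrix.mul_assoc, Matrix.mul_assoc,
    ← Matrix.mul_assoc (diagonal _), diagonal_mul_diagonal]
  congr 3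
  ext i
  simp only [Pi.star_apply, RCLike.star_def, Complex.conj_ofReal]
  rw [← Complex.ofReal_mul, Real.mul_self_sqrt (hd i)]
lemma simdiag (P Q : Matrix ι ι ℂ) (hP : P.PosDef) (hQ : Q.PosSemidef) :
    ∃ (B : Matrix ι ι ℂ) (d : ι → ℝ), (∀ i, 0 ≤ d i) ∧ P = Bᴴ * B ∧
      Q = Bᴴ * diagonal (fun i => (d i : ℂ)) * B := by
  obtain ⟨B, hB⟩ := psd_root P hP.posSemidef
  have hu : IsUnit B.det := by
    have := (Matrix.isUnit_iff_isUnit_det _).1 hP.isUnit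
    rw [hB, det_mul] at this
    exact isUnit_of_mul_isUnit_right this
  have h1 : B⁻¹ * B = 1 := nonsing_inv_mul B hu
  have h2 : Bᴴ * (B⁻¹)ᴴ = 1 := by rw [← conjTranspose_mul, h1, conjTranspose_one]
  have hQ' := hQ.conjTranspose_mul_mul_same B⁻¹
  obtain ⟨U, d, hd, hUU, hs'⟩ := psd_spec _ hQ'
  refine ⟨Uᴴ * B, d, hd, ?_, ?_⟩
  · rw [conjTranspose_mul, conjTranspose_conjTranspose, Matrix.mul_assoc, ← Matrix.mul_assoc U, hUU, Matrix.one_mul, hB]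
  · have e : Q = Bᴴ * ((B⁻¹)ᴴ * Q * B⁻¹) * B := by
      calc Q = 1 * Q * 1 := by simp
        _ = (Bᴴ * (B⁻¹)ᴴ) * Q * (B⁻¹ * B) := by rw [h1, h2]
        _ = _ := by simp only [Matrix.mul_assoc]
    conv_lhs => rw [e, hs']
    rw [conjTranspose_mul, conjTranspose_conjTranspose]
    simp only [Matrix.mul_assoc]
lemma coeff_prod_nonneg {κ : Type*} (s : Finset κ) (d : κ → ℝ) (hd : ∀ i, 0 ≤ d i) (n : ℕ) :
    0 ≤ (∏ i ∈ s, (1 + (X : ℂ[X]) * C (d i : ℂ))).coeff n := by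
  classical
  induction s using Finset.induction_on generalizing n with
  | empty => rw [Finset.prod_empty, coeff_one]; split_ifs <;> simp
  | insert a s ha ih =>
    rw [Finset.prod_insert ha, add_mul, one_mul, coeff_add, mul_assoc]
    refine add_nonneg (ih n) ?_
    cases n with
    | zero => simp
    | succ n =>
      rw [coeff_X_mul, coeff_C_mul]
      exact mul_nonneg (by exact_mod_cast hd a) (ih n)
lemma Tc_psd (P Q : Matrix ι ι ℂ) (hP : P.PosDef) (hQ : Q.PosSemidef) (k : ℕ) : (Tc P Q k).PosSemidef := by
  obtain ⟨B, d, hd, h1, h2⟩ := simdiag P Q hP hQ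
  have e : pen P Q = (Bᴴ).map C * diagonal (fun i => 1 + (X : ℂ[X]) * C (d i : ℂ)) * B.map C := by
    have ed : diagonal (fun i => 1 + (X : ℂ[X]) * C (d i : ℂ)) = (X : ℂ[X]) • (diagonal (fun i => (d i : ℂ))).map C + 1 := by
      ext1 a b
      by_cases h : a = b
      · subst h; simp [add_comm]
      · simp [h]
    rw [ed, pen, mul_add, add_mul, h1, h2, Matrix.map_mul, Matrix.map_mul, Matrix.map_mul]
    simp [smul_mul]
  have ea : Tc P Q k = adjugate B * diagonal (fun i => (∏ j ∈ Finset.univ.erase i, (1 + (X : ℂ[X]) * C (d j : ℂ))).coeff k) * (adjugate B)ᴴ := by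
    rw [Tc, e, adjugate_mul_distrib, adjugate_mul_distrib, adjugate_diagonal, adjugate_conjTranspose]
    have f1 : ∀ M : Matrix ι ι ℂ, adjugate (M.map (C : ℂ →+* ℂ[X])) = (adjugate M).map C := fun M =>
      ((C : ℂ →+* ℂ[X]).map_adjugate M).symm
    rw [f1, f1, ← Matrix.mul_assoc]
    ext a b
    simp [mul_apply, finsetSum_coeff, mul_diagonal, Matrix.mul_apply, diagonal_apply]
  rw [ea]
  refine PosSemidef.mul_mul_conjTranspose_same ?_ _
  refine PosSemidef.diagonal fun i => coeff_prod_nonneg _ d hd k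
lemma trace_mul_nonneg (P Q : Matrix ι ι ℂ) (hP : P.PosSemidef) (hQ : Q.PosSemidef) : 0 ≤ (P * Q).trace := by
  obtain ⟨B, hB⟩ := psd_root Q hQ
  rw [hB, ← Matrix.mul_assoc, trace_mul_comm, ← Matrix.mul_assoc]
  exact (hP.mul_mul_conjTranspose_same B).trace_nonneg
lemma dc_nonneg (P Q : Matrix ι ι ℂ) (hP : P.PosDef) (hQ : Q.PosSemidef) (k : ℕ) : 0 ≤ dc P Q k := by
  cases k with
  | zero => rw [dc_zero]; exact hP.posSemidef.det_nonneg
  | succ k =>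
    have h := trace_mul_nonneg _ _ (Tc_psd P Q hP hQ k) hQ
    rw [tr_TB] at h
    have h' : (0:ℂ) ≤ ((k + 1 : ℝ) : ℂ)⁻¹ * ((k + 1) * dc P Q (k + 1)) := by
      refine mul_nonneg ?_ h
      rw [← Complex.ofReal_inv]
      exact Complex.zero_le_real.2 (by positivity)
    rwa [← mul_assoc, show ((k + 1 : ℝ) : ℂ)⁻¹ * ((k:ℂ) + 1) = 1 by
      push_cast; exact inv_mul_cancel₀ (by exact_mod_cast Nat.succ_ne_zero k), one_mul] at h'
end
end
section
variable {m : ℕ}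
def Sm (m : ℕ) : Subalgebra ℂ (EE m → ℂ) where
  carrier := {f | ContDiff ℝ ∞ f}
  mul_mem' := fun ha hb => by rw [mem_ofPred_eq] at *; exact ContDiff.mul ha hb
  add_mem' := fun ha hb => by rw [mem_ofPred_eq] at *; exact ContDiff.add ha hb
  algebraMap_mem' := fun _ => by rw [mem_ofPred_eq]; exact contDiff_const
def RS (m : ℕ) : Subalgebra ℝ (EE m → ℝ) where
  carrier := {f | ContDiff ℝ ∞ f}
  mul_mem' := fun ha hb => by rw [mem_ofPred_eq] at *; exact ContDiff.mul ha hb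
  add_mem' := fun ha hb => by rw [mem_ofPred_eq] at *; exact ContDiff.add ha hb
  algebraMap_mem' := fun _ => by rw [mem_ofPred_eq]; exact contDiff_const
lemma Sm.cd (f : Sm m) : ContDiff ℝ ∞ (f : EE m → ℂ) := f.2
lemma RS.cd (f : RS m) : ContDiff ℝ ∞ (f : EE m → ℝ) := f.2
lemma Sm.da (f : Sm m) (z : EE m) : DifferentiableAt ℝ (f : EE m → ℂ) z :=
  ((Sm.cd f).differentiable (by simp)) z
lemma RS.da (f : RS m) (z : EE m) : DifferentiableAt ℝ (f : EE m → ℝ) z :=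
  ((RS.cd f).differentiable (by simp)) z
lemma Sm.ct (f : Sm m) : Continuous (f : EE m → ℂ) := (Sm.cd f).continuous
lemma RS.ct (f : RS m) : Continuous (f : EE m → ℝ) := (RS.cd f).continuous
lemma two_le_inf : minSmoothness ℝ 2 ≤ (∞ : WithTop ℕ∞) := by
  rw [minSmoothness_of_isRCLikeNormedField]
  exact WithTop.coe_le_coe.2 (le_top : (2 : ℕ∞) ≤ ⊤)
lemma cd_fd {E : Type*} [NormedAddCommGroup E] [NormedSpace ℝ E] {f : EE m → E} (hf : ContDiff ℝ ∞ f) :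
    ContDiff ℝ ∞ (fderiv ℝ f) := hf.fderiv_right (by simp)
def Dv (v : EE m) : Dr (Sm m) where
  toFun f := ⟨fun z => fderiv ℝ (f : EE m → ℂ) z v, (cd_fd (Sm.cd f)).clm_apply contDiff_const⟩
  map_zero' := by
    apply Subtype.ext; funext z
    change fderiv ℝ (fun _ => (0 : ℂ)) z v = 0
    simp
  map_add' := fun f g => by
    apply Subtype.ext; funext z
    change fderiv ℝ ((f : EE m → ℂ) + (g : EE m → ℂ)) z v = fderiv ℝ (f : EE m → ℂ) z v + fderiv ℝ (g : EE m → ℂ) z v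
    rw [fderiv_add (Sm.da f z) (Sm.da g z)]; rfl
  leib := fun f g => by
    apply Subtype.ext; funext z
    change fderiv ℝ ((f : EE m → ℂ) * (g : EE m → ℂ)) z v = f.1 z * fderiv ℝ (g : EE m → ℂ) z v + g.1 z * fderiv ℝ (f : EE m → ℂ) z v
    rw [fderiv_mul (Sm.da f z) (Sm.da g z)]; rfl
lemma Dv_apply (v : EE m) (f : Sm m) (z : EE m) : (Dv v f : EE m → ℂ) z = fderiv ℝ (f : EE m → ℂ) z v := rfl
lemma Dv_smul (v : EE m) (c : ℂ) (f : Sm m) : Dv v (c • f) = c • Dv v f := by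
  apply Subtype.ext; funext z
  change fderiv ℝ (c • (f : EE m → ℂ)) z v = c • fderiv ℝ (f : EE m → ℂ) z v
  rw [fderiv_const_smul (Sm.da f z)]; rfl
lemma Dv2 (v w : EE m) (f : Sm m) (z : EE m) :
    (Dv v (Dv w f) : EE m → ℂ) z = fderiv ℝ (fderiv ℝ (f : EE m → ℂ)) z v w := by
  rw [Dv_apply]
  change fderiv ℝ (fun z => fderiv ℝ (f : EE m → ℂ) z w) z v = _
  rw [fderiv_clm_apply (((cd_fd (Sm.cd f)).differentiable (by simp)) z) (differentiableAt_const _)]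
  simp
lemma Dv_comm (v w : EE m) (f : Sm m) : Dv v (Dv w f) = Dv w (Dv v f) := by
  apply Subtype.ext; funext z
  rw [Dv2, Dv2]
  exact (((Sm.cd f).contDiffAt).isSymmSndFDerivAt two_le_inf) v w
def Dr.comb {A : Type*} [CommRing A] [Algebra ℂ A] (a b : ℂ) (d e : Dr A) : Dr A where
  toFun f := a • d f + b • e f
  map_zero' := by simp
  map_add' := fun f g => by simp only [map_add, smul_add]; abel
  leib := fun f g => by
    simp only [Dr.leibniz, smul_add, mul_add, Algebra.mul_smul_comm]; abel
lemma Dr.comb_apply {A : Type*} [CommRing A] [Algebra ℂ A] (a b : ℂ) (d e : Dr A) (f : A) :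
  Dr.comb a b d e f = a • d f + b • e f := rfl
def eb (l : Fin m) : EE m := EuclideanSpace.single l (1 : ℂ)
def db (l : Fin m) : Dr (Sm m) := Dr.comb (1/2) (Complex.I/2) (Dv (eb l)) (Dv (Complex.I • eb l))
def dd (l : Fin m) : Dr (Sm m) := Dr.comb (1/2) (-(Complex.I/2)) (Dv (eb l)) (Dv (Complex.I • eb l))
lemma comb_comm (a b c d : ℂ) (v w x y : EE m) (f : Sm m) :
    Dr.comb a b (Dv v) (Dv w) (Dr.comb c d (Dv x) (Dv y) f) = Dr.comb c d (Dv x) (Dv y) (Dr.comb a b (Dv v) (Dv w) f) := by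
  simp only [Dr.comb_apply, map_add, Dv_smul, smul_smul]
  rw [Dv_comm v x, Dv_comm w x, Dv_comm v y, Dv_comm w y, mul_comm a c, mul_comm b c, mul_comm a d, mul_comm b d]
  abel
def toC : RS m →+* Sm m where
  toFun u := ⟨fun z => (u.1 z : ℂ), Complex.ofRealCLM.contDiff.comp (RS.cd u)⟩
  map_one' := by apply Subtype.ext; funext z; simp
  map_zero' := by apply Subtype.ext; funext z; simp
  map_mul' := fun u v => by apply Subtype.ext; funext z; simp
  map_add' := fun u v => by apply Subtype.ext; funext z; simp
lemma toC_apply (u : RS m) (z : EE m) : (toC u : EE m → ℂ) z = (u.1 z : ℂ) := rfl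
lemma toC_smul (t : ℝ) (u : RS m) : toC (t • u) = (t : ℂ) • toC u := by
  apply Subtype.ext; funext z; simp [toC_apply]
def HA (u : RS m) : Matrix (Fin m) (Fin m) (Sm m) := fun l i => db l (dd i (toC u))
lemma db_smul (l : Fin m) (c : ℂ) (f : Sm m) : db l (c • f) = c • db l f := by
  simp only [db, Dr.comb_apply, Dv_smul, smul_add, smul_smul, mul_comm c]
lemma dd_smul (l : Fin m) (c : ℂ) (f : Sm m) : dd l (c • f) = c • dd l f := by
  simp only [dd, Dr.comb_apply, Dv_smul, smul_add, smul_smul, mul_comm c]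
lemma HA_add (u v : RS m) : HA (u + v) = HA u + HA v := by ext1 l i; simp [HA]
lemma HA_sub (u v : RS m) : HA (u - v) = HA u - HA v := by ext1 l i; simp [HA]
lemma HA_smul (t : ℝ) (u : RS m) : HA (t • u) = (t : ℂ) • HA u := by
  ext1 l i; simp only [HA, toC_smul, dd_smul, db_smul, Matrix.smul_apply]
lemma HA_comm (u : RS m) (l i : Fin m) : HA u l i = dd i (db l (toC u)) := comb_comm _ _ _ _ _ _ _ _ _
lemma HA_db (u : RS m) (l r j : Fin m) : db l (HA u r j) = db r (HA u l j) := comb_comm _ _ _ _ _ _ _ _ _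
lemma HA_dd (u : RS m) (l r j : Fin m) : dd l (HA u j r) = dd r (HA u j l) := by
  rw [HA_comm, HA_comm]; exact comb_comm _ _ _ _ _ _ _ _ _
def ev (z : EE m) : Sm m →+* ℂ where
  toFun f := f.1 z
  map_one' := rfl
  map_zero' := rfl
  map_mul' := fun _ _ => rfl
  map_add' := fun _ _ => rfl
lemma ev_apply (z : EE m) (f : Sm m) : ev z f = f.1 z := rfl
lemma ev_smul (z : EE m) (c : ℂ) (f : Sm m) : ev z (c • f) = c * ev z f := rfl
def Hz (u : RS m) (z : EE m) : Matrix (Fin m) (Fin m) ℂ := (HA u).map (ev z)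
def MA (u : RS m) (z : EE m) : ℝ := (Hz u z).det.re
lemma Hz_add (u v : RS m) (z : EE m) : Hz (u + v) z = Hz u z + Hz v z := by
  simp only [Hz, HA_add]; ext; simp
lemma Hz_sub (u v : RS m) (z : EE m) : Hz (u - v) z = Hz u z - Hz v z := by
  simp only [Hz, HA_sub]; ext; simp
lemma Hz_smul (t : ℝ) (u : RS m) (z : EE m) : Hz (t • u) z = (t : ℂ) • Hz u z := by
  simp only [Hz, HA_smul]; ext; simp only [Matrix.map_apply, Matrix.smul_apply, ev_smul, smul_eq_mul]
lemma clin (g : EE m →ₗ[ℝ] ℂ) (b : EE m) : (1/2 : ℂ) * g b + -(Complex.I/2) * g (Complex.I • b)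
    = ∑ i, b i * ((1/2 : ℂ) * g (eb i) + -(Complex.I/2) * g (Complex.I • eb i)) := by
  have hI : ∀ x : EE m, Complex.I • Complex.I • x = -x := fun x => by
    rw [smul_smul, Complex.I_mul_I, neg_one_smul]
  let G : EE m →ₗ[ℂ] ℂ :=
    { toFun := fun b => (1/2 : ℂ) * g b + -(Complex.I/2) * g (Complex.I • b)
      map_add' := fun x y => by simp only [smul_add, map_add]; ring
      map_smul' := fun c x => by
        have e : ∀ x : EE m, c • x = c.re • x + c.im • (Complex.I • x) := fun x => by
          conv_lhs => rw [← Complex.re_add_im c]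
          rw [add_smul, mul_smul]; rfl
        have e2 : Complex.I • (c.re • x + c.im • Complex.I • x) = c.re • Complex.I • x - c.im • x := by
          rw [smul_add, smul_comm _ c.re, smul_comm _ c.im, hI, smul_neg, sub_eq_add_neg]
        simp only [e, e2, map_sub, map_add, map_smul, RingHom.id_apply, Complex.real_smul, smul_eq_mul]
        conv_rhs => rw [← Complex.re_add_im c]
        linear_combination ((1/2) * (c.im : ℂ) * g (Complex.I • x)) * Complex.I_mul_I }
  have h : G b = ∑ i, b i * G (eb i) := by
    have e : b = ∑ i, b i • eb i := by
      ext j; simp [eb, Pi.single_apply]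
    conv_lhs => rw [e]
    rw [map_sum]; simp only [map_smul, smul_eq_mul]
  exact h
lemma clin' (g : EE m →ₗ[ℝ] ℂ) (b : EE m) : (1/2 : ℂ) * g b + (Complex.I/2) * g (Complex.I • b)
    = ∑ i, star (b i) * ((1/2 : ℂ) * g (eb i) + (Complex.I/2) * g (Complex.I • eb i)) := by
  have h := congrArg star (clin (Complex.conjAe.toLinearMap.comp g) b)
  simp only [star_sum, star_add, star_mul', LinearMap.comp_apply, RCLike.star_def] at h
  have e : ∀ x : ℂ, (starRingEnd ℂ) (Complex.conjAe.toLinearMap x) = x := fun x => Complex.conj_conj x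
  simp only [e, map_neg, map_div₀, Complex.conj_I, map_one, map_ofNat] at h
  rw [show -(-Complex.I/2) = Complex.I/2 by ring] at h
  simpa only [RCLike.star_def] using h
def D2 (u : RS m) (z : EE m) : EE m →L[ℝ] EE m →L[ℝ] ℝ := fderiv ℝ (fderiv ℝ (u : EE m → ℝ)) z
def Lv (u : RS m) (z b : EE m) : ℝ := (D2 u z b b + D2 u z (Complex.I • b) (Complex.I • b)) / 4
lemma D2_symm (u : RS m) (z v w : EE m) : D2 u z v w = D2 u z w v :=
  (((RS.cd u).contDiffAt).isSymmSndFDerivAt two_le_inf) v w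
lemma D2_toC (u : RS m) (z v w : EE m) : (Dv v (Dv w (toC u)) : EE m → ℂ) z = (D2 u z v w : ℂ) := by
  have e1 : ∀ z, (Dv w (toC u) : EE m → ℂ) z = ((fderiv ℝ (u : EE m → ℝ) z w : ℝ) : ℂ) := fun z => by
    rw [Dv_apply]
    have := (Complex.ofRealCLM.hasFDerivAt.comp z (RS.da u z).hasFDerivAt).fderiv
    change fderiv ℝ (Complex.ofRealCLM ∘ (u : EE m → ℝ)) z w = _
    rw [this]; rfl
  rw [Dv_apply, show ((Dv w (toC u) : Sm m) : EE m → ℂ) = fun z => ((fderiv ℝ (u : EE m → ℝ) z w : ℝ) : ℂ) from funext e1]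
  have hd : HasFDerivAt (fun z => fderiv ℝ (u : EE m → ℝ) z w) ((ContinuousLinearMap.apply ℝ ℝ w).comp (D2 u z)) z :=
    (ContinuousLinearMap.apply ℝ ℝ w).hasFDerivAt.comp z (((cd_fd (RS.cd u)).differentiable (by simp)) z).hasFDerivAt
  have := (Complex.ofRealCLM.hasFDerivAt.comp z hd).fderiv
  change fderiv ℝ (Complex.ofRealCLM ∘ (fun z => fderiv ℝ (u : EE m → ℝ) z w)) z v = _
  rw [this]; rfl
lemma Hz_apply (u : RS m) (z : EE m) (l i : Fin m) : Hz u z l i =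
    (1/2) * ((1/2) * (D2 u z (eb l) (eb i) : ℂ) + -(Complex.I/2) * (D2 u z (eb l) (Complex.I • eb i) : ℂ))
    + (Complex.I/2) * ((1/2) * (D2 u z (Complex.I • eb l) (eb i) : ℂ) + -(Complex.I/2) * (D2 u z (Complex.I • eb l) (Complex.I • eb i) : ℂ)) := by
  simp only [← D2_toC]
  simp only [Hz, Matrix.map_apply, HA, db, dd, Dr.comb_apply, map_add, Dv_smul, ev_smul]
  simp only [ev_apply]; ring
lemma Hz_form (u : RS m) (z b : EE m) : star (b : Fin m → ℂ) ⬝ᵥ (Hz u z *ᵥ (b : Fin m → ℂ)) = (Lv u z b : ℂ) := by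
  set B : EE m → EE m →ₗ[ℝ] ℂ := fun v => Complex.ofRealCLM.toLinearMap.comp (D2 u z v).toLinearMap
  let G : EE m →ₗ[ℝ] ℂ :=
    { toFun := fun v => (1/2 : ℂ) * B v b + -(Complex.I/2) * B v (Complex.I • b)
      map_add' := fun x y => by simp [B]; ring
      map_smul' := fun c x => by simp [B]; ring }
  have h1 := clin' G b
  have h2 : ∀ v, G v = ∑ i, b i * ((1/2 : ℂ) * B v (eb i) + -(Complex.I/2) * B v (Complex.I • eb i)) := fun v => clin (B v) b
  have h3 : (1/2 : ℂ) * G b + (Complex.I/2) * G (Complex.I • b) = (Lv u z b : ℂ) := by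
    simp only [G, B, LinearMap.coe_mk, AddHom.coe_mk, Lv, LinearMap.comp_apply]
    simp only [ContinuousLinearMap.coe_coe, Complex.ofRealCLM_apply, D2_symm u z (Complex.I • b) b]
    push_cast
    linear_combination (-(1/4) * (D2 u z (Complex.I • b) (Complex.I • b) : ℂ)) * Complex.I_mul_I
  rw [← h3, h1]
  simp only [dotProduct, mulVec, Pi.star_apply]
  refine Finset.sum_congr rfl fun l _ => ?_
  congr 1
  rw [h2, h2, Finset.mul_sum, Finset.mul_sum, ← Finset.sum_add_distrib]
  refine Finset.sum_congr rfl fun i _ => ?_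
  rw [Hz_apply]
  simp only [B, LinearMap.comp_apply, ContinuousLinearMap.coe_coe, Complex.ofRealCLM_apply]
  ring
lemma Hz_herm (u : RS m) (z : EE m) : (Hz u z).IsHermitian := by
  ext l i
  rw [conjTranspose_apply, Hz_apply, Hz_apply]
  simp only [star_add, star_mul', star_neg, RCLike.star_def, map_div₀, Complex.conj_I, map_one, map_ofNat, Complex.conj_ofReal]
  rw [D2_symm u z (eb i) (eb l), D2_symm u z (eb i) (Complex.I • eb l), D2_symm u z (Complex.I • eb i) (eb l), D2_symm u z (Complex.I • eb i) (Complex.I • eb l)]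
  ring
lemma Hz_psd (u : RS m) (z : EE m) (h : ∀ b, 0 ≤ Lv u z b) : (Hz u z).PosSemidef :=
  PosSemidef.of_dotProduct_mulVec_nonneg (Hz_herm u z) fun x => by
    have := Hz_form u z (WithLp.toLp 2 x)
    rw [show star x ⬝ᵥ (Hz u z *ᵥ x) = _ from this]
    exact_mod_cast h _
lemma Hz_pd (u : RS m) (z : EE m) (h : ∀ b, b ≠ 0 → 0 < Lv u z b) : (Hz u z).PosDef :=
  PosDef.of_dotProduct_mulVec_pos (Hz_herm u z) fun x hx => by
    have := Hz_form u z (WithLp.toLp 2 x)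
    rw [show star x ⬝ᵥ (Hz u z *ᵥ x) = _ from this]
    exact_mod_cast h _ (by intro h0; exact hx (by simpa using congrArg (WithLp.ofLp) h0))
end
section
variable {m : ℕ}
def Van (R : ℝ) (a : Sm m) : Prop := ∀ z : EE m, R < ‖z‖ → a.1 z = 0
lemma Van.mul_left {R : ℝ} {a : Sm m} (h : Van R a) (b : Sm m) : Van R (b * a) := fun z hz => by
  change b.1 z * a.1 z = 0; rw [h z hz, mul_zero]
lemma Van.mul_right {R : ℝ} {a : Sm m} (h : Van R a) (b : Sm m) : Van R (a * b) := fun z hz => by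
  change a.1 z * b.1 z = 0; rw [h z hz, zero_mul]
lemma Van.add {R : ℝ} {a b : Sm m} (ha : Van R a) (hb : Van R b) : Van R (a + b) := fun z hz => by
  change a.1 z + b.1 z = 0; rw [ha z hz, hb z hz, zero_add]
lemma Van.smul {R : ℝ} {a : Sm m} (ha : Van R a) (c : ℂ) : Van R (c • a) := fun z hz => by
  change c * a.1 z = 0; rw [ha z hz, mul_zero]
lemma Van.Dv {R : ℝ} {a : Sm m} (h : Van R a) (v : EE m) : Van R (Dv v a) := fun z hz => by
  rw [Dv_apply]
  have : (a : EE m → ℂ) =ᶠ[𝓝 z] fun _ => 0 := by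
    filter_upwards [(isOpen_lt continuous_const continuous_norm).mem_nhds hz] with w hw
    exact h w hw
  rw [this.fderiv_eq]; simp
lemma Van.dd {R : ℝ} {a : Sm m} (h : Van R a) (l : Fin m) : Van R (dd l a) :=
  ((h.Dv _).smul _).add ((h.Dv _).smul _)
lemma Van.sum {R : ℝ} {ι : Type*} (s : Finset ι) {f : ι → Sm m} (h : ∀ i, Van R (f i)) : Van R (∑ i ∈ s, f i) := by
  classical
  induction s using Finset.induction_on with
  | empty => intro z _; rfl
  | insert a s ha ih => rw [Finset.sum_insert ha]; exact (h a).add ih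
lemma Sm.intOn (a : Sm m) (R : ℝ) : IntegrableOn (a : EE m → ℂ) (closedBall 0 R) :=
  (Sm.ct a).continuousOn.integrableOn_compact (isCompact_closedBall 0 R)
def IR (R : ℝ) : Sm m →ₗ[ℂ] ℂ where
  toFun a := ∫ z in closedBall (0 : EE m) R, (a : EE m → ℂ) z
  map_add' := fun a b => integral_add (Sm.intOn a R) (Sm.intOn b R)
  map_smul' := fun c a => integral_const_mul c _
lemma IR_apply (R : ℝ) (a : Sm m) : IR R a = ∫ z in closedBall (0 : EE m) R, (a : EE m → ℂ) z := rfl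
lemma IR_Dv {R : ℝ} {a : Sm m} (h : Van R a) (v : EE m) : IR R (Dv v a) = 0 := by
  rw [IR_apply, setIntegral_eq_integral_of_forall_compl_eq_zero (fun z hz => (h.Dv v) z (by simpa using hz))]
  have hc : HasCompactSupport (a : EE m → ℂ) :=
    HasCompactSupport.intro (isCompact_closedBall 0 R) fun z hz => h z (by simpa using hz)
  have hc' : HasCompactSupport (Dv v a : EE m → ℂ) :=
    HasCompactSupport.intro (isCompact_closedBall 0 R) fun z hz => (h.Dv v) z (by simpa using hz)
  have i1 := (Sm.ct (Dv v a)).integrable_of_hasCompactSupport (μ := volume) hc'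
  have i2 := (Sm.ct a).integrable_of_hasCompactSupport (μ := volume) hc
  have := integral_mul_fderiv_eq_neg_fderiv_mul_of_integrable (𝕜 := ℂ) (μ := volume) (f := fun _ : EE m => (1 : ℂ)) (g := (a : EE m → ℂ)) (v := v)
    (by simp) (by simp only [one_mul]; exact i1) (by simpa using i2) (fun _ _ => by fun_prop) (fun z _ => Sm.da a z)
  simpa [Dv_apply] using this
lemma IR_db {R : ℝ} {a : Sm m} (h : Van R a) (l : Fin m) : IR R (db l a) = 0 := by
  rw [db, Dr.comb_apply, map_add, map_smul, map_smul, IR_Dv h, IR_Dv h]; simp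
lemma IR_dd {R : ℝ} {a : Sm m} (h : Van R a) (l : Fin m) : IR R (dd l a) = 0 := by
  rw [dd, Dr.comb_apply, map_add, map_smul, map_smul, IR_Dv h, IR_Dv h]; simp
def GG (T : Matrix (Fin m) (Fin m) (Sm m)) (a k : Sm m) : Sm m := ∑ l, ∑ i, T i l * (db l a * dd i k)
lemma IBP1 {R : ℝ} {T : Matrix (Fin m) (Fin m) (Sm m)} (hT : ∀ i, ∑ l, db l (T i l) = 0) (a : Sm m) (k : RS m)
    (h : Van R a ∨ Van R (toC k)) : IR R (a * (T * HA k).trace) = - IR R (GG T a (toC k)) := by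
  have h1 : ∑ l, db l (a * ∑ i, T i l * dd i (toC k)) = GG T a (toC k) + a * (T * HA k).trace := by
    have e : ∀ l, db l (a * ∑ i, T i l * dd i (toC k)) = ∑ i, T i l * (db l a * dd i (toC k)) +
        a * ∑ i, (T i l * HA k l i + dd i (toC k) * db l (T i l)) := fun l => by
      rw [Dr.leibniz, map_sum, add_comm]
      congr 1
      · rw [Finset.sum_mul]; exact Finset.sum_congr rfl fun i _ => by ring
      · congr 1; exact Finset.sum_congr rfl fun i _ => by rw [Dr.leibniz]; rfl
    rw [Finset.sum_congr rfl fun l _ => e l, Finset.sum_add_distrib, ← Finset.mul_sum]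
    simp only [Finset.sum_add_distrib]
    have e2 : ∑ l, ∑ i, dd i (toC k) * db l (T i l) = 0 := by
      rw [Finset.sum_comm]
      exact Finset.sum_eq_zero fun i _ => by rw [← Finset.mul_sum, hT, mul_zero]
    rw [e2, add_zero]
    simp only [GG, trace, diag_apply, Matrix.mul_apply]
    rw [Finset.sum_comm (f := fun x i => T i x * HA k x i)]
  have h2 := congrArg (IR R) h1
  rw [map_sum, map_add, Finset.sum_eq_zero] at h2
  · linear_combination -h2
  · intro l _
    refine IR_db ?_ l
    rcases h with h | h
    · exact h.mul_right _
    · exact (Van.sum _ fun i => ((h.dd i).mul_left _)).mul_left _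
lemma IBP2 {R : ℝ} {T : Matrix (Fin m) (Fin m) (Sm m)} (hT : ∀ l, ∑ i, dd i (T i l) = 0) (a : RS m) (k : Sm m)
    (h : Van R k) : IR R (k * (T * HA a).trace) = - IR R (GG T (toC a) k) := by
  have h1 : ∑ i, dd i (k * ∑ l, T i l * db l (toC a)) = GG T (toC a) k + k * (T * HA a).trace := by
    have e : ∀ i, dd i (k * ∑ l, T i l * db l (toC a)) = ∑ l, T i l * (db l (toC a) * dd i k) +
        k * ∑ l, (T i l * HA a l i + db l (toC a) * dd i (T i l)) := fun i => by
      rw [Dr.leibniz, map_sum, add_comm]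
      congr 1
      · rw [Finset.sum_mul]; exact Finset.sum_congr rfl fun i _ => by ring
      · congr 1; exact Finset.sum_congr rfl fun l _ => by rw [Dr.leibniz, HA_comm]
    rw [Finset.sum_congr rfl fun l _ => e l, Finset.sum_add_distrib, ← Finset.mul_sum]
    simp only [Finset.sum_add_distrib]
    have e2 : ∑ i, ∑ l, db l (toC a) * dd i (T i l) = 0 := by
      rw [Finset.sum_comm]
      exact Finset.sum_eq_zero fun i _ => by rw [← Finset.mul_sum, hT, mul_zero]
    rw [e2, add_zero]
    simp only [GG, trace, diag_apply, Matrix.mul_apply]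
    rw [Finset.sum_comm (f := fun i l => T i l * (db l (toC a) * dd i k))]
  have h2 := congrArg (IR R) h1
  rw [map_sum, map_add, Finset.sum_eq_zero] at h2
  · linear_combination -h2
  · intro l _
    exact IR_dd (h.mul_right _) l
abbrev TT (p q : RS m) (i : ℕ) : Matrix (Fin m) (Fin m) (Sm m) := Tc (HA p) (HA q) i
abbrev DD (p q : RS m) (i : ℕ) : Sm m := dc (HA p) (HA q) i
lemma TT_div (p q : RS m) (n : ℕ) (i : Fin m) : ∑ l, db l (TT p q n i l) = 0 :=
  Tc_div db _ _ (HA_db p) (HA_db q) n i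
lemma TT_div' (p q : RS m) (n : ℕ) (l : Fin m) : ∑ i, dd i (TT p q n i l) = 0 := by
  have h := Tc_div dd (HA p)ᵀ (HA q)ᵀ (fun l r j => HA_dd p l r j) (fun l r j => HA_dd q l r j) n l
  have e : ∀ i, Tc (HA p)ᵀ (HA q)ᵀ n l i = TT p q n i l := fun i => by
    have : pen (HA p)ᵀ (HA q)ᵀ = (pen (HA p) (HA q))ᵀ := by ext1 a b; rfl
    simp only [Tc, this, Matrix.map_apply, ← adjugate_transpose, transpose_apply]
  simpa only [e] using h
lemma IBP_symm {R : ℝ} (p q a k : RS m) (n : ℕ) (ha : Van R (toC a)) (hk : Van R (toC k)) :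
    IR R (toC a * (TT p q n * HA k).trace) = IR R (toC k * (TT p q n * HA a).trace) := by
  rw [IBP1 (TT_div p q n) _ _ (Or.inl ha), IBP2 (TT_div' p q n) _ _ hk]
lemma IBP_one {R : ℝ} (p q k : RS m) (n : ℕ) (hk : Van R (toC k)) :
    IR R ((TT p q n * HA k).trace) = 0 := by
  have := IBP1 (R := R) (TT_div p q n) 1 k (Or.inr hk)
  rw [one_mul] at this
  rw [this]; simp [GG, Dr.one]
end
section
variable {m : ℕ}
lemma cm_rot (u : EE m → ℝ) (a b : EE m) (χ : ℂ) (hω : ‖χ‖ = 1) : cm u a (χ • b) = cm u a b := by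
  obtain ⟨η, hη⟩ : ∃ η : ℝ, χ = Complex.exp (η * Complex.I) := ⟨χ.arg, by
    have := Complex.norm_mul_exp_arg_mul_I χ
    rw [hω] at this; simpa using this.symm⟩
  unfold cm
  conv_rhs => rw [Real.circleAverage_eq_integral_add η]
  rw [Real.circleAverage_def]
  congr 2; funext θ
  simp only [circleMap, hη, smul_smul, zero_add]
  push_cast
  rw [add_mul, Complex.exp_add]
  congr 3; ring
lemma peano (Q : RS m) (z : EE m) {ε : ℝ} (hε : 0 < ε) : ∃ δ > 0, ∀ y : EE m, ‖y‖ < δ →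
    |Q.1 (z + y) - Q.1 z - fderiv ℝ Q.1 z y - D2 Q z y y / 2| ≤ ε * ‖y‖ ^ 2 := by
  have h1 : HasFDerivAt (fderiv ℝ Q.1) (D2 Q z) z := (((cd_fd (RS.cd Q)).differentiable (by simp)) z).hasFDerivAt
  have h2 := (hasFDerivAt_iff_isLittleO_nhds_zero.1 h1).def hε
  obtain ⟨δ, hδ, h3⟩ := Metric.eventually_nhds_iff.1 h2
  refine ⟨δ, hδ, fun y hy => ?_⟩
  set h : EE m → ℝ := fun x => Q.1 (z + x) - fderiv ℝ Q.1 z x - D2 Q z x x / 2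
  have hd : ∀ x, HasFDerivAt h (fderiv ℝ Q.1 (z + x) - fderiv ℝ Q.1 z - D2 Q z x) x := fun x => by
    have a1 : HasFDerivAt (fun x => Q.1 (z + x)) (fderiv ℝ Q.1 (z + x)) x := by
      have := (RS.da Q (z + x)).hasFDerivAt.comp x ((hasFDerivAt_id x).const_add z)
      rw [ContinuousLinearMap.comp_id] at this
      exact this
    have a2 : HasFDerivAt (fun x => fderiv ℝ Q.1 z x) (fderiv ℝ Q.1 z) x := (fderiv ℝ Q.1 z).hasFDerivAt
    have a3 : HasFDerivAt (fun x => D2 Q z x x / 2) (D2 Q z x) x := by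
      have := ((D2 Q z).hasFDerivAt (x := x)).clm_apply (hasFDerivAt_id x)
      have := this.mul_const (2 : ℝ)⁻¹
      simp only [← div_eq_mul_inv] at this
      refine this.congr_fderiv ?_
      ext w
      have := D2_symm Q z w x
      simp only [_root_.smul_apply, _root_.add_apply, ContinuousLinearMap.comp_apply, ContinuousLinearMap.flip_apply, ContinuousLinearMap.id_apply, id, smul_eq_mul]
      linarith
    exact (a1.sub a2).sub a3
  have hb := ((convex_ball (0 : EE m) δ).inter (convex_closedBall 0 ‖y‖)).norm_image_sub_le_of_norm_hasFDerivWithin_le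
      (f := h) (f' := fun x => fderiv ℝ Q.1 (z + x) - fderiv ℝ Q.1 z - D2 Q z x) (C := ε * ‖y‖) (x := 0) (y := y)
      (fun x _ => (hd x).hasFDerivWithinAt) (fun x hx => by
        have h4 := h3 (y := x) hx.1
        refine h4.trans (mul_le_mul_of_nonneg_left (by simpa using hx.2) hε.le)) ⟨by simpa using hδ, by simp⟩ ⟨by simpa using hy, by simp⟩
  simp only [h, Real.norm_eq_abs] at hb
  simp only [add_zero, map_zero, sub_zero, zero_div] at hb
  rw [show ε * ‖y‖ ^ 2 = ε * ‖y‖ * ‖y‖ by ring]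
  refine le_of_eq_of_le ?_ hb
  congr 1; ring
lemma touch {g : EE m → ℝ} (hg : LB g) (sg : SubM g) (Q : RS m) (z : EE m) {r : ℝ} (hr : 0 < r)
    (hle : ∀ y, ‖y‖ < r → g (z + y) ≤ Q.1 (z + y)) (he : g z = Q.1 z) (b : EE m) : 0 ≤ Lv Q z b := by
  by_contra hneg
  push Not at hneg
  set ε : ℝ := - Lv Q z b / (2 * (‖b‖ ^ 2 + 1)) with hεd
  have hB : 0 < ‖b‖ ^ 2 + 1 := by positivity
  have hε : 0 < ε := by rw [hεd]; apply div_pos <;> linarith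
  have hε2 : ε * (‖b‖ ^ 2 + 1) = - Lv Q z b / 2 := by rw [hεd]; field_simp
  obtain ⟨δ, hδ, hp⟩ := peano Q z hε
  set t : ℝ := min δ r / (2 * (‖b‖ + 1)) with htd
  have ht : 0 < t := by positivity
  have htb : t * ‖b‖ < min δ r := by
    rw [htd, div_mul_eq_mul_div, div_lt_iff₀ (by positivity)]
    nlinarith [norm_nonneg b, lt_min hδ hr]
  have hn : ∀ χ ζ : ℂ, ‖χ‖ = 1 → ‖ζ‖ = 1 → ‖χ • ζ • (t • b)‖ = t * ‖b‖ := fun χ ζ h1 h2 => by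
    simp [norm_smul, h1, h2, abs_of_pos ht]
  have h4 : ∀ χ : ℂ, ‖χ‖ = 1 → cm g z (t • b) = cm (fun y => g (z + χ • y)) 0 (t • b) := fun χ h => by
    rw [← cm_rot g z (t • b) χ h]
    simp only [cm, zero_add, smul_comm χ]
  have hl : ∀ χ : ℂ, LB (fun y => g (z + χ • y)) := fun χ => by
    refine ⟨hg.meas.comp (by fun_prop), fun s => ?_⟩
    obtain ⟨C, hC⟩ := hg.bdd (‖z‖ + ‖χ‖ * s)
    refine ⟨C, fun y hy => hC _ ((norm_add_le _ _).trans ?_)⟩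
    rw [norm_smul]; gcongr
  have h5 : 4 * cm g z (t • b) = cm (fun y => (g (z + (1:ℂ) • y) + g (z + (-1:ℂ) • y)) + (g (z + Complex.I • y) + g (z + (-Complex.I) • y))) 0 (t • b) := by
    rw [cm_add ((hl _).add (hl _)) ((hl _).add (hl _)), cm_add (hl _) (hl _), cm_add (hl _) (hl _),
      ← h4 _ (by simp), ← h4 _ (by simp), ← h4 _ (by simp), ← h4 _ (by simp)]
    ring
  have h6 : 4 * cm g z (t • b) ≤ 4 * Q.1 z + t ^ 2 * (4 * Lv Q z b) + 4 * ε * (t * ‖b‖) ^ 2 := by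
    rw [h5]
    refine cm_le (((hl _).add (hl _)).add ((hl _).add (hl _))) fun ζ hζ => ?_
    have k1 : ∀ χ : ℂ, ‖χ‖ = 1 → g (z + χ • (0 + ζ • t • b)) ≤ Q.1 z + fderiv ℝ Q.1 z (χ • ζ • t • b) + D2 Q z (χ • ζ • t • b) (χ • ζ • t • b) / 2 + ε * (t * ‖b‖) ^ 2 := fun χ hω => by
      rw [zero_add]
      have := hle (χ • ζ • t • b) (by rw [hn χ ζ hω hζ]; exact htb.trans_le (min_le_right _ _))
      have h7 := (abs_le.1 (hp (χ • ζ • t • b) (by rw [hn χ ζ hω hζ]; exact htb.trans_le (min_le_left _ _)))).2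
      rw [hn χ ζ hω hζ] at h7
      linarith
    have a1 := k1 1 (by simp)
    have a2 := k1 (-1) (by simp)
    have a3 := k1 Complex.I (by simp)
    have a4 := k1 (-Complex.I) (by simp)
    have key : D2 Q z (ζ • t • b) (ζ • t • b) + D2 Q z (Complex.I • ζ • t • b) (Complex.I • ζ • t • b) = t ^ 2 * (4 * Lv Q z b) := by
      have e : ∀ x : EE m, ζ • x = ζ.re • x + ζ.im • (Complex.I • x) := fun x => by
        conv_lhs => rw [← Complex.re_add_im ζ]
        rw [add_smul, mul_smul]; rfl
      have hI : ∀ x : EE m, Complex.I • Complex.I • x = -x := fun x => by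
        rw [smul_smul, Complex.I_mul_I, neg_one_smul]
      have e1 : ζ • t • b = t • (ζ.re • b + ζ.im • (Complex.I • b)) := by rw [smul_comm, e]
      have e2 : Complex.I • ζ • t • b = t • (ζ.re • (Complex.I • b) - ζ.im • b) := by
        rw [e1, smul_comm _ t, smul_add, smul_comm _ ζ.re, smul_comm _ ζ.im, hI, smul_neg, sub_eq_add_neg]
      have hz1 : ζ.re ^ 2 + ζ.im ^ 2 = 1 := by
        have := Complex.sq_norm ζ
        rw [hζ, Complex.normSq_apply] at this; nlinarith
      rw [e2, e1, Lv]
      simp only [map_smul, map_add, map_sub, _root_.add_apply, _root_.sub_apply,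
        _root_.smul_apply, smul_eq_mul, D2_symm Q z (Complex.I • b) b]
      linear_combination (t ^ 2 * (D2 Q z b b + D2 Q z (Complex.I • b) (Complex.I • b))) * hz1
    simp only [one_smul, neg_smul, map_neg, _root_.neg_apply, neg_neg] at a1 a2 a3 a4 ⊢
    linarith
  have h7 := sg z (t • b)
  have h8 : 0 ≤ t ^ 2 * (Lv Q z b + ε * ‖b‖ ^ 2) := by nlinarith
  have h9 : 0 ≤ Lv Q z b + ε * ‖b‖ ^ 2 := by
    by_contra hc; push Not at hc; nlinarith [pow_pos ht 2]
  nlinarith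
lemma Lv_nonneg (u : RS m) (su : SubM u.1) (z b : EE m) : 0 ≤ Lv u z b :=
  touch (RS.ct u).lb su u z one_pos (fun _ _ => le_rfl) rfl b
lemma D2_add (u v : RS m) (z : EE m) : D2 (u + v) z = D2 u z + D2 v z := by
  have h : fderiv ℝ ((u + v : RS m) : EE m → ℝ) = fun z => fderiv ℝ (u : EE m → ℝ) z + fderiv ℝ (v : EE m → ℝ) z := by
    funext z; exact fderiv_add (RS.da u z) (RS.da v z)
  unfold D2; rw [h]
  exact fderiv_add (((cd_fd (RS.cd u)).differentiable (by simp)) z) (((cd_fd (RS.cd v)).differentiable (by simp)) z)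
lemma D2_smul (t : ℝ) (u : RS m) (z : EE m) : D2 (t • u) z = t • D2 u z := by
  have h : fderiv ℝ ((t • u : RS m) : EE m → ℝ) = fun z => t • fderiv ℝ (u : EE m → ℝ) z := by
    funext z; exact fderiv_const_smul (RS.da u z) t
  unfold D2; rw [h]
  exact fderiv_const_smul (((cd_fd (RS.cd u)).differentiable (by simp)) z) t
lemma D2_sub (u v : RS m) (z : EE m) : D2 (u - v) z = D2 u z - D2 v z := by
  have h := D2_add (u - v) v z
  rw [sub_add_cancel] at h; ext a b; rw [h]; simp
lemma Lv_add (u v : RS m) (z b : EE m) : Lv (u + v) z b = Lv u z b + Lv v z b := by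
  simp only [Lv, D2_add, _root_.add_apply]; ring
lemma Lv_sub (u v : RS m) (z b : EE m) : Lv (u - v) z b = Lv u z b - Lv v z b := by
  simp only [Lv, D2_sub, _root_.sub_apply]; ring
lemma Lv_smul (t : ℝ) (u : RS m) (z b : EE m) : Lv (t • u) z b = t * Lv u z b := by
  simp only [Lv, D2_smul, _root_.smul_apply, smul_eq_mul]; ring
def nsq : RS m := ⟨fun z => ‖z‖ ^ 2, by change ContDiff ℝ ∞ _; exact contDiff_norm_sq ℂ⟩
lemma D2_nsq (z v w : EE m) : D2 nsq z v w = 2 * (inner ℂ v w).re := by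
  let _ : InnerProductSpace ℝ (EE m) := InnerProductSpace.complexToReal
  have h : fderiv ℝ ((nsq : RS m) : EE m → ℝ) = fun z => (2 : ℝ) • innerSL ℝ z := by
    funext z
    rw [ofNat_smul_eq_nsmul]
    exact (hasStrictFDerivAt_norm_sq z).hasFDerivAt.fderiv
  unfold D2; rw [h]
  have h2 : HasFDerivAt (fun z : EE m => (2 : ℝ) • innerSL ℝ z) ((2 : ℝ) • (innerSL ℝ)) z :=
    ((2 : ℝ) • (innerSL ℝ : EE m →L[ℝ] EE m →L[ℝ] ℝ)).hasFDerivAt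
  rw [h2.fderiv]
  simp; rfl
lemma D2_nsq' (z v : EE m) : D2 nsq z v v = 2 * ‖v‖ ^ 2 := by
  rw [D2_nsq, inner_self_eq_norm_sq_to_K]; norm_cast
lemma Lv_nsq (z b : EE m) : Lv nsq z b = ‖b‖ ^ 2 := by
  rw [Lv, D2_nsq', D2_nsq', norm_smul]; simp; ring
lemma pd_of_subm (u : RS m) {κ : ℝ} (hκ : 0 < κ) (su : SubM (u - κ • nsq).1) (z : EE m) : (Hz u z).PosDef :=
  Hz_pd u z fun b hb => by
    have := Lv_nonneg _ su z b
    rw [Lv_sub, Lv_smul, Lv_nsq] at this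
    have : 0 < κ * ‖b‖ ^ 2 := by positivity
    linarith
end
section
variable {m : ℕ}
def gm' (t : ℝ) : ℝ := Real.smoothTransition ((t + 1) / 2)
def gm (x : ℝ) : ℝ := ∫ t in (-1)..x, gm' t
lemma gm'_cd : ContDiff ℝ ∞ gm' := Real.smoothTransition.contDiff.comp (by fun_prop)
lemma gm'_mono : Monotone gm' := fun x y h => Real.smoothTransition.monotone (by linarith)
lemma gm'_nn (x : ℝ) : 0 ≤ gm' x := Real.smoothTransition.nonneg _
lemma gm'_le (x : ℝ) : gm' x ≤ 1 := Real.smoothTransition.le_one _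
lemma gm_deriv (x : ℝ) : HasDerivAt gm (gm' x) x :=
  intervalIntegral.integral_hasDerivAt_right (gm'_cd.continuous.intervalIntegrable _ _)
    (gm'_cd.continuous.stronglyMeasurableAtFilter _ _) gm'_cd.continuous.continuousAt
lemma gm_cd : ContDiff ℝ ∞ gm := by
  rw [contDiff_infty_iff_deriv]
  refine ⟨fun x => (gm_deriv x).differentiableAt, ?_⟩
  rw [show deriv gm = gm' from funext fun x => (gm_deriv x).deriv]
  exact gm'_cd
lemma gm_neg {x : ℝ} (h : x ≤ -1) : gm x = 0 := by
  unfold gm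
  rw [intervalIntegral.integral_symm, intervalIntegral.integral_of_le h,
    setIntegral_congr_fun (f := gm') measurableSet_Ioc (g := fun _ => 0) fun t ht => Real.smoothTransition.zero_of_nonpos (by linarith [ht.2])]
  simp
lemma gm_sub (x y : ℝ) : gm y - gm x = ∫ t in x..y, gm' t := by
  unfold gm
  rw [intervalIntegral.integral_interval_sub_left] <;> exact gm'_cd.continuous.intervalIntegrable _ _
lemma gm_sub_mem {x y : ℝ} (h : x ≤ y) : 0 ≤ gm y - gm x ∧ gm y - gm x ≤ y - x := by
  rw [gm_sub]
  constructor
  · exact intervalIntegral.integral_nonneg h fun t _ => gm'_nn t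
  · calc _ ≤ ∫ t in x..y, (1 : ℝ) := intervalIntegral.integral_mono_on h (gm'_cd.continuous.intervalIntegrable _ _) (by simp) fun t _ => gm'_le t
      _ = _ := by simp
lemma gm_pos {x : ℝ} (h : 1 ≤ x) : gm x = x + (gm 1 - 1) := by
  have : gm x - gm 1 = ∫ t in (1:ℝ)..x, (1 : ℝ) := by
    rw [gm_sub]
    refine intervalIntegral.integral_congr fun t ht => ?_
    rw [uIcc_of_le h] at ht
    exact Real.smoothTransition.one_of_one_le (by linarith [ht.1])
  simp at this; linarith
lemma gm_nn (x : ℝ) : 0 ≤ gm x := by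
  rcases le_total x (-1) with h | h
  · rw [gm_neg h]
  · have := (gm_sub_mem h).1; rw [gm_neg le_rfl] at this; linarith
lemma gm_le (x : ℝ) (h : -1 ≤ x) : gm x ≤ x + 1 := by
  have := (gm_sub_mem h).2; rw [gm_neg le_rfl] at this; linarith
lemma gm_conv (x y : ℝ) : gm x + gm' x * (y - x) ≤ gm y := by
  have : gm' x * (y - x) ≤ gm y - gm x := by
    rcases le_total x y with h | h
    · rw [gm_sub]
      calc _ = ∫ t in x..y, gm' x := by simp; ring
        _ ≤ _ := intervalIntegral.integral_mono_on h (by simp) (gm'_cd.continuous.intervalIntegrable _ _) fun t ht => gm'_mono ht.1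
    · have : gm x - gm y ≤ gm' x * (x - y) := by
        rw [gm_sub]
        calc _ ≤ ∫ t in y..x, gm' x := intervalIntegral.integral_mono_on h (gm'_cd.continuous.intervalIntegrable _ _) (by simp) fun t ht => gm'_mono ht.2
          _ = _ := by simp; ring
      linarith
  linarith
def sm (u p : RS m) : RS m := ⟨fun z => p.1 z + gm (u.1 z - p.1 z), by
  change ContDiff ℝ ∞ _
  exact (RS.cd p).add (gm_cd.comp ((RS.cd u).sub (RS.cd p)))⟩
lemma sm_apply (u p : RS m) (z : EE m) : (sm u p).1 z = p.1 z + gm (u.1 z - p.1 z) := rfl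
lemma sm_subm {u p : RS m} (su : SubM u.1) (sp : SubM p.1) : SubM (sm u p).1 := fun a b => by
  set s := gm' (u.1 a - p.1 a) with hs
  have h0 : 0 ≤ s := gm'_nn _
  have h1 : s ≤ 1 := gm'_le _
  have lu := (RS.ct u).lb
  have lp := (RS.ct p).lb
  have hl : LB (fun z => ((1 - s) * p.1 z + s * u.1 z) + (gm (u.1 a - p.1 a) - s * (u.1 a - p.1 a))) :=
    ((lp.smul _).add (lu.smul _)).add (LB.const _)
  have h2 : cm (fun z => ((1 - s) * p.1 z + s * u.1 z) + (gm (u.1 a - p.1 a) - s * (u.1 a - p.1 a))) a b ≤ cm (sm u p).1 a b := by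
    refine cm_mono hl (RS.ct _).lb fun ζ _ => ?_
    rw [sm_apply]
    have := gm_conv (u.1 a - p.1 a) (u.1 (a + ζ • b) - p.1 (a + ζ • b))
    rw [← hs] at this
    linarith
  rw [cm_add ((lp.smul _).add (lu.smul _)) (LB.const _), cm_add (lp.smul _) (lu.smul _), cm_smul, cm_smul, cm_const] at h2
  have := mul_le_mul_of_nonneg_left (su a b) h0
  have := mul_le_mul_of_nonneg_left (sp a b) (sub_nonneg.2 h1)
  rw [sm_apply]; linarith
lemma sm_pd {u p : RS m} {κ : ℝ} (hκ : 0 < κ) (su : SubM (u - κ • nsq).1) (sp : SubM (p - κ • nsq).1) (z : EE m) :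
    (Hz (sm u p) z).PosDef := by
  refine pd_of_subm _ hκ ?_ z
  convert sm_subm su sp using 1
  funext x
  change (p.1 x + gm (u.1 x - p.1 x)) - κ * ‖x‖ ^ 2 = (p.1 x - κ * ‖x‖ ^ 2) + gm ((u.1 x - κ * ‖x‖ ^ 2) - (p.1 x - κ * ‖x‖ ^ 2))
  rw [show (u.1 x - κ * ‖x‖ ^ 2) - (p.1 x - κ * ‖x‖ ^ 2) = u.1 x - p.1 x by ring]; ring
lemma sm_far (u p : RS m) {z : EE m} (h : u.1 z + 1 ≤ p.1 z) : (sm u p).1 z = p.1 z := by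
  rw [sm_apply, gm_neg (by linarith), add_zero]
lemma sm_near (u p : RS m) {z : EE m} (h : p.1 z + 1 ≤ u.1 z) : (sm u p).1 z = u.1 z + (gm 1 - 1) := by
  rw [sm_apply, gm_pos (by linarith)]; ring
lemma sm_mono {u v : RS m} (p : RS m) {z : EE m} (h : u.1 z ≤ v.1 z) : (sm u p).1 z ≤ (sm v p).1 z ∧ (sm v p).1 z ≤ (sm u p).1 z + (v.1 z - u.1 z) := by
  have := gm_sub_mem (x := u.1 z - p.1 z) (y := v.1 z - p.1 z) (by linarith)
  simp only [sm_apply]; constructor <;> linarith [this.1, this.2]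
lemma sm_bd (u p : RS m) (z : EE m) : p.1 z ≤ (sm u p).1 z ∧ (sm u p).1 z ≤ max (p.1 z) (u.1 z + 1) := by
  rw [sm_apply]
  refine ⟨by linarith [gm_nn (u.1 z - p.1 z)], ?_⟩
  rcases le_total (u.1 z - p.1 z) (-1) with h | h
  · rw [gm_neg h]; simp
  · exact le_max_of_le_right (by linarith [gm_le _ h])
end
section
variable {m : ℕ}
section
open Polynomial
variable {ι A : Type*} [Fintype ι] [DecidableEq ι] [CommRing A]
lemma der_pen (d : Dr A) (P Q : Matrix ι ι A) (hP : ∀ a b, d (P a b) = 0) (n : ℕ) :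
    d (dc P Q n) = ((adjugate (pen P Q) * (Q.map d).map C).trace * X).coeff n := by
  have h := der_det' (dCo d) (pen P Q)
  have h2 : (pen P Q).map (dCo d) = (X : A[X]) • (Q.map d).map C := by
    ext1 a b; ext n
    simp only [Matrix.map_apply, dCo_coeff, pen, Matrix.add_apply, Matrix.smul_apply, smul_eq_mul, coeff_add]
    cases n with
    | zero => simp [hP]
    | succ n => simp only [coeff_X_mul, coeff_C]; split_ifs <;> simp_all
  rw [dc, ← dCo_coeff, h, h2, mul_smul_comm, trace_smul, smul_eq_mul, mul_comm]
lemma der_dc (d : Dr A) (P Q : Matrix ι ι A) (hP : ∀ a b, d (P a b) = 0) (i : ℕ) :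
    d (dc P Q (i + 1)) = (Tc P Q i * Q.map d).trace := by
  rw [der_pen d P Q hP, coeff_mul_X, tr_coeff]; rfl
lemma der_dc0 (d : Dr A) (P Q : Matrix ι ι A) (hP : ∀ a b, d (P a b) = 0) : d (dc P Q 0) = 0 := by
  rw [der_pen d P Q hP, coeff_mul_X_zero]
end
lemma toC_van {R : ℝ} {u : RS m} : Van R (toC u) ↔ ∀ z, R < ‖z‖ → u.1 z = 0 :=
  forall₂_congr fun z _ => by rw [← Complex.ofReal_eq_zero]; rfl
def cc (t : ℝ) : Sm m := algebraMap ℂ (Sm m) (t : ℂ)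
lemma cc_mul (t : ℝ) (a : Sm m) : cc t * a = (t : ℂ) • a := (Algebra.smul_def _ _).symm
lemma cc_mul' (t : ℝ) (a : Sm m) : a * cc t = t • a := by rw [mul_comm, cc_mul]; rfl
def Jr (R : ℝ) (a : Sm m) : ℝ := (IR R a).re
lemma Jr_add (R : ℝ) (a b : Sm m) : Jr R (a + b) = Jr R a + Jr R b := by simp [Jr]
lemma Jr_sub (R : ℝ) (a b : Sm m) : Jr R (a - b) = Jr R a - Jr R b := by simp [Jr]
lemma Jr_smul (R t : ℝ) (a : Sm m) : Jr R ((t : ℂ) • a) = t * Jr R a := by simp [Jr]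
lemma Jr_nat (R : ℝ) (n : ℕ) (a : Sm m) : Jr R ((n : Sm m) * a) = n * Jr R a := by
  rw [← Jr_smul, Algebra.smul_def]; simp
lemma Jr_sum (R : ℝ) {ι : Type*} (s : Finset ι) (f : ι → Sm m) : Jr R (∑ i ∈ s, f i) = ∑ i ∈ s, Jr R (f i) := by
  simp [Jr]
lemma Jr_eq (R : ℝ) (a : Sm m) : Jr R a = ∫ z in closedBall (0 : EE m) R, (a.1 z).re := by
  rw [Jr, IR_apply]; exact (integral_re (Sm.intOn a R)).symm
lemma Jr_mono {R : ℝ} {a b : Sm m} (h : ∀ z, ‖z‖ ≤ R → (a.1 z).re ≤ (b.1 z).re) : Jr R a ≤ Jr R b := by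
  rw [Jr_eq, Jr_eq]
  exact setIntegral_mono_on (Sm.intOn a R).re (Sm.intOn b R).re measurableSet_closedBall fun z hz => h z (by simpa using hz)
lemma Jr_nonneg {R : ℝ} {a : Sm m} (h : ∀ z, ‖z‖ ≤ R → 0 ≤ (a.1 z).re) : 0 ≤ Jr R a := by
  have := Jr_mono (a := 0) (b := a) (by simpa using h)
  simpa [Jr] using this
open Polynomial in
lemma IR_poly (R : ℝ) (p : (Sm m)[X]) (t : ℝ) :
    HasDerivAt (fun t : ℝ => Jr R (p.eval (cc t))) (Jr R (p.derivative.eval (cc t))) t := by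
  induction p using Polynomial.induction_on' with
  | add p q hp hq => simp only [eval_add, derivative_add, Jr_add]; exact hp.add hq
  | monomial n a =>
    have e : ∀ (t : ℝ) (n : ℕ) (a : Sm m), Jr R (a * cc t ^ n) = t ^ n * Jr R a := fun t n a => by
      rw [cc, ← map_pow, ← Algebra.commutes, ← Algebra.smul_def, ← Complex.ofReal_pow, Jr_smul]
    simp only [eval_monomial, derivative_monomial, e]
    rw [mul_comm a, Jr_nat]
    have := (hasDerivAt_pow n t).mul_const (Jr R a)
    exact this.congr_deriv (by ring)
def En (R : ℝ) (p u : RS m) : ℝ := ∑ i ∈ Finset.range (m + 1), ((i : ℝ) + 1)⁻¹ * Jr R (toC (u - p) * DD p (u - p) i)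
lemma En_deriv {R : ℝ} (p h k : RS m) (hh : Van R (toC h)) (hk : Van R (toC k)) (t : ℝ) :
    HasDerivAt (fun t : ℝ => En R p (p + h + t • k)) (Jr R (toC k * (HA (p + h + t • k)).det)) t := by
  have e0 : ∀ t : ℝ, p + h + t • k - p = h + t • k := fun t => by abel
  simp only [En, e0]
  have key : ∀ i, HasDerivAt (fun t : ℝ => Jr R (toC (h + t • k) * DD p (h + t • k) i))
      ((i + 1) * Jr R (toC k * DD p (h + t • k) i)) t := fun i => by
    open Polynomial in
    set P : Matrix (Fin m) (Fin m) (Sm m)[X] := (HA p).map C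
    set Q : Matrix (Fin m) (Fin m) (Sm m)[X] := (HA h).map C + (X : (Sm m)[X]) • (HA k).map C
    set H : (Sm m)[X] := C (toC h) + X * C (toC k)
    have eP : ∀ t, P.map (evalRingHom (cc t)) = HA p := fun t => by ext1 a b; simp [P]
    have eQ : ∀ t, Q.map (evalRingHom (cc t)) = HA (h + t • k) := fun t => by
      ext1 a b; simp [Q, HA_add, HA_smul, cc_mul']
    have eH : ∀ t, (evalRingHom (cc t)) H = toC (h + t • k) := fun t => by
      simp [H, toC_smul, cc_mul']
    have edc : ∀ t, (evalRingHom (cc t)) (dc P Q i) = DD p (h + t • k) i := fun t => by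
      have := dc_map (evalRingHom (cc t)) P Q i
      rw [eP, eQ] at this; exact this
    have e1 : ∀ t, (H * dc P Q i).eval (cc t) = toC (h + t • k) * DD p (h + t • k) i := fun t => by
      have := map_mul (evalRingHom (cc t)) H (dc P Q i)
      rw [eH, edc] at this; exact this
    have h1 := IR_poly R (H * dc P Q i) t
    simp only [e1] at h1
    refine h1.congr_deriv ?_
    have dH : derivative H = C (toC k) := by simp [H]
    have dQ : Q.map (dX (A := Sm m)) = (HA k).map C := by
      ext1 a b
      change derivative (Q a b) = _
      simp [Q]
    have dP : ∀ a b, (dX (A := Sm m)) (P a b) = 0 := fun a b => by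
      change derivative (P a b) = 0
      simp [P]
    rw [derivative_mul, dH, eval_add]
    have e2 : (C (toC k) * dc P Q i).eval (cc t) = toC k * DD p (h + t • k) i := by
      have := map_mul (evalRingHom (cc t)) (C (toC k)) (dc P Q i)
      rw [edc] at this; simpa using this
    rw [e2, Jr_add]
    have e3 : Jr R ((H * derivative (dc P Q i)).eval (cc t)) = i * Jr R (toC k * DD p (h + t • k) i) := by
      cases i with
      | zero =>
        have := der_dc0 (dX (A := Sm m)) P Q dP
        change derivative _ = 0 at this
        rw [this]; simp [Jr]
      | succ i =>
        have := der_dc (dX (A := Sm m)) P Q dP i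
        change derivative _ = _ at this
        rw [this, dQ]
        have h5 : (H * (Tc P Q i * (HA k).map C).trace).eval (cc t) = toC (h + t • k) * (TT p (h + t • k) i * HA k).trace := by
          have := map_mul (evalRingHom (cc t)) H (Tc P Q i * (HA k).map C).trace
          have e6 : evalRingHom (cc t) (Tc P Q i * (HA k).map C).trace = (TT p (h + t • k) i * HA k).trace := by
            have e7 : ((HA k).map C).map (evalRingHom (cc t)) = HA k := by ext1 a b; simp
            have e8 := Matrix.map_mul (L := Tc P Q i) (M := (HA k).map C) (f := evalRingHom (cc t))
            rw [AddMonoidHom.map_trace, e8, e7]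
            have e9 := Tc_map (evalRingHom (cc t)) P Q i
            rw [eP, eQ] at e9
            rw [e9]
          rw [eH, e6] at this; exact this
        rw [h5, Jr, IBP_symm _ _ _ _ _ ?_ hk, tr_TB, ← Jr, mul_left_comm]
        · have := Jr_nat R (i + 1) (toC k * DD p (h + t • k) (i + 1))
          push_cast at this ⊢
          exact this
        · rw [map_add, toC_smul]; exact hh.add (hk.smul _)
    rw [e3]; ring
  have h2 := HasDerivAt.fun_sum (u := Finset.range (m + 1)) fun i _ => (key i).const_mul (((i : ℝ) + 1)⁻¹)
  refine h2.congr_deriv ?_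
  have h3 := dc_eval (HA p) (HA (h + t • k)) 1
  rw [one_smul, ← HA_add] at h3
  rw [show p + h + t • k = p + (h + t • k) by abel, h3, Finset.mul_sum, Jr_sum]
  simp only [Fintype.card_fin, one_pow, mul_one]
  refine (Finset.sum_congr rfl fun i _ => ?_).symm
  rw [inv_mul_cancel_left₀ (by positivity)]
end
section
variable {m : ℕ}
lemma det_ev (u : RS m) (z : EE m) : (HA u).det.1 z = (Hz u z).det := (ev z).map_det (HA u)
lemma DD_ev (p q : RS m) (i : ℕ) (z : EE m) : (DD p q i).1 z = dc (Hz p z) (Hz q z) i := dc_map (ev z) _ _ i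
lemma TT_ev (p q k : RS m) (i : ℕ) (z : EE m) : (TT p q i * HA k).trace.1 z = (Tc (Hz p z) (Hz q z) i * Hz k z).trace := by
  rw [← ev_apply, AddMonoidHom.map_trace]
  have := Matrix.map_mul (L := TT p q i) (M := HA k) (f := ev z)
  rw [this, Tc_map]; rfl
lemma toC_re (k : RS m) (a : Sm m) (z : EE m) : ((toC k * a).1 z).re = k.1 z * (a.1 z).re := by
  change ((k.1 z : ℂ) * a.1 z).re = _
  simp
lemma Jdet (R : ℝ) (k u : RS m) : Jr R (toC k * (HA u).det) = ∫ z in closedBall (0 : EE m) R, k.1 z * MA u z := by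
  rw [Jr_eq]; simp only [toC_re, det_ev]; rfl
def PD (u : RS m) : Prop := ∀ z, (Hz u z).PosDef
lemma PD.ma {u : RS m} (h : PD u) (z : EE m) : 0 ≤ MA u z := (Complex.le_def.1 (h z).posSemidef.det_nonneg).1
lemma psd_smul {A : Matrix (Fin m) (Fin m) ℂ} (h : A.PosSemidef) {t : ℝ} (ht : 0 ≤ t) : ((t : ℂ) • A).PosSemidef :=
  h.smul (by exact_mod_cast ht)
lemma pd_smul {A : Matrix (Fin m) (Fin m) ℂ} (h : A.PosDef) {t : ℝ} (ht : 0 < t) : ((t : ℂ) • A).PosDef :=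
  h.smul (by exact_mod_cast ht)
lemma det_mono {P Q : Matrix (Fin m) (Fin m) ℂ} (hP : P.PosDef) (hQ : Q.PosSemidef) : P.det.re ≤ (P + Q).det.re := by
  have h := dc_eval P Q 1
  simp only [one_smul, one_pow, mul_one] at h
  rw [h, Finset.sum_range_succ', dc_zero, Complex.add_re, Complex.re_sum]
  have : 0 ≤ ∑ i ∈ Finset.range (Fintype.card (Fin m)), (dc P Q (i + 1)).re :=
    Finset.sum_nonneg fun i _ => (Complex.le_def.1 (dc_nonneg P Q hP hQ _)).1
  linarith
lemma mass_eq {R : ℝ} {u v : RS m} (h : Van R (toC (u - v))) : Jr R (HA u).det = Jr R (HA v).det := by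
  have h1 := dc_eval (HA v) (HA (u - v)) 1
  rw [one_smul, ← HA_add, add_sub_cancel] at h1
  simp only [one_pow, mul_one] at h1
  rw [h1, Finset.sum_range_succ', dc_zero, Jr_add, Jr_sum, Finset.sum_eq_zero, zero_add]
  intro i _
  have h2 := IBP_one v (u - v) (u - v) i h
  rw [tr_TB] at h2
  have h3 := Jr_nat R (i + 1) (DD v (u - v) (i + 1))
  push_cast at h3
  rw [Jr, h2] at h3
  simp only [Complex.zero_re, zero_eq_mul] at h3
  rcases h3 with h3 | h3
  · exfalso; norm_cast at h3
  · exact h3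
structure PP (R M : ℝ) (p u : RS m) : Prop where
  pd : PD u
  off : ∀ z, R < ‖z‖ → u.1 z = p.1 z
  bd : ∀ z, ‖z‖ ≤ R → |u.1 z| ≤ M
variable {R M : ℝ} {p u v φ : RS m}
lemma PP.van (hu : PP R M p u) (hv : PP R M p v) : Van R (toC (u - v)) :=
  toC_van.2 fun z hz => by change u.1 z - v.1 z = 0; rw [hu.off z hz, hv.off z hz, sub_self]
lemma Hz_seg (u v : RS m) (t : ℝ) (z : EE m) : Hz (v + t • (u - v)) z = ((1 - t : ℝ) : ℂ) • Hz v z + (t : ℂ) • Hz u z := by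
  rw [Hz_add, Hz_smul, Hz_sub]; push_cast; module
lemma PP.seg (hu : PP R M p u) (hv : PP R M p v) {t : ℝ} (h0 : 0 ≤ t) (h1 : t ≤ 1) : PP R M p (v + t • (u - v)) where
  pd z := by
    rw [Hz_seg]
    rcases h1.eq_or_lt with rfl | h1
    · simpa using hu.pd z
    · exact (pd_smul (hv.pd z) (by linarith)).add_posSemidef (psd_smul (hu.pd z).posSemidef h0)
  off z hz := by
    change v.1 z + t * (u.1 z - v.1 z) = _
    rw [hu.off z hz, hv.off z hz]; ring
  bd z hz := by
    change |v.1 z + t * (u.1 z - v.1 z)| ≤ M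
    have a := abs_le.1 (hu.bd z hz); have b := abs_le.1 (hv.bd z hz)
    rw [abs_le]; constructor <;> nlinarith
lemma En_seg (hp : PP R M p p) (hu : PP R M p u) (hv : PP R M p v) (t : ℝ) :
    HasDerivAt (fun t : ℝ => En R p (v + t • (u - v))) (Jr R (toC (u - v) * (HA (v + t • (u - v))).det)) t := by
  have := En_deriv p (v - p) (u - v) (hv.van hp) (hu.van hv) t
  simpa only [add_sub_cancel] using this
lemma Jdet_mono {k : RS m} {w : RS m} (hw : PD w) {ε : ℝ} (h : ∀ z, ‖z‖ ≤ R → k.1 z ≤ ε) :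
    Jr R (toC k * (HA w).det) ≤ ε * Jr R (HA w).det := by
  rw [← Jr_smul]
  refine Jr_mono fun z hz => ?_
  rw [toC_re]
  change _ ≤ ((ε : ℂ) * (HA w).det.1 z).re
  rw [Complex.re_ofReal_mul, det_ev]
  exact mul_le_mul_of_nonneg_right (h z hz) (hw.ma z)
lemma mass_PP (hp : PP R M p p) (hu : PP R M p u) : Jr R (HA u).det = Jr R (HA p).det := mass_eq (hu.van hp)
lemma En_slope (hp : PP R M p p) (hu : PP R M p u) (hv : PP R M p v) {a b : ℝ} (hab : a < b) : ∃ t ∈ Ioo a b,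
    En R p (v + b • (u - v)) - En R p (v + a • (u - v)) = (b - a) * Jr R (toC (u - v) * (HA (v + t • (u - v))).det) := by
  obtain ⟨t, ht, h⟩ := exists_hasDerivAt_eq_slope (fun t : ℝ => En R p (v + t • (u - v))) _ hab
    (fun t _ => (En_seg hp hu hv t).continuousAt.continuousWithinAt) (fun t _ => En_seg hp hu hv t)
  exact ⟨t, ht, by rw [h]; field_simp [(sub_pos.2 hab).ne']⟩
lemma En_le (hp : PP R M p p) (hu : PP R M p u) (hv : PP R M p v) {ε : ℝ} (h : ∀ z, ‖z‖ ≤ R → u.1 z - v.1 z ≤ ε) :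
    En R p u - En R p v ≤ ε * Jr R (HA p).det := by
  obtain ⟨t, ht, e⟩ := En_slope hp hu hv zero_lt_one
  simp only [one_smul, zero_smul, add_zero, add_sub_cancel, sub_zero, one_mul] at e
  have hs := hu.seg hv ht.1.le ht.2.le
  rw [e, ← mass_PP hp hs]
  exact Jdet_mono hs.pd h
lemma En_low (hp : PP R M p p) (hu : PP R M p u) (hv : PP R M p v) (h : ∀ z, ‖z‖ ≤ R → v.1 z ≤ u.1 z) :
    (1/2) ^ (m + 1) * Jr R (toC (u - v) * (HA (v + (1/2 : ℝ) • (u - v))).det) ≤ En R p u - En R p v := by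
  have hk : ∀ z, ‖z‖ ≤ R → 0 ≤ (u - v).1 z := fun z hz => sub_nonneg.2 (h z hz)
  have pos : ∀ w : RS m, PD w → 0 ≤ Jr R (toC (u - v) * (HA w).det) := fun w hw => Jr_nonneg fun z hz => by
    rw [toC_re, det_ev]; exact mul_nonneg (hk z hz) (hw.ma z)
  obtain ⟨t1, h1, e1⟩ := En_slope hp hu hv (show (0:ℝ) < 1/4 by norm_num)
  obtain ⟨t2, h2, e2⟩ := En_slope hp hu hv (show (1/4:ℝ) < 3/4 by norm_num)
  obtain ⟨t3, h3, e3⟩ := En_slope hp hu hv (show (3/4:ℝ) < 1 by norm_num)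
  simp only [one_smul, zero_smul, add_zero, add_sub_cancel] at e1 e3
  have p1 := pos _ (hu.seg hv h1.1.le (by linarith [h1.2])).pd
  have p3 := pos _ (hu.seg hv (t := t3) (by linarith [h3.1]) h3.2.le).pd
  have q := (hu.seg hv (t := 1/2) (by norm_num) (by norm_num)).pd
  have p2 : (1/2) ^ m * Jr R (toC (u - v) * (HA (v + (1/2 : ℝ) • (u - v))).det) ≤ Jr R (toC (u - v) * (HA (v + t2 • (u - v))).det) := by
    rw [← Jr_smul]
    refine Jr_mono fun z hz => ?_
    change ((((1/2) ^ m : ℝ) : ℂ) * (toC (u - v) * (HA (v + (1/2 : ℝ) • (u - v))).det).1 z).re ≤ _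
    rw [Complex.re_ofReal_mul, toC_re, toC_re, det_ev, det_ev, mul_left_comm]
    refine mul_le_mul_of_nonneg_left ?_ (hk z hz)
    have e : Hz (v + t2 • (u - v)) z = ((1/2 : ℝ) : ℂ) • Hz (v + (1/2 : ℝ) • (u - v)) z +
        (((3/4 - t2 : ℝ) : ℂ) • Hz v z + ((t2 - 1/4 : ℝ) : ℂ) • Hz u z) := by
      rw [Hz_seg, Hz_seg]; push_cast; module
    have := det_mono (pd_smul (q z) (show (0:ℝ) < 1/2 by norm_num))
      ((psd_smul (hv.pd z).posSemidef (show 0 ≤ 3/4 - t2 by linarith [h2.2])).add (psd_smul (hu.pd z).posSemidef (show 0 ≤ t2 - 1/4 by linarith [h2.1])))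
    rw [← e, det_smul, Fintype.card_fin, ← Complex.ofReal_pow, Complex.re_ofReal_mul] at this
    exact this
  rw [pow_succ]
  linarith
lemma GG_nonneg {q a : RS m} (hφ : PD φ) (hq : PD q) (i : ℕ) : 0 ≤ Jr R (GG (TT φ q i) (toC a) (toC a)) := by
  refine Jr_nonneg fun z _ => ?_
  have hT := Tc_psd _ _ (hφ z) (hq z).posSemidef i
  set w : Fin m → ℂ := fun l => (db l (toC a)).1 z
  have hw : ∀ l, (dd l (toC a)).1 z = star (w l) := fun l => by
    have e : ∀ v : EE m, (Dv v (toC a)).1 z = (fderiv ℝ a.1 z v : ℂ) := fun v => by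
      rw [Dv_apply]
      have : HasFDerivAt (toC a : EE m → ℂ) (Complex.ofRealCLM.comp (fderiv ℝ a.1 z)) z :=
        Complex.ofRealCLM.hasFDerivAt.comp z (RS.da a z).hasFDerivAt
      rw [this.fderiv]; rfl
    simp only [w, db, dd, Dr.comb_apply]
    change (1/2 : ℂ) * (Dv _ (toC a)).1 z + -(Complex.I/2) * (Dv _ (toC a)).1 z = star ((1/2 : ℂ) * (Dv _ (toC a)).1 z + (Complex.I/2) * (Dv _ (toC a)).1 z)
    simp [e]; ring
  have h := hT.dotProduct_mulVec_nonneg w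
  have e : (GG (TT φ q i) (toC a) (toC a)).1 z = star w ⬝ᵥ (Tc (Hz φ z) (Hz q z) i *ᵥ w) := by
    rw [← ev_apply, GG]
    simp only [map_sum, map_mul, ev_apply, hw]
    rw [Finset.sum_comm]
    simp only [dotProduct, mulVec, Finset.mul_sum]
    refine Finset.sum_congr rfl fun x _ => Finset.sum_congr rfl fun y _ => ?_
    have := congrFun (congrFun (Tc_map (ev z) (HA φ) (HA q) i) x) y
    simp only [Matrix.map_apply, ev_apply] at this
    rw [this]; simp only [w, Pi.star_apply, Hz]; ring
  rw [e]; exact (Complex.le_def.1 h).1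
lemma tr_nn {q w : RS m} (hφ : PD φ) (hq : PD q) (hw : PD w) (i : ℕ) (z : EE m) : 0 ≤ ((TT φ q i * HA w).trace.1 z).re := by
  rw [TT_ev]
  exact (Complex.le_def.1 (trace_mul_nonneg _ _ (Tc_psd _ _ (hφ z) (hq z).posSemidef i) (hw z).posSemidef)).1
lemma tr_add (T : Matrix (Fin m) (Fin m) (Sm m)) (a b : RS m) : (T * HA (a + b)).trace = (T * HA a).trace + (T * HA b).trace := by
  rw [HA_add, mul_add, trace_add]
lemma tr_sub (T : Matrix (Fin m) (Fin m) (Sm m)) (a b : RS m) : (T * HA (a - b)).trace = (T * HA a).trace - (T * HA b).trace := by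
  rw [HA_sub, mul_sub, trace_sub]
lemma tr_smul (T : Matrix (Fin m) (Fin m) (Sm m)) (t : ℝ) (b : RS m) : (T * HA (t • b)).trace = (t : ℂ) • (T * HA b).trace := by
  rw [HA_smul, mul_smul_comm, trace_smul]
lemma CS_form {q h f : RS m} (hφ : PD φ) (hq : PD q) (i : ℕ) (vh : Van R (toC h)) (vf : Van R (toC f)) {s : ℝ} (hs : 0 < s) :
    2 * s * Jr R (toC h * (TT φ q i * HA f).trace) ≤ - Jr R (toC h * (TT φ q i * HA h).trace) + s ^ 2 * (- Jr R (toC f * (TT φ q i * HA f).trace)) := by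
  have h1 := GG_nonneg (R := R) (a := h + s • f) hφ hq i
  have van : Van R (toC (h + s • f)) := by
    rw [map_add, toC_smul]; exact vh.add (vf.smul _)
  have h2 := congrArg Complex.re (IBP1 (TT_div φ q i) _ (h + s • f) (Or.inl van))
  rw [Complex.neg_re, ← Jr, ← Jr, tr_add, tr_smul, map_add, toC_smul, add_mul, mul_add, mul_add, smul_mul_assoc,
    smul_mul_assoc, mul_smul_comm, mul_smul_comm, Jr_add, Jr_add, Jr_add, Jr_smul, Jr_smul, Jr_smul, Jr_smul] at h2
  have h3 := congrArg Complex.re (IBP_symm φ q f h i vf vh)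
  rw [← Jr, ← Jr] at h3
  rw [h3] at h2
  rw [map_add, toC_smul] at h1
  nlinarith
lemma C_step (hM : 0 ≤ M) (hp : PP R M p p) (hu : PP R M p u) (hv : PP R M p v) (hφ : PP R M p φ)
    (h : ∀ z, ‖z‖ ≤ R → v.1 z ≤ u.1 z) (i : ℕ) (hi : i < m) {s : ℝ} (hs : 0 < s) :
    Jr R (toC (u - v) * DD φ (v + (1/2 : ℝ) • (u - v)) i) ≤
      (i + 1) * (1 + 1 / s) * Jr R (toC (u - v) * DD φ (v + (1/2 : ℝ) • (u - v)) (i + 1)) +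
      s * (2 * M * m * Jr R (HA (p + p)).det) := by
  have hqP : PP R M p (v + (1/2 : ℝ) • (u - v)) := hu.seg hv (t := 1/2) (by norm_num) (by norm_num)
  set q := v + (1/2 : ℝ) • (u - v) with hqd
  have hk : ∀ z, ‖z‖ ≤ R → 0 ≤ (u - v).1 z := fun z hz => sub_nonneg.2 (h z hz)
  have eA : (TT φ q i * HA φ).trace = ((m - i : ℕ) : Sm m) * DD φ q i := by
    rw [tr_TA, Fintype.card_fin, Nat.cast_sub hi.le]
  have eB : (TT φ q i * HA q).trace = ((i + 1 : ℕ) : Sm m) * DD φ q (i + 1) := by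
    rw [tr_TB]; push_cast; rfl
  have dn : ∀ j z, 0 ≤ ((DD φ q j).1 z).re := fun j z => by
    rw [DD_ev]; exact (Complex.le_def.1 (dc_nonneg _ _ (hφ.pd z) (hqP.pd z).posSemidef j)).1
  have Dn : ∀ j, 0 ≤ Jr R (toC (u - v) * DD φ q j) := fun j => Jr_nonneg fun z hz => by
    rw [toC_re]; exact mul_nonneg (hk z hz) (dn j z)
  have h1 : ((m - i : ℕ) : ℝ) * Jr R (toC (u - v) * DD φ q i) = ((i + 1 : ℕ) : ℝ) * Jr R (toC (u - v) * DD φ q (i + 1))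
      + Jr R (toC (u - v) * (TT φ q i * HA (φ - q)).trace) := by
    rw [tr_sub, eA, eB, mul_sub, Jr_sub, mul_left_comm, mul_left_comm (toC (u - v)), Jr_nat, Jr_nat]; ring
  have h2 := CS_form hφ.pd hqP.pd i (hu.van hv) (hφ.van hqP) hs
  have h3 : - Jr R (toC (u - v) * (TT φ q i * HA (u - v)).trace) ≤ 2 * ((i + 1 : ℕ) * Jr R (toC (u - v) * DD φ q (i + 1))) := by
    rw [← Jr_nat, mul_left_comm, ← eB]
    have e : (2 : ℝ) * Jr R (toC (u - v) * (TT φ q i * HA q).trace) = Jr R (toC (u - v) * (TT φ q i * HA u).trace) + Jr R (toC (u - v) * (TT φ q i * HA v).trace) := by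
      rw [hqd, tr_add, tr_smul, tr_sub, mul_add, mul_smul_comm, Jr_add, Jr_smul, mul_sub, Jr_sub]; ring
    have n1 : 0 ≤ Jr R (toC (u - v) * (TT φ q i * HA u).trace) := Jr_nonneg fun z hz => by
      rw [toC_re]; exact mul_nonneg (hk z hz) (tr_nn hφ.pd hqP.pd hu.pd i z)
    rw [e, tr_sub, mul_sub, Jr_sub]
    linarith
  have h4 : - Jr R (toC (φ - q) * (TT φ q i * HA (φ - q)).trace) ≤ 2 * M * (2 * m * Jr R (HA (p + p)).det) := by
    have a1 : - Jr R (toC (φ - q) * (TT φ q i * HA (φ - q)).trace) ≤ (2 * M) * Jr R (TT φ q i * HA (φ + q)).trace := by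
      rw [← Jr_smul]
      have : -Jr R (toC (φ - q) * (TT φ q i * HA (φ - q)).trace) = Jr R (-(toC (φ - q) * (TT φ q i * HA (φ - q)).trace)) := by simp [Jr]
      rw [this]
      refine Jr_mono fun z hz => ?_
      change (-((toC (φ - q) * (TT φ q i * HA (φ - q)).trace).1 z)).re ≤ (((2 * M : ℝ) : ℂ) * (TT φ q i * HA (φ + q)).trace.1 z).re
      rw [Complex.neg_re, toC_re, Complex.re_ofReal_mul, tr_sub _ φ q, tr_add _ φ q]
      have b1 := tr_nn hφ.pd hqP.pd hφ.pd i z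
      have b2 := tr_nn hφ.pd hqP.pd hqP.pd i z
      change -((φ.1 z - q.1 z) * ((TT φ q i * HA φ).trace.1 z - (TT φ q i * HA q).trace.1 z).re) ≤ 2 * M * ((TT φ q i * HA φ).trace.1 z + (TT φ q i * HA q).trace.1 z).re
      rw [Complex.sub_re, Complex.add_re]
      have c1 := abs_le.1 (hφ.bd z hz)
      have c2 := abs_le.1 (hqP.bd z hz)
      nlinarith
    have a2 : ∀ j ≤ m, Jr R (DD φ q j) ≤ Jr R (HA (p + p)).det := fun j hj => by
      rw [← mass_eq (u := φ + q) (v := p + p) ?_]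
      · refine Jr_mono fun z _ => ?_
        have h := dc_eval (Hz φ z) (Hz q z) 1
        simp only [one_smul, one_pow, mul_one] at h
        rw [det_ev, Hz_add, h, Complex.re_sum, DD_ev]
        exact Finset.single_le_sum (f := fun j => (dc (Hz φ z) (Hz q z) j).re) (fun j _ => by have := dn j z; rwa [DD_ev] at this) (by simp; omega)
      · have := (hφ.van hp).add (hqP.van hp)
        rw [← map_add] at this
        convert this using 2; abel
    have a0 : 0 ≤ Jr R (HA (p + p)).det := le_trans (Jr_nonneg fun z _ => dn 0 z) (a2 0 (by omega))
    rw [tr_add, eA, eB, Jr_add, Jr_nat, Jr_nat] at a1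
    refine a1.trans (mul_le_mul_of_nonneg_left ?_ (by linarith))
    have b1 : ((m - i : ℕ) : ℝ) * Jr R (DD φ q i) ≤ m * Jr R (HA (p + p)).det :=
      mul_le_mul (by exact_mod_cast Nat.sub_le _ _) (a2 i hi.le) (Jr_nonneg fun z _ => dn i z) (by positivity)
    have b2 : ((i + 1 : ℕ) : ℝ) * Jr R (DD φ q (i + 1)) ≤ m * Jr R (HA (p + p)).det :=
      mul_le_mul (by exact_mod_cast hi) (a2 _ hi) (Jr_nonneg fun z _ => dn _ z) (by positivity)
    linarith
  have h5 : Jr R (toC (u - v) * DD φ q i) ≤ ((m - i : ℕ) : ℝ) * Jr R (toC (u - v) * DD φ q i) :=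
    le_mul_of_one_le_left (Dn i) (by exact_mod_cast (by omega : 1 ≤ m - i))
  have h6 : Jr R (toC (u - v) * (TT φ q i * HA (φ - q)).trace) ≤ (1 / s) * ((i + 1 : ℕ) * Jr R (toC (u - v) * DD φ q (i + 1))) + s * (2 * M * m * Jr R (HA (p + p)).det) := by
    have : s ^ 2 * (- Jr R (toC (φ - q) * (TT φ q i * HA (φ - q)).trace)) ≤ s ^ 2 * (2 * M * (2 * m * Jr R (HA (p + p)).det)) := by gcongr
    rw [← mul_le_mul_iff_right₀ (show 0 < 2 * s by positivity)]
    calc _ ≤ _ := h2.trans (add_le_add h3 this)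
      _ = _ := by field_simp
  push_cast at h1 h6
  linear_combination h5 + h1 + h6
lemma thmC (hM : 0 ≤ M) (hp : PP R M p p) {η : ℝ} (hη : 0 < η) : ∃ δ > 0, ∀ u v φ : RS m, PP R M p u → PP R M p v → PP R M p φ →
    (∀ z, ‖z‖ ≤ R → v.1 z ≤ u.1 z) → En R p u - En R p v ≤ δ → Jr R (toC (u - v) * (HA φ).det) ≤ η := by
  have key : ∀ j ≤ m, ∀ η > 0, ∃ δ > 0, ∀ u v φ : RS m, PP R M p u → PP R M p v → PP R M p φ →
    (∀ z, ‖z‖ ≤ R → v.1 z ≤ u.1 z) → En R p u - En R p v ≤ δ → Jr R (toC (u - v) * DD φ (v + (1/2 : ℝ) • (u - v)) (m - j)) ≤ η := by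
    intro j
    induction j with
    | zero =>
      intro _ η hη
      refine ⟨(1/2) ^ (m + 1) * η, by positivity, fun u v φ hu hv hφ h hE => ?_⟩
      have := (En_low hp hu hv h).trans hE
      have e := dc_card (HA φ) (HA (v + (1/2 : ℝ) • (u - v)))
      rw [Fintype.card_fin] at e
      rw [Nat.sub_zero, DD, e]
      exact le_of_mul_le_mul_left this (by positivity)
    | succ j ih =>
      intro hj η hη
      obtain ⟨K, hK⟩ : ∃ K, K = |2 * M * m * Jr R (HA (p + p)).det| + 1 := ⟨_, rfl⟩
      have hK0 : 0 < K := by rw [hK]; positivity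
      have hK1 : 2 * M * m * Jr R (HA (p + p)).det ≤ K := by rw [hK]; linarith [le_abs_self (2 * M * m * Jr R (HA (p + p)).det)]
      set s := η / (2 * K) with hs
      have hs0 : 0 < s := by positivity
      have hc : 0 < (((m - (j + 1) : ℕ) : ℝ) + 1) * (1 + 1 / s) := by positivity
      obtain ⟨δ, hδ, H⟩ := ih (by omega) (η / 2 / ((((m - (j + 1) : ℕ) : ℝ) + 1) * (1 + 1 / s))) (by positivity)
      refine ⟨δ, hδ, fun u v φ hu hv hφ h hE => ?_⟩
      have a := C_step hM hp hu hv hφ h (m - (j + 1)) (by omega) hs0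
      have b := H u v φ hu hv hφ h hE
      rw [show m - (j + 1) + 1 = m - j by omega] at a
      rw [le_div_iff₀ hc] at b
      have c : s * (2 * M * m * Jr R (HA (p + p)).det) ≤ η / 2 := by
        calc _ ≤ s * K := by gcongr
          _ = _ := by rw [hs]; field_simp
      linarith
  obtain ⟨δ, hδ, H⟩ := key m le_rfl η hη
  refine ⟨δ, hδ, fun u v φ hu hv hφ h hE => ?_⟩
  have := H u v φ hu hv hφ h hE
  rwa [Nat.sub_self, DD, dc_zero] at this
end
section
variable {m : ℕ}
lemma mol_ae {u : EE m → ℝ} (hu : LB u) : ∀ᵐ z : EE m, Tendsto (fun τ => mol τ u z) (𝓝[>] 0) (𝓝 (u z)) := by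
  filter_upwards [IsUnifLocDoublingMeasure.ae_tendsto_average_norm_sub (μ := volume) hu.locInt 1] with z hz
  obtain ⟨C, hC⟩ := (krn_lb (m := m)).bdd 1
  have kb : ∀ y : EE m, |krn y| ≤ C := fun y => by
    rcases le_total ‖y‖ 1 with h | h
    · exact hC y h
    · rw [krn_supp y h, abs_zero]; exact (abs_nonneg _).trans (hC 0 (by simp))
  have h1 := hz (ι := ℝ) (l := 𝓝[>] 0) (fun _ => z) id tendsto_id (by
    filter_upwards [self_mem_nhdsWithin] with τ hτ
    simpa using le_of_lt hτ)
  have h2 := tendsto_integral_smul_of_tendsto_average_norm_sub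
    (g := fun (τ : ℝ) y => (τ ^ Module.finrank ℝ (EE m))⁻¹ * krn (τ⁻¹ • (z - y))) (C * volume.real (ball (0 : EE m) 1)) h1
    (Eventually.of_forall fun τ => hu.locInt.integrableOn_isCompact (isCompact_closedBall _ _)) ?_ ?_ ?_
  · refine h2.congr' ?_
    filter_upwards [self_mem_nhdsWithin] with τ hτ
    rw [mol_eq_conv hτ]; simp only [smul_eq_mul, mul_comm]
  · refine tendsto_const_nhds.congr' ?_
    filter_upwards [self_mem_nhdsWithin] with τ hτ
    have := mol_eq_conv (m := m) hτ (fun _ => 1) z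
    rw [mol_const] at this; simpa using this
  · filter_upwards [self_mem_nhdsWithin] with τ hτ y hy
    by_contra h
    refine hy ?_
    have hτ : 0 < τ := hτ
    simp only [id, mem_closedBall, not_le, dist_comm y, dist_eq_norm] at h
    change _ * krn _ = 0
    rw [krn_supp, mul_zero]
    rw [norm_smul, norm_inv, Real.norm_eq_abs, abs_of_pos hτ, inv_mul_eq_div, one_le_div hτ]
    exact h.le
  · filter_upwards [self_mem_nhdsWithin] with τ hτ y
    have hτ : 0 < τ := hτ
    have hv : volume.real (ball (0 : EE m) 1) ≠ 0 := (ENNReal.toReal_pos (measure_ball_pos _ _ one_pos).ne' measure_ball_lt_top.ne).ne'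
    rw [Measure.addHaar_real_closedBall _ _ (by simpa using hτ.le), id, abs_mul, abs_of_pos (by positivity), mul_div_mul_right _ _ hv, inv_mul_eq_div]
    exact div_le_div_of_nonneg_right (kb _) (by positivity)
lemma subm_nsq : SubM (nsq : RS m).1 := fun a b => by
  have h1 := cm_rot (nsq : RS m).1 a b (-1) (by simp)
  have lb := (RS.ct (nsq : RS m)).lb
  have h : cm (fun z => 2 * (nsq : RS m).1 a) a b ≤ cm (nsq : RS m).1 a b + cm (nsq : RS m).1 a ((-1 : ℂ) • b) := by
    have c2 : Continuous fun z : EE m => (nsq : RS m).1 ((2 : ℝ) • a - z) := (RS.ct (nsq : RS m)).comp (by fun_prop)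
    have e2 : ∀ x : EE m, (2 : ℝ) • a - (a + x) = a - x := fun x => by rw [two_smul]; abel
    have e : cm (nsq : RS m).1 a ((-1 : ℂ) • b) = cm (fun z => (nsq : RS m).1 ((2 : ℝ) • a - z)) a b := by
      unfold cm; congr 1; funext ζ; beta_reduce; rw [e2, neg_one_smul, smul_neg, sub_eq_add_neg]
    rw [e, ← cm_add lb c2.lb]
    refine cm_mono (LB.const _) ((RS.ct (nsq : RS m)).add c2).lb fun ζ _ => ?_
    change 2 * ‖a‖ ^ 2 ≤ ‖a + ζ • b‖ ^ 2 + ‖(2 : ℝ) • a - (a + ζ • b)‖ ^ 2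
    rw [e2]
    have := parallelogram_law_with_norm ℂ a (ζ • b)
    nlinarith [sq_nonneg ‖ζ • b‖]
  rw [cm_const, h1] at h; linarith
lemma SubM.add' {u v : EE m → ℝ} (su : SubM u) (sv : SubM v) (hu : LB u) (hv : LB v) : SubM fun z => u z + v z := fun a b => by
  rw [cm_add hu hv]; exact add_le_add (su a b) (sv a b)
lemma SubM.smul' {u : EE m → ℝ} (su : SubM u) {t : ℝ} (ht : 0 ≤ t) : SubM fun z => t * u z := fun a b => by
  rw [cm_smul]; exact mul_le_mul_of_nonneg_left (su a b) ht
lemma SubM.const (t : ℝ) : SubM fun _ : EE m => t := fun a b => by rw [cm_const]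
def toRS (f : EE m → ℝ) : RS m := open Classical in if h : ContDiff ℝ ∞ f then ⟨f, h⟩ else 0
lemma toRS_eq {f : EE m → ℝ} (h : ContDiff ℝ ∞ f) : (toRS f).1 = f := by rw [toRS, dif_pos h]
def pB (B : ℝ) : RS m := ⟨fun z => ‖z‖ ^ 2 - B, by change ContDiff ℝ ∞ _; exact (contDiff_norm_sq ℂ).sub contDiff_const⟩
def RR (A B : ℝ) : ℝ := 2 * (A + B + 5)
def MM (A B : ℝ) : ℝ := RR A B ^ 2 + A + B + RR A B + 10
def V (B : ℝ) (f : EE m → ℝ) : RS m := sm (toRS fun z => f z + ‖z‖ ^ 2 / 2) (pB B)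
structure GS (A : ℝ) (f : EE m → ℝ) : Prop where
  cd : ContDiff ℝ ∞ f
  sub : SubM f
  nn : ∀ z, 0 ≤ f z
  up : ∀ z, f z ≤ A + 1 + Real.log (2 + ‖z‖)
structure GC (A : ℝ) (f : EE m → ℝ) : Prop where
  lb : LB f
  sub : SubM f
  nn : ∀ z, 0 ≤ f z
  up : ∀ z, f z ≤ A + Real.log (1 + ‖z‖)
section
variable {A B : ℝ} {f g : EE m → ℝ}
lemma log2_le (z : EE m) : Real.log (2 + ‖z‖) ≤ 1 + ‖z‖ := by
  have := Real.log_le_sub_one_of_pos (x := 2 + ‖z‖) (by positivity); linarith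
lemma V_arg (hf : ContDiff ℝ ∞ f) : (toRS fun z => f z + ‖z‖ ^ 2 / 2).1 = fun z => f z + ‖z‖ ^ 2 / 2 :=
  toRS_eq (hf.add ((contDiff_norm_sq ℂ).div_const _))
lemma V_PP (hA : 0 ≤ A) (hB : 0 ≤ B) (hf : GS A f) : PP (RR A B) (MM A B) (pB B) (V B f) where
  pd := fun z => by
    refine sm_pd (κ := 1/2) (by norm_num) ?_ ?_ z
    · convert hf.sub using 1
      funext x
      change (toRS fun z => f z + ‖z‖ ^ 2 / 2).1 x - 1/2 * ‖x‖ ^ 2 = _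
      rw [V_arg hf.cd]; ring
    · have := (subm_nsq (m := m)).smul' (t := 1/2) (by norm_num)
      convert this.add' (SubM.const (-B)) ((RS.ct nsq).lb.smul _) (LB.const _) using 1
      funext x
      change (‖x‖ ^ 2 - B) - 1/2 * ‖x‖ ^ 2 = 1/2 * ‖x‖ ^ 2 + (-B)
      ring
  off := fun z hz => by
    refine sm_far _ _ ?_
    rw [V_arg hf.cd]
    change f z + ‖z‖ ^ 2 / 2 + 1 ≤ ‖z‖ ^ 2 - B
    have := hf.up z
    have := log2_le z
    unfold RR at hz
    nlinarith
  bd := fun z hz => by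
    have h := sm_bd (toRS fun z => f z + ‖z‖ ^ 2 / 2) (pB B) z
    rw [V_arg hf.cd] at h
    change ‖z‖ ^ 2 - B ≤ (V B f).1 z ∧ (V B f).1 z ≤ max (‖z‖ ^ 2 - B) (f z + ‖z‖ ^ 2 / 2 + 1) at h
    have := hf.up z
    have := log2_le z
    have h3 : ‖z‖ ^ 2 ≤ RR A B ^ 2 := by gcongr
    have h4 := norm_nonneg z
    rw [abs_le]; unfold MM
    constructor
    · nlinarith [h.1]
    · refine h.2.trans (max_le ?_ ?_) <;> nlinarith
lemma pB_PP (hA : 0 ≤ A) (hB : 0 ≤ B) : PP (RR A B) (MM A B) (pB B) (pB B : RS m) where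
  pd := fun z => pd_of_subm _ one_pos (by
    convert SubM.const (-B) using 1
    funext x
    change (‖x‖ ^ 2 - B) - 1 * ‖x‖ ^ 2 = -B
    ring) z
  off := fun z _ => rfl
  bd := fun z hz => by
    change |‖z‖ ^ 2 - B| ≤ MM A B
    have h3 : ‖z‖ ^ 2 ≤ RR A B ^ 2 := by gcongr
    have h4 := norm_nonneg z
    rw [abs_le]; unfold MM
    constructor <;> nlinarith
lemma V_mono (hf : ContDiff ℝ ∞ f) (hg : ContDiff ℝ ∞ g) {z : EE m} (h : f z ≤ g z) : (V B f).1 z ≤ (V B g).1 z ∧ (V B g).1 z - (V B f).1 z ≤ g z - f z := by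
  have := sm_mono (u := toRS fun z => f z + ‖z‖ ^ 2 / 2) (v := toRS fun z => g z + ‖z‖ ^ 2 / 2) (pB B) (z := z) (by rw [V_arg hf, V_arg hg]; linarith)
  rw [V_arg hf, V_arg hg] at this
  exact ⟨this.1, by have := this.2; unfold V; linarith⟩
lemma V_near (hf : ContDiff ℝ ∞ f) {z : EE m} (h0 : 0 ≤ f z) (h : ‖z‖ ^ 2 + 1 ≤ B) : (V B f).1 z = f z + ‖z‖ ^ 2 / 2 + (gm 1 - 1) := by
  have := sm_near (toRS fun z => f z + ‖z‖ ^ 2 / 2) (pB B) (z := z) (by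
    rw [V_arg hf]; change ‖z‖ ^ 2 - B + 1 ≤ _; nlinarith [sq_nonneg ‖z‖])
  rw [V, this, V_arg hf]
lemma V_ge (z : EE m) : (pB B : RS m).1 z ≤ (V B f).1 z := (sm_bd _ _ z).1
lemma GC.mol (hg : GC A g) {τ : ℝ} (h0 : 0 < τ) (h1 : τ ≤ 1) {s : ℝ} (hs : 0 ≤ s) (hs1 : s ≤ 1) : GS A (fun z => mol τ g z + s) where
  cd := (mol_smooth hg.lb h0).add contDiff_const
  sub := (mol_sub hg.lb hg.sub τ).add' (SubM.const s) (mol_cont hg.lb h0).lb (LB.const _)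
  nn := fun z => add_nonneg (le_mol' hg.lb h0.le fun y _ => hg.nn y) hs
  up := fun z => by
    have : _root_.mol τ g z ≤ A + Real.log (2 + ‖z‖) := mol_le hg.lb h0.le fun y hy => by
      refine (hg.up y).trans (add_le_add_right (Real.log_le_log (by positivity) ?_) _)
      have := norm_le_norm_add_norm_sub z y
      rw [dist_eq_norm, norm_sub_rev] at hy
      linarith [norm_sub_rev z y]
    linarith
end
end
section
variable {m : ℕ} {A B : ℝ} {f g : EE m → ℝ}
def EN (A B : ℝ) (f : EE m → ℝ) : ℝ := En (RR A B) (pB B) (V B f)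
def ms (τ s : ℝ) (g : EE m → ℝ) (z : EE m) : ℝ := mol τ g z + s
lemma EN_add (hA : 0 ≤ A) (hB : 0 ≤ B) (hf : GS A f) (hg : GS A g) {s : ℝ} (hs : 0 ≤ s)
    (h : ∀ z, ‖z‖ ≤ RR A B → g z ≤ f z + s) : EN A B g ≤ EN A B f + s * Jr (RR A B) (HA (pB B : RS m)).det := by
  have := En_le (pB_PP hA hB) (V_PP hA hB hg) (V_PP hA hB hf) (ε := s) fun z hz => by
    rcases le_total (f z) (g z) with h1 | h1
    · linarith [(V_mono (B := B) hf.cd hg.cd h1).2, h z hz]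
    · linarith [(V_mono (B := B) hg.cd hf.cd h1).1]
  unfold EN; linarith
lemma EN_mono (hA : 0 ≤ A) (hB : 0 ≤ B) (hf : GS A f) (hg : GS A g)
    (h : ∀ z, ‖z‖ ≤ RR A B → g z ≤ f z) : EN A B g ≤ EN A B f := by
  have := EN_add hA hB hf hg le_rfl (by simpa using h)
  simpa using this
lemma mol_small (hg : GC A g) {t : ℝ} (ht : 0 < t) {s : ℝ} (hs : 0 < s) (R : ℝ) :
    ∀ᶠ τ in 𝓝[>] (0:ℝ), ∀ z, ‖z‖ ≤ R → mol τ g z ≤ mol t g z + s := by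
  have hc := (isCompact_closedBall (0 : EE m) (R + 1)).uniformContinuousOn_of_continuous (mol_cont hg.lb ht).continuousOn
  obtain ⟨δ, hδ, h⟩ := Metric.uniformContinuousOn_iff.1 hc s hs
  filter_upwards [Ioo_mem_nhdsGT (lt_min hδ one_pos)] with τ hτ z hz
  have hτ2 := lt_min_iff.1 hτ.2
  refine (mol_mono_on hg.lb (mol_cont hg.lb ht).lb hτ.1.le fun y _ => le_mol hg.lb hg.sub t y).trans ?_
  refine mol_le (mol_cont hg.lb ht).lb hτ.1.le fun y hy => ?_
  have h1 : ‖y‖ ≤ R + 1 := by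
    have := norm_le_norm_add_norm_sub z y
    rw [dist_eq_norm] at hy
    linarith [norm_sub_rev z y]
  have := h y (by simpa using h1) z (by simp; linarith) (hy.trans_lt hτ2.1)
  rw [Real.dist_eq] at this
  linarith [(abs_lt.1 this).2]
def ebar (A B : ℝ) (g : EE m → ℝ) : ℝ := sInf ((fun τ => EN A B (ms τ 0 g)) '' Ioc 0 1)
lemma EN_low (hA : 0 ≤ A) (hB : 0 ≤ B) (hf : GS A f) : En (RR A B) (pB B) (pB B : RS m) ≤ EN A B f := by
  have := En_le (pB_PP hA hB) (pB_PP hA hB) (V_PP hA hB hf) (ε := 0) fun z hz => by linarith [V_ge (B := B) (f := f) z]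
  unfold EN; linarith
lemma GC.ms (hg : GC A g) {τ : ℝ} (h0 : 0 < τ) (h1 : τ ≤ 1) : GS A (ms τ 0 g) := hg.mol h0 h1 le_rfl zero_le_one
lemma eb_le (hA : 0 ≤ A) (hB : 0 ≤ B) (hg : GC A g) {τ : ℝ} (h0 : 0 < τ) (h1 : τ ≤ 1) : ebar A B g ≤ EN A B (ms τ 0 g) :=
  csInf_le ⟨En (RR A B) (pB B) (pB B : RS m), by rintro _ ⟨t, ht, rfl⟩; exact EN_low hA hB (hg.ms ht.1 ht.2)⟩ ⟨τ, ⟨h0, h1⟩, rfl⟩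
lemma ev01 : ∀ᶠ τ in 𝓝[>] (0:ℝ), 0 < τ ∧ τ ≤ 1 := by
  filter_upwards [Ioo_mem_nhdsGT one_pos] with τ h using ⟨h.1, h.2.le⟩
lemma eb_near (hA : 0 ≤ A) (hB : 0 ≤ B) (hg : GC A g) {δ : ℝ} (hδ : 0 < δ) :
    ∀ᶠ τ in 𝓝[>] (0:ℝ), EN A B (ms τ 0 g) ≤ ebar A B g + δ := by
  have hne : ((fun τ => EN A B (_root_.ms τ 0 g)) '' Ioc 0 1).Nonempty := ⟨_, 1, ⟨one_pos, le_rfl⟩, rfl⟩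
  obtain ⟨_, ⟨t, ht, rfl⟩, h⟩ := exists_lt_of_csInf_lt hne (show sInf _ < ebar A B g + δ / 2 by unfold ebar; linarith)
  set J := Jr (RR A B) (HA (pB B : RS m)).det with hJ
  have hJ0 : 0 ≤ J := Jr_nonneg fun z _ => by rw [det_ev]; exact (pB_PP hA hB).pd.ma z
  set s := min 1 (δ / (2 * (J + 1))) with hs
  have hs0 : 0 < s := lt_min one_pos (by positivity)
  have hsJ : s * J ≤ δ / 2 := by
    have : s ≤ δ / (2 * (J + 1)) := min_le_right _ _
    calc s * J ≤ δ / (2 * (J + 1)) * (J + 1) := by gcongr; linarith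
      _ = δ / 2 := by field_simp
  filter_upwards [mol_small hg ht.1 hs0 (RR A B), ev01] with τ h1 h2
  have := EN_add hA hB (hg.ms ht.1 ht.2) (hg.ms h2.1 h2.2) hs0.le fun z hz => by
    simpa [_root_.ms] using h1 z hz
  simp only at h
  linarith
lemma eb_mono (hA : 0 ≤ A) (hB : 0 ≤ B) (hf : GC A f) (hg : GC A g) (h : ∀ z, f z ≤ g z) : ebar A B f ≤ ebar A B g := by
  refine le_of_forall_pos_le_add fun δ hδ => ?_
  obtain ⟨τ, h1, h2⟩ := ((eb_near hA hB hg hδ).and ev01).exists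
  refine (eb_le hA hB hf h2.1 h2.2).trans (le_trans ?_ h1)
  exact EN_mono hA hB (hg.ms h2.1 h2.2) (hf.ms h2.1 h2.2) fun z _ => add_le_add_left (mol_mono_on hf.lb hg.lb h2.1.le fun y _ => h y) _
lemma GC.max (hf : GC A f) (hg : GC A g) : GC A fun z => max (f z) (g z) :=
  ⟨hf.lb.max hg.lb, hf.sub.max hg.sub hf.lb hg.lb, fun z => le_max_of_le_left (hf.nn z), fun z => max_le (hf.up z) (hg.up z)⟩
lemma GC.sup {f : ℕ → EE m → ℝ} (hf : ∀ j, GC A (f j)) : GC A (fun z => ⨆ j, f j z) ∧ ∀ j z, f j z ≤ ⨆ j, f j z := by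
  have bd : ∀ z, BddAbove (range fun j => f j z) := fun z => ⟨_, by rintro _ ⟨j, rfl⟩; exact (hf j).up z⟩
  have le : ∀ j z, f j z ≤ ⨆ j, f j z := fun j z => le_ciSup (bd z) j
  have up : ∀ z, (⨆ j, f j z) ≤ A + Real.log (1 + ‖z‖) := fun z => ciSup_le fun j => (hf j).up z
  have nn : ∀ z, 0 ≤ ⨆ j, f j z := fun z => ((hf 0).nn z).trans (le 0 z)
  have lb : LB fun z => ⨆ j, f j z := ⟨Measurable.iSup fun j => (hf j).lb.meas, fun r => ⟨A + Real.log (1 + r), fun z hz => by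
    rw [abs_of_nonneg (nn z)]; exact (up z).trans (by linarith [log1_mono hz])⟩⟩
  exact ⟨⟨lb, fun a b => ciSup_le fun j => ((hf j).sub a b).trans (cm_mono (hf j).lb lb fun ζ _ => le j _), nn, up⟩, le⟩
lemma seq_lemma {X : Set (EE m)} (hA : 0 ≤ A) {ε : ℝ} (h : ∀ a ∈ X, ∀ δ > 0, ∃ z, dist z a < δ ∧ ∃ f, (GC A f ∧ UpperSemicontinuous f ∧ ∀ x ∈ X, f x = 0) ∧ ε ≤ f z) :
    ∃ f : ℕ → EE m → ℝ, (∀ z, Monotone fun j => f j z) ∧ (∀ j, GC A (f j) ∧ UpperSemicontinuous (f j) ∧ ∀ x ∈ X, f j x = 0) ∧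
      ∀ a ∈ X, ∀ δ > 0, ∃ z, dist z a < δ ∧ ∃ j, ε ≤ f j z := by
  have ch : ∀ i : ℕ, ∃ f : EE m → ℝ, (GC A f ∧ UpperSemicontinuous f ∧ ∀ x ∈ X, f x = 0) ∧
      ((∃ f : EE m → ℝ, (GC A f ∧ UpperSemicontinuous f ∧ ∀ x ∈ X, f x = 0) ∧ ∃ z ∈ ball (TopologicalSpace.denseSeq (EE m) i.unpair.1) (1 / ((i.unpair.2 : ℝ) + 1)), ε ≤ f z) →
        ∃ z ∈ ball (TopologicalSpace.denseSeq (EE m) i.unpair.1) (1 / ((i.unpair.2 : ℝ) + 1)), ε ≤ f z) := fun i => by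
    by_cases hh : ∃ f : EE m → ℝ, (GC A f ∧ UpperSemicontinuous f ∧ ∀ x ∈ X, f x = 0) ∧ ∃ z ∈ ball (TopologicalSpace.denseSeq (EE m) i.unpair.1) (1 / ((i.unpair.2 : ℝ) + 1)), ε ≤ f z
    · obtain ⟨f, h1, h2⟩ := hh; exact ⟨f, h1, fun _ => h2⟩
    · refine ⟨fun _ => 0, ⟨⟨LB.const 0, SubM.const 0, fun _ => le_rfl, fun z => by linarith [log1_nonneg z]⟩, continuous_const.upperSemicontinuous, fun _ _ => rfl⟩, fun h => (hh h).elim⟩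
  choose F hF hF2 using ch
  set f : ℕ → EE m → ℝ := fun j => Nat.rec (F 0) (fun n G => fun z => max (G z) (F (n + 1) z)) j with hf
  have hs : ∀ j, f (j + 1) = fun z => max (f j z) (F (j + 1) z) := fun j => rfl
  refine ⟨f, fun z => monotone_nat_of_le_succ fun j => by rw [hs]; exact le_max_left _ _, fun j => ?_, fun a ha δ hδ => ?_⟩
  · induction j with
    | zero => exact hF 0
    | succ j ih =>
      rw [hs]
      exact ⟨ih.1.max (hF _).1, ih.2.1.sup (hF _).2.1, fun x hx => by simp [ih.2.2 x hx, (hF (j + 1)).2.2 x hx]⟩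
  · have le : ∀ j z, F j z ≤ f j z := fun j z => by
      cases j with
      | zero => exact le_rfl
      | succ j => rw [hs]; exact le_max_right _ _
    obtain ⟨n, hn⟩ := exists_nat_one_div_lt (half_pos hδ)
    set r : ℝ := 1 / ((n : ℝ) + 1) with hr
    have hr0 : 0 < r := by positivity
    obtain ⟨k, hk⟩ := (TopologicalSpace.denseRange_denseSeq (EE m)).exists_dist_lt a hr0
    obtain ⟨z, hz, f', hf', he⟩ := h a ha (r - dist a (TopologicalSpace.denseSeq (EE m) k)) (by linarith)
    have := hF2 (Nat.pair k n) ⟨f', hf', z, by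
      simp only [Nat.unpair_pair, mem_ball]
      linarith [dist_triangle z a (TopologicalSpace.denseSeq (EE m) k)], he⟩
    simp only [Nat.unpair_pair, mem_ball] at this
    obtain ⟨w, hw, hwe⟩ := this
    exact ⟨w, by linarith [dist_triangle_right w a (TopologicalSpace.denseSeq (EE m) k)], _, hwe.trans (le _ w)⟩
end
section
variable {m : ℕ} {A B : ℝ} {f g : EE m → ℝ}
lemma MA_cont (u : RS m) : Continuous (MA u) := by
  have : MA u = fun z => ((HA u).det.1 z).re := funext fun z => by rw [det_ev]; rfl
  rw [this]; exact Complex.continuous_re.comp (Sm.ct _)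
theorem null_lemma (hA : 0 ≤ A) (hB : 0 ≤ B) {X : Set (EE m)} (hX : ∀ x ∈ X, ‖x‖ ^ 2 + 1 < B) {ε : ℝ} (hε : 0 < ε)
    (h : ∀ a ∈ X, ∀ δ > 0, ∃ z, dist z a < δ ∧ ∃ f, (GC A f ∧ UpperSemicontinuous f ∧ ∀ x ∈ X, f x = 0) ∧ ε ≤ f z)
    {η : ℝ} (hη : 0 < η) : ∃ O : Set (EE m), IsOpen O ∧ X ⊆ O ∧ O ⊆ closedBall 0 (RR A B) ∧
      ∀ φ, PP (RR A B) (MM A B) (pB B) φ → ∫ z in O, MA φ z ≤ η := by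
  obtain ⟨f, fm, hf, hd⟩ := seq_lemma hA h
  obtain ⟨hU, le⟩ := GC.sup fun j => (hf j).1
  set U : EE m → ℝ := fun z => ⨆ j, f j z with hUd
  have hp := pB_PP (m := m) hA hB
  have hmol : ∀ t > 0, ∀ a ∈ X, ε ≤ mol t U a := fun t ht a ha => by
    by_contra! hc
    obtain ⟨δ, hδ, hh⟩ := Metric.eventually_nhds_iff.1 ((mol_cont hU.lb ht).continuousAt.eventually_lt continuousAt_const hc)
    obtain ⟨z, hz, j, hj⟩ := hd a ha δ hδ
    linarith [hh hz, le_mol hU.lb hU.sub t z, le j z]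
  have hM0 : 0 ≤ MM A B := by unfold MM RR; nlinarith
  obtain ⟨δ, hδ, hC⟩ := thmC hM0 hp (show 0 < ε * η / 4 by positivity)
  set J := Jr (RR A B) (HA (pB B : RS m)).det with hJ
  have hJ0 : 0 ≤ J := Jr_nonneg fun z _ => by rw [det_ev]; exact hp.pd.ma z
  set s := min 1 (δ / (2 * (J + 1))) with hs
  have hs0 : 0 < s := lt_min one_pos (by positivity)
  have hsJ : s * J ≤ δ / 2 := by
    have : s ≤ δ / (2 * (J + 1)) := min_le_right _ _
    calc s * J ≤ δ / (2 * (J + 1)) * (J + 1) := by gcongr; linarith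
      _ = δ / 2 := by field_simp
  obtain ⟨t, ht1, ht⟩ := ((eb_near hA hB hU (half_pos hδ)).and ev01).exists
  have gsW : GS A (ms t s U) := hU.mol ht.1 ht.2 hs0.le (min_le_left _ _)
  have hEW : EN A B (ms t s U) ≤ ebar A B U + δ := by
    have := EN_add hA hB (hU.ms ht.1 ht.2) gsW hs0.le fun z _ => by simp [ms]
    linarith
  obtain ⟨j, hj⟩ : ∃ j, ∀ k ≥ j, ebar A B (f k) ≤ ebar A B (f j) + δ / 2 := by
    have bd : BddAbove (range fun k => ebar A B (f k)) := ⟨ebar A B U, by rintro _ ⟨k, rfl⟩; exact eb_mono hA hB (hf k).1 hU (le k)⟩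
    obtain ⟨_, ⟨j, rfl⟩, hj⟩ := exists_lt_of_lt_csSup (range_nonempty fun k => ebar A B (f k)) (sub_lt_self (sSup _) (half_pos hδ))
    exact ⟨j, fun k _ => by have := le_csSup bd ⟨k, rfl⟩; simp only at hj; linarith⟩
  set O : Set (EE m) := ({z | f j z < ε / 4} ∩ {z | 3 * ε / 4 < mol t U z}) ∩ {z | ‖z‖ ^ 2 + 1 < B} with hO
  have oO : IsOpen O := by
    refine (IsOpen.inter ?_ ?_).inter ?_
    · exact (hf j).2.1.isOpen_preimage _
    · exact isOpen_lt continuous_const (mol_cont hU.lb ht.1)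
    · exact isOpen_lt (by fun_prop) continuous_const
  have OB : O ⊆ closedBall 0 (RR A B) := fun z hz => by
    have h3 : ‖z‖ ^ 2 + 1 < B := hz.2
    simp only [mem_closedBall_zero_iff]; unfold RR; nlinarith [norm_nonneg z]
  refine ⟨O, oO, fun a ha => ⟨⟨?_, ?_⟩, hX a ha⟩, OB, fun φ hφ => ?_⟩
  · change f j a < ε / 4; rw [(hf j).2.2 a ha]; positivity
  · change 3 * ε / 4 < _; linarith [hmol t ht.1 a ha]
  have cτ : ∀ k : ℕ, ∃ τ : ℝ, (0 < τ ∧ τ ≤ 1) ∧ τ < 1 / ((k : ℝ) + 1) ∧ EN A B (ms τ 0 (f k)) ≤ ebar A B (f k) + δ / 2 := fun k => by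
    obtain ⟨τ, h1, h2, h3⟩ := ((eb_near hA hB (hf k).1 (half_pos hδ)).and (ev01.and (Ioo_mem_nhdsGT (show (0:ℝ) < 1 / ((k : ℝ) + 1) by positivity)))).exists
    exact ⟨τ, h2, h3.2, h1⟩
  choose τ hτ hτk hτE using cτ
  set σ : ℕ → ℝ := fun k => 1 / ((k : ℝ) + 1) with hσ
  have σ0 : ∀ k, 0 < σ k := fun k => by simp only [hσ]; positivity
  have σ1 : ∀ k, σ k ≤ 1 := fun k => by simp only [hσ]; rw [div_le_one (by positivity)]; linarith [(Nat.cast_nonneg k : (0:ℝ) ≤ k)]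
  have σt : Tendsto σ atTop (𝓝[>] 0) := tendsto_nhdsWithin_iff.2 ⟨tendsto_one_div_add_atTop_nhds_zero_nat, Eventually.of_forall σ0⟩
  have τt : Tendsto τ atTop (𝓝[>] 0) := tendsto_nhdsWithin_iff.2 ⟨squeeze_zero (fun k => (hτ k).1.le) (fun k => (hτk k).le) tendsto_one_div_add_atTop_nhds_zero_nat, Eventually.of_forall fun k => (hτ k).1⟩
  have c0 : Continuous (MA φ) := MA_cont φ
  set G : ℕ → EE m → ℝ := fun k z => (O.indicator (fun z => 3 * ε / 4 - mol (τ k) (f j) z) z - (mol (σ k) U z - f k z)) * MA φ z with hG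
  set C := A + 1 + Real.log (2 + RR A B) with hCd
  have bC : ∀ w : EE m → ℝ, GS A w → ∀ z, ‖z‖ ≤ RR A B → |w z| ≤ C := fun w hw z hz => by
    rw [abs_of_nonneg (hw.nn z)]
    exact (hw.up z).trans (add_le_add_right (Real.log_le_log (by positivity) (by linarith)) _)
  have bD : ∀ w : EE m → ℝ, GC A w → ∀ z, ‖z‖ ≤ RR A B → |w z| ≤ C := fun w hw z hz => by
    rw [abs_of_nonneg (hw.nn z)]
    refine (hw.up z).trans ?_
    have := Real.log_le_log (x := 1 + ‖z‖) (y := 2 + RR A B) (by positivity) (by linarith)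
    linarith
  have Gm : ∀ k, AEStronglyMeasurable (G k) (volume.restrict (closedBall 0 (RR A B))) := fun k => by
    refine Measurable.aestronglyMeasurable (Measurable.mul (Measurable.sub (Measurable.indicator ?_ oO.measurableSet) (Measurable.sub ?_ (hf k).1.lb.meas)) c0.measurable)
    · exact measurable_const.sub (mol_cont (hf j).1.lb (hτ k).1).measurable
    · exact (mol_cont hU.lb (σ0 k)).measurable
  have Ib : IntegrableOn (fun z => (3 * ε / 4 + C + (C + C)) * MA φ z) (closedBall 0 (RR A B)) :=
    (continuous_const.mul c0).continuousOn.integrableOn_compact (isCompact_closedBall _ _)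
  have Gb : ∀ k, ∀ᵐ z ∂(volume.restrict (closedBall 0 (RR A B))), ‖G k z‖ ≤ (3 * ε / 4 + C + (C + C)) * MA φ z := fun k => by
    filter_upwards [ae_restrict_mem measurableSet_closedBall] with z hz
    rw [mem_closedBall_zero_iff] at hz
    rw [Real.norm_eq_abs, abs_mul, abs_of_nonneg (hφ.pd.ma z)]
    refine mul_le_mul_of_nonneg_right ?_ (hφ.pd.ma z)
    have b1 := bC _ ((hf j).1.ms (hτ k).1 (hτ k).2) z hz
    have b2 := bC _ (hU.ms (σ0 k) (σ1 k)) z hz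
    have b3 := bD _ (hf k).1 z hz
    simp only [ms, add_zero] at b1 b2
    refine (abs_sub _ _).trans (add_le_add ?_ ((abs_sub _ _).trans (add_le_add b2 b3)))
    by_cases hz : z ∈ O
    · rw [indicator_of_mem hz]
      exact (abs_sub _ _).trans (add_le_add (abs_of_pos (by positivity)).le b1)
    · rw [indicator_of_notMem hz, abs_zero]
      have := (abs_nonneg _).trans b1
      positivity
  have Gl : ∀ᵐ z ∂(volume.restrict (closedBall 0 (RR A B))), Tendsto (fun k => G k z) atTop (𝓝 ((O.indicator (fun z => 3 * ε / 4 - f j z) z - (U z - U z)) * MA φ z)) := by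
    filter_upwards [ae_restrict_of_ae (mol_ae hU.lb)] with z hz
    refine Tendsto.mul_const _ (Tendsto.sub ?_ ((hz.comp σt).sub ?_))
    · by_cases hz : z ∈ O
      · simp only [indicator_of_mem hz]
        exact tendsto_const_nhds.sub ((mol_lim (hf j).1.lb (hf j).1.sub ((hf j).2.1 z)).comp τt)
      · simp only [indicator_of_notMem hz]; exact tendsto_const_nhds
    · exact tendsto_atTop_ciSup (fm z) ⟨_, by rintro _ ⟨j, rfl⟩; exact (hf j).1.up z⟩
  have lim := tendsto_integral_of_dominated_convergence _ Gm Ib Gb Gl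
  have ev : ∀ᶠ k in atTop, ∫ z in closedBall 0 (RR A B), G k z ≤ ε * η / 2 := by
    filter_upwards [σt.eventually (mol_small hU ht.1 hs0 (RR A B)), eventually_ge_atTop j] with k hk hjk
    have g1 := hU.ms (σ0 k) (σ1 k)
    have g2 := (hf k).1.ms (hτ k).1 (hτ k).2
    have g3 := (hf j).1.ms (hτ k).1 (hτ k).2
    have o12 : ∀ z, ‖z‖ ≤ RR A B → (V B (ms (σ k) 0 U)).1 z ≤ (V B (ms t s U)).1 z := fun z hz => (V_mono g1.cd gsW.cd (by simpa [ms] using hk z hz)).1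
    have o23 : ∀ z, (V B (ms (τ k) 0 (f j))).1 z ≤ (V B (ms (τ k) 0 (f k))).1 z := fun z => (V_mono g3.cd g2.cd (add_le_add_left (mol_mono_on (hf j).1.lb (hf k).1.lb (hτ k).1.le fun y _ => fm y hjk) _)).1
    have C1 := hC _ _ φ (V_PP hA hB gsW) (V_PP hA hB g1) hφ o12 (by
      have := eb_le hA hB hU (σ0 k) (σ1 k); unfold EN at this hEW; linarith)
    have C2 := hC _ _ φ (V_PP hA hB g2) (V_PP hA hB g3) hφ (fun z _ => o23 z) (by
      have := eb_le hA hB (hf j).1 (hτ k).1 (hτ k).2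
      have h2 := hτE k
      unfold EN at this h2; linarith [hj k hjk])
    rw [Jdet] at C1 C2
    have I1 : IntegrableOn (fun z => (V B (ms t s U) - V B (ms (σ k) 0 U)).1 z * MA φ z) (closedBall 0 (RR A B)) :=
      ((RS.ct _).mul c0).continuousOn.integrableOn_compact (isCompact_closedBall _ _)
    have I2 : IntegrableOn (fun z => (V B (ms (τ k) 0 (f k)) - V B (ms (τ k) 0 (f j))).1 z * MA φ z) (closedBall 0 (RR A B)) :=
      ((RS.ct _).mul c0).continuousOn.integrableOn_compact (isCompact_closedBall _ _)
    have : ∫ z in closedBall 0 (RR A B), G k z ≤ ∫ z in closedBall 0 (RR A B), ((V B (ms t s U) - V B (ms (σ k) 0 U)).1 z * MA φ z + (V B (ms (τ k) 0 (f k)) - V B (ms (τ k) 0 (f j))).1 z * MA φ z) := by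
      refine setIntegral_mono_on (Ib.mono' (Gm k) (Gb k)) (I1.add I2) measurableSet_closedBall fun z hz => ?_
      rw [mem_closedBall_zero_iff] at hz
      rw [← add_mul]
      refine mul_le_mul_of_nonneg_right ?_ (hφ.pd.ma z)
      change _ ≤ ((V B (ms t s U)).1 z - (V B (ms (σ k) 0 U)).1 z) + ((V B (ms (τ k) 0 (f k))).1 z - (V B (ms (τ k) 0 (f j))).1 z)
      have q1 := o12 z hz
      have q2 := o23 z
      have q3 := le_mol hU.lb hU.sub (σ k) z
      have q4 := le_mol (hf k).1.lb (hf k).1.sub (τ k) z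
      have q5 := le k z
      have q6 : (V B (ms (σ k) 0 U)).1 z - (V B (ms (τ k) 0 (f k))).1 z ≤ mol (σ k) U z - f k z := by
        rcases le_total (ms (τ k) 0 (f k) z) (ms (σ k) 0 U z) with hh | hh
        · have := (V_mono (B := B) g2.cd g1.cd hh).2
          simp only [ms] at this; linarith
        · have := (V_mono (B := B) g1.cd g2.cd hh).1
          change f k z ≤ U z at q5
          linarith
      by_cases hz : z ∈ O
      · rw [indicator_of_mem hz]
        have h3 : ‖z‖ ^ 2 + 1 < B := hz.2
        have h4 : 3 * ε / 4 < mol t U z := hz.1.2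
        have w1 := V_near (B := B) gsW.cd (gsW.nn z) h3.le
        have w2 := V_near (B := B) g3.cd (g3.nn z) h3.le
        simp only [ms] at w1 w2 q6 ⊢
        linarith
      · rw [indicator_of_notMem hz]
        change f k z ≤ U z at q5
        linarith
    rw [integral_add I1 I2] at this
    linarith
  have fin := le_of_tendsto lim ev
  simp only [sub_self, sub_zero] at fin
  have i0 : IntegrableOn (MA φ) (closedBall 0 (RR A B)) := c0.continuousOn.integrableOn_compact (isCompact_closedBall _ _)
  have e1 : ∫ z in closedBall 0 (RR A B), O.indicator (fun z => 3 * ε / 4 - f j z) z * MA φ z = ∫ z in O, (3 * ε / 4 - f j z) * MA φ z := by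
    have : (fun z => O.indicator (fun z => 3 * ε / 4 - f j z) z * MA φ z) = O.indicator (fun z => (3 * ε / 4 - f j z) * MA φ z) := by
      funext z; by_cases hz : z ∈ O <;> simp only [indicator_of_mem, indicator_of_notMem, hz, not_false_eq_true, zero_mul]
    rw [this, setIntegral_indicator oO.measurableSet, inter_eq_self_of_subset_right OB]
  have e2 : ∫ z in O, ε / 2 * MA φ z ≤ ∫ z in O, (3 * ε / 4 - f j z) * MA φ z := by
    refine setIntegral_mono_on ((i0.mono_set OB).const_mul _) ?_ oO.measurableSet fun z hz => mul_le_mul_of_nonneg_right ?_ (hφ.pd.ma z)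
    · refine Integrable.mono' (Ib.mono_set OB) ((measurable_const.sub (hf j).1.lb.meas).mul c0.measurable).aestronglyMeasurable ?_
      filter_upwards [ae_restrict_mem oO.measurableSet] with z hz
      have b3 := bD _ (hf j).1 z (by simpa using OB hz)
      rw [Real.norm_eq_abs, abs_mul, abs_of_nonneg (hφ.pd.ma z)]
      refine mul_le_mul_of_nonneg_right ?_ (hφ.pd.ma z)
      have := (abs_nonneg _).trans b3
      refine (abs_sub _ _).trans ?_
      rw [abs_of_pos (by positivity)]; linarith
    · have : f j z < ε / 4 := hz.1.1
      linarith
  rw [integral_const_mul] at e2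
  rw [e1] at fin
  have : ε / 2 * ∫ z in O, MA φ z ≤ ε / 2 * η := by linarith
  exact le_of_mul_le_mul_left this (by positivity)
end
section
variable {m : ℕ}
def Pl (d : ℕ) (f : EE m → ℂ) : Prop :=
  ∃ p : MvPolynomial (Fin m) ℂ, p.totalDegree ≤ d ∧ f = fun z => MvPolynomial.eval (fun i => z i) p
lemma Pl.mono {d e : ℕ} {f : EE m → ℂ} (h : Pl d f) (hd : d ≤ e) : Pl e f := by
  obtain ⟨p, h1, h2⟩ := h; exact ⟨p, h1.trans hd, h2⟩
lemma Pl.const (c : ℂ) (d : ℕ) : Pl d (fun _ : EE m => c) :=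
  ⟨MvPolynomial.C c, by simp, by simp⟩
lemma Pl.mul {d e : ℕ} {f g : EE m → ℂ} (hf : Pl d f) (hg : Pl e g) : Pl (d + e) (fun z => f z * g z) := by
  obtain ⟨p, h1, rfl⟩ := hf
  obtain ⟨q, h2, rfl⟩ := hg
  exact ⟨p * q, (MvPolynomial.totalDegree_mul p q).trans (by omega), by simp⟩
lemma Pl.pow {d : ℕ} {f : EE m → ℂ} (hf : Pl d f) (n : ℕ) : Pl (n * d) (fun z => f z ^ n) := by
  obtain ⟨p, h1, rfl⟩ := hf
  exact ⟨p ^ n, (MvPolynomial.totalDegree_pow p n).trans (Nat.mul_le_mul le_rfl h1), by simp⟩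
lemma Pl.sum {ι : Type*} (s : Finset ι) {d : ℕ} {f : ι → EE m → ℂ} (h : ∀ i ∈ s, Pl d (f i)) :
    Pl d (fun z => ∑ i ∈ s, f i z) := by
  classical
  choose! p hp using h
  refine ⟨∑ i ∈ s, p i, MvPolynomial.totalDegree_finsetSum_le fun i hi => (hp i hi).1, ?_⟩
  funext z
  rw [map_sum]
  exact Finset.sum_congr rfl fun i hi => by rw [(hp i hi).2]
lemma Pl.prod {ι : Type*} (s : Finset ι) {d : ι → ℕ} {f : ι → EE m → ℂ} (h : ∀ i ∈ s, Pl (d i) (f i)) :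
    Pl (∑ i ∈ s, d i) (fun z => ∏ i ∈ s, f i z) := by
  classical
  induction s using Finset.induction_on with
  | empty => simpa using Pl.const 1 0
  | insert a s ha ih =>
    simp only [Finset.sum_insert ha, Finset.prod_insert ha]
    exact (h a (by simp)).mul (ih fun i hi => h i (by simp [hi]))
lemma Pl.coord (i : Fin m) (c : ℂ) : Pl 1 (fun z : EE m => z i + c) :=
  ⟨MvPolynomial.X i + MvPolynomial.C c, (MvPolynomial.totalDegree_add _ _).trans (by simp), by simp⟩
lemma Pl.shift {d : ℕ} {f : EE m → ℂ} (hf : Pl d f) (y : EE m) : Pl d (fun z => f (z + y)) := by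
  obtain ⟨p, h1, rfl⟩ := hf
  simp only [MvPolynomial.eval_eq, PiLp.add_apply]
  refine Pl.sum _ fun α hα => ?_
  have h2 := (Pl.const (m := m) (p.coeff α) 0).mul
    (Pl.prod α.support (f := fun i z => (z i + y i) ^ α i) fun i _ => (Pl.coord i (y i)).pow (α i))
  refine h2.mono ?_
  have := (MvPolynomial.le_totalDegree hα).trans h1
  simpa [Finsupp.sum] using this
lemma Pl.cont {d : ℕ} {f : EE m → ℂ} (hf : Pl d f) : Continuous f := by
  obtain ⟨p, h1, rfl⟩ := hf
  simp only [MvPolynomial.eval_eq]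
  fun_prop
lemma Pl.diff {d : ℕ} {f : EE m → ℂ} (hf : Pl d f) : Differentiable ℂ f := by
  obtain ⟨p, h1, rfl⟩ := hf
  simp only [MvPolynomial.eval_eq]
  fun_prop
lemma Pl.grow {d : ℕ} {f : EE m → ℂ} (hf : Pl d f) : ∃ C, 1 ≤ C ∧ ∀ z, ‖f z‖ ≤ C * (1 + ‖z‖) ^ d := by
  obtain ⟨p, h1, rfl⟩ := hf
  simp only [MvPolynomial.eval_eq]
  refine ⟨1 + ∑ α ∈ p.support, ‖p.coeff α‖, by simp; positivity, fun z => (norm_sum_le _ _).trans ?_⟩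
  have hz : 1 ≤ 1 + ‖z‖ := by linarith [norm_nonneg z]
  calc _ ≤ ∑ α ∈ p.support, ‖p.coeff α‖ * (1 + ‖z‖) ^ d := Finset.sum_le_sum fun α hα => by
        rw [norm_mul, norm_prod]
        gcongr
        calc _ ≤ ∏ i ∈ α.support, (1 + ‖z‖) ^ α i := Finset.prod_le_prod (fun _ _ => norm_nonneg _) fun i _ => by
              rw [norm_pow]; gcongr; linarith [PiLp.norm_apply_le z i]
          _ = (1 + ‖z‖) ^ (∑ i ∈ α.support, α i) := Finset.prod_pow_eq_pow_sum _ _ _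
          _ ≤ _ := pow_le_pow_right₀ hz ((MvPolynomial.le_totalDegree hα).trans h1)
    _ = (∑ α ∈ p.support, ‖p.coeff α‖) * (1 + ‖z‖) ^ d := by rw [Finset.sum_mul]
    _ ≤ _ := by gcongr; linarith
def lgm (d : ℕ) (f : EE m → ℂ) (z : EE m) : ℝ := Real.log (max 1 ‖f z‖) / d
lemma lgm_nonneg (d : ℕ) (f : EE m → ℂ) (z : EE m) : 0 ≤ lgm d f z :=
  div_nonneg (Real.log_nonneg (le_max_left _ _)) (Nat.cast_nonneg d)
lemma lgm_cont {f : EE m → ℂ} (d : ℕ) (hf : Continuous f) : Continuous (lgm d f) :=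
  ((continuous_const.max hf.norm).log fun z => (lt_max_of_lt_left one_pos).ne').div_const _
lemma lgm_sub {f : EE m → ℂ} (d : ℕ) (hf : Differentiable ℂ f) : SubM (lgm d f) := by
  intro a b
  have hl := (lgm_cont d hf.continuous).lb
  have h0 : 0 ≤ cm (lgm d f) a b := by
    have := cm_mono (a := a) (b := b) (LB.const 0) hl fun ζ _ => lgm_nonneg d f _
    rwa [cm_const] at this
  rcases le_or_gt ‖f a‖ 1 with h | h
  · rw [lgm, max_eq_left h]; simpa using h0
  set F : ℂ → ℂ := fun ζ => f (a + ζ • b)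
  have hF : Differentiable ℂ F := hf.comp (by fun_prop)
  have hF0 : F 0 = f a := by simp [F]
  have hJ := AnalyticOnNhd.circleAverage_log_norm (c := 0) (R := 1) (f := F) one_ne_zero
    (fun z _ => hF.analyticAt z) (by rw [hF0]; intro h'; rw [h'] at h; simp at h; linarith)
  have hm : MeromorphicOn F (sphere 0 |1|) := fun z _ => (hF.analyticAt z).meromorphicAt
  have h1 : Real.circleAverage (fun ζ => Real.log ‖F ζ‖) 0 1 ≤ Real.circleAverage (fun ζ => Real.log (max 1 ‖F ζ‖)) 0 1 := by
    refine Real.circleAverage_mono (hm.circleIntegrable_log_norm) ?_ fun ζ _ => ?_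
    · have := (lgm_cont 1 hf.continuous).lb.cint a b
      simpa [lgm] using this
    · rcases eq_or_ne ‖F ζ‖ 0 with h | h
      · simp [h]
      · exact Real.log_le_log (by positivity) (le_max_right _ _)
  have h2 : Real.log ‖f a‖ ≤ Real.circleAverage (fun ζ => Real.log ‖F ζ‖) 0 1 := by
    rw [hJ, hF0]
    refine le_add_of_nonneg_left (finsum_nonneg fun u => ?_)
    by_cases hu : u ∈ closedBall (0 : ℂ) |1|
    · refine mul_nonneg ?_ ?_
      · have := MeromorphicOn.AnalyticOnNhd.divisor_nonneg (f := F) (U := closedBall 0 |1|) (fun z _ => hF.analyticAt z)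
        exact_mod_cast this u
      · rcases eq_or_ne u 0 with rfl | h0
        · simp
        · refine Real.log_nonneg ?_
          simp at hu
          simp only [one_mul, zero_sub, norm_neg]
          exact (one_le_inv₀ (norm_pos_iff.2 h0)).2 hu
    · rw [Function.locallyFinsuppWithin.apply_eq_zero_of_notMem _ hu]; simp
  have h3 : cm (lgm d f) a b = (d : ℝ)⁻¹ * Real.circleAverage (fun ζ => Real.log (max 1 ‖F ζ‖)) 0 1 := by
    rw [← smul_eq_mul, ← Real.circleAverage_fun_smul]
    unfold cm lgm
    congr 1; funext ζ; simp [F]; ring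
  rw [h3, lgm, max_eq_right h.le, div_eq_inv_mul]
  exact mul_le_mul_of_nonneg_left (h2.trans h1) (by positivity)
lemma Pl.inLs {d : ℕ} (hd : 1 ≤ d) {f : EE m → ℂ} (hf : Pl d f) : InLs 1 (lgm d f) := by
  have hd' : (1 : ℝ) ≤ d := by exact_mod_cast hd
  refine ⟨(lgm_cont d hf.cont).upperSemicontinuous, ⟨0, fun z => by simpa using lgm_nonneg d f z⟩, ?_, lgm_sub d hf.diff⟩
  obtain ⟨C, h1, hC⟩ := hf.grow
  refine ⟨Real.log C, fun z => ?_⟩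
  have hz : 1 ≤ 1 + ‖z‖ := by linarith [norm_nonneg z]
  have h2 : max 1 ‖f z‖ ≤ C * (1 + ‖z‖) ^ d := max_le (one_le_mul_of_one_le_of_one_le h1 (one_le_pow₀ hz)) (hC z)
  have h3 := Real.log_le_log (lt_max_of_lt_left one_pos) h2
  rw [Real.log_mul (by positivity) (by positivity), Real.log_pow] at h3
  rw [lgm, div_le_iff₀ (by positivity)]
  nlinarith [Real.log_nonneg h1]
end
section
variable {m : ℕ}
lemma mono01 {f f' : ℝ → ℝ} (h : ∀ t, HasDerivAt f (f' t) t) (h0 : ∀ t ∈ Icc (0:ℝ) 1, 0 ≤ f' t) {t : ℝ} (ht : t ∈ Icc (0:ℝ) 1) :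
    f 0 ≤ f t := by
  have : MonotoneOn f (Icc 0 1) := monotoneOn_of_deriv_nonneg (convex_Icc 0 1)
    (fun t _ => (h t).continuousAt.continuousWithinAt) (fun t _ => (h t).differentiableAt.differentiableWithinAt)
    fun t ht => by rw [(h t).deriv]; exact h0 t (interior_subset ht)
  exact this ⟨le_rfl, zero_le_one⟩ ht ht.1
lemma SD1 (Q : RS m) (w s : EE m) {c : ℝ} (h : ∀ t ∈ Icc (0:ℝ) 1, c ≤ D2 Q (w + t • s) s s) :
    Q.1 w + fderiv ℝ Q.1 w s + c / 2 ≤ Q.1 (w + s) := by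
  have hl : ∀ t : ℝ, HasDerivAt (fun t : ℝ => w + t • s) s t := fun t => by
    simpa using ((hasDerivAt_id t).smul_const s).const_add w
  have h1 : ∀ t : ℝ, HasDerivAt (fun t : ℝ => Q.1 (w + t • s)) (fderiv ℝ Q.1 (w + t • s) s) t := fun t =>
    (RS.da Q _).hasFDerivAt.comp_hasDerivAt t (hl t)
  have h2 : ∀ t : ℝ, HasDerivAt (fun t : ℝ => fderiv ℝ Q.1 (w + t • s) s) (D2 Q (w + t • s) s s) t := fun t => by
    have := ((((cd_fd (RS.cd Q)).differentiable (by simp)) (w + t • s)).hasFDerivAt.comp_hasDerivAt t (hl t))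
    exact this.clm_apply (hasDerivAt_const t s) |>.congr_deriv (by simp [D2])
  have h3 : ∀ t : ℝ, HasDerivAt (fun t : ℝ => fderiv ℝ Q.1 (w + t • s) s - fderiv ℝ Q.1 w s - c * t) (D2 Q (w + t • s) s s - c) t :=
    fun t => ((h2 t).sub_const _).sub (((hasDerivAt_id t).const_mul c).congr_deriv (by simp))
  have h4 : ∀ t : ℝ, HasDerivAt (fun t : ℝ => Q.1 (w + t • s) - t * fderiv ℝ Q.1 w s - c / 2 * t ^ 2)
      (fderiv ℝ Q.1 (w + t • s) s - fderiv ℝ Q.1 w s - c * t) t := fun t =>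
    (((h1 t).sub ((hasDerivAt_id t).mul_const _)).sub ((hasDerivAt_pow 2 t).const_mul (c/2))).congr_deriv (by
      simp; ring)
  have h5 := mono01 h4 (fun t ht => by
    have := mono01 h3 (fun t ht => by linarith [h t ht]) ht
    simpa using this) (t := 1) ⟨zero_le_one, le_rfl⟩
  simp at h5
  linarith
lemma SD1' (Q : RS m) (w s : EE m) {c : ℝ} (h : ∀ t ∈ Icc (0:ℝ) 1, D2 Q (w + t • s) s s ≤ c) :
    Q.1 (w + s) ≤ Q.1 w + fderiv ℝ Q.1 w s + c / 2 := by
  have h1 := SD1 ((-1:ℝ) • Q) w s (c := -c) fun t ht => by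
    rw [D2_smul]; simp; exact h t ht
  have h2 : ((-1:ℝ) • Q : RS m).1 = fun z => - Q.1 z := by funext z; change (-1:ℝ) * Q.1 z = _; ring
  rw [h2, fderiv_fun_neg] at h1
  simp at h1
  linarith
structure QH (M : ℝ) (K O : Set (EE m)) (Q : RS m) (k : ℝ) : Prop where
  nn : ∀ z, 0 ≤ Q.1 z
  zero : ∀ z ∈ K, Q.1 z = 0
  k0 : 0 < k
  d2 : ∀ z v, |D2 Q z v v| ≤ 2 * k * ‖v‖ ^ 2
  off : ∀ z ∉ O, M + 2 + Real.log (1 + ‖z‖) ≤ Q.1 z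
lemma exQ {K O : Set (EE m)} (hK : IsCompact K) (hO : IsOpen O) (hKO : K ⊆ O) {R : ℝ} (hR : O ⊆ closedBall 0 R) {M : ℝ} (hM : 0 ≤ M) :
    ∃ (Q : RS m) (k : ℝ), QH M K O Q k := by
  obtain ⟨χ, c1, c2, c3, c4⟩ := exists_contMDiff_support_eq_eq_one_iff (modelWithCornersSelf ℝ (EE m)) (n := (⊤ : ℕ∞)) hO hK.isClosed hKO
  have c1 : ContDiff ℝ ∞ χ := c1.contDiff
  have cr : ∀ z, 0 ≤ χ z ∧ χ z ≤ 1 := fun z => c2 ⟨z, rfl⟩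
  set ψ : RS m := ⟨fun z => χ z * (M + 3 + ‖z‖ ^ 2), by change ContDiff ℝ ∞ _; exact c1.mul (contDiff_const.add (contDiff_norm_sq ℂ))⟩
  set Q : RS m := algebraMap ℝ _ (M + 3) + nsq - ψ
  have hQ : ∀ z, Q.1 z = (1 - χ z) * (M + 3 + ‖z‖ ^ 2) := fun z => by
    change M + 3 + ‖z‖ ^ 2 - χ z * (M + 3 + ‖z‖ ^ 2) = _; ring
  have hψ : HasCompactSupport ψ.1 := by
    refine HasCompactSupport.intro (isCompact_closedBall (0 : EE m) R) fun z hz => ?_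
    have : χ z = 0 := by
      by_contra h
      exact hz (hR (c3 ▸ h))
    change χ z * _ = 0; rw [this, zero_mul]
  have hc : HasCompactSupport (D2 ψ) := hψ.fderiv ℝ |>.fderiv ℝ
  obtain ⟨C, hC⟩ := (((cd_fd (cd_fd (RS.cd ψ))).continuous).bounded_above_of_compact_support hc)
  refine ⟨Q, 1 + C, ⟨fun z => ?_, fun z hz => ?_, ?_, fun z v => ?_, fun z hz => ?_⟩⟩
  · rw [hQ]; exact mul_nonneg (by linarith [(cr z).2]) (by positivity)
  · rw [hQ, (c4 z).1 hz]; simp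
  · linarith [(norm_nonneg _).trans (hC 0)]
  · have h0 : D2 (algebraMap ℝ (RS m) (M + 3)) z = 0 := by
      have : (algebraMap ℝ (RS m) (M + 3)).1 = fun _ => M + 3 := rfl
      unfold D2; rw [this]; simp
    have h00 : D2 Q z v v = 2 * ‖v‖ ^ 2 - D2 ψ z v v := by
      rw [D2_sub, D2_add, h0, ← D2_nsq' z]; simp
    rw [h00]
    have h1 : |D2 ψ z v v| ≤ C * ‖v‖ * ‖v‖ := by
      rw [← Real.norm_eq_abs]
      exact ((D2 ψ z).le_opNorm₂ v v).trans (by gcongr; exact hC z)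
    rw [abs_le] at h1 ⊢
    have h2 : 0 ≤ C * ‖v‖ * ‖v‖ := by have := (norm_nonneg _).trans (hC z); positivity
    constructor <;> nlinarith [sq_nonneg ‖v‖]
  · have : χ z = 0 := by
      by_contra h
      exact hz (c3 ▸ h)
    rw [hQ, this]
    have := Real.log_le_sub_one_of_pos (x := 1 + ‖z‖) (by positivity)
    nlinarith [sq_nonneg (‖z‖ - 1)]
section
variable {M : ℝ} {K O : Set (EE m)} {Q : RS m} {k : ℝ}
lemma QH.tay (h : QH M K O Q k) (w s : EE m) : |Q.1 (w + s) - Q.1 w - fderiv ℝ Q.1 w s| ≤ k * ‖s‖ ^ 2 := by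
  have h1 := SD1 Q w s (c := -(2 * k * ‖s‖ ^ 2)) fun t _ => (abs_le.1 (h.d2 _ s)).1
  have h2 := SD1' Q w s (c := 2 * k * ‖s‖ ^ 2) fun t _ => (abs_le.1 (h.d2 _ s)).2
  rw [abs_le]; constructor <;> linarith
lemma QH.mid (h : QH M K O Q k) (w s : EE m) : |Q.1 (w + s) + Q.1 (w - s) - 2 * Q.1 w| ≤ 2 * k * ‖s‖ ^ 2 := by
  have h1 := abs_le.1 (h.tay w s)
  have h2 := abs_le.1 (h.tay w (-s))
  rw [map_neg, norm_neg, ← sub_eq_add_neg] at h2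
  rw [abs_le]; constructor <;> linarith
def PBW (M : ℝ) (K : Set (EE m)) : Prop := ∀ (d : ℕ) (f : EE m → ℂ), Pl d f → (∀ x ∈ K, ‖f x‖ ≤ 1) →
  ∀ z, ‖z‖ ≤ 1 → ‖f z‖ ≤ Real.exp (d * M)
structure Adm (Q : EE m → ℝ) (d : ℕ) (f : EE m → ℂ) : Prop where
  d1 : 1 ≤ d
  pl : Pl d f
  le : ∀ z, ‖f z‖ ≤ Real.exp (d * Q z)
lemma PBW.le (hK : PBW M K) (hM : 0 ≤ M) {d : ℕ} (hd : 1 ≤ d) {f : EE m → ℂ} (hf : Pl d f) (h : ∀ x ∈ K, ‖f x‖ ≤ 1) (z : EE m) :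
    lgm d f z ≤ M + 1 + Real.log (1 + ‖z‖) := by
  refine BW1 (hf.inLs hd) (fun w hw => ?_) z
  have h1 := hK d f hf h w (by simp at hw; exact hw.le)
  have hd' : (0 : ℝ) < d := by exact_mod_cast hd
  rw [lgm, div_le_iff₀ hd', Real.log_le_iff_le_exp (lt_max_of_lt_left one_pos), mul_comm]
  exact max_le (Real.one_le_exp (by positivity)) h1
def gE (Q : EE m → ℝ) (z : EE m) : ℝ := ⨆ x : {x : ℕ × (EE m → ℂ) // Adm Q x.1 x.2}, lgm x.1.1 x.1.2 z
lemma Adm.lgm_le {Q : EE m → ℝ} (hQ : ∀ z, 0 ≤ Q z) {d : ℕ} {f : EE m → ℂ} (h : Adm Q d f) (z : EE m) : lgm d f z ≤ Q z := by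
  have hd' : (0 : ℝ) < d := by exact_mod_cast h.d1
  rw [lgm, div_le_iff₀ hd', Real.log_le_iff_le_exp (lt_max_of_lt_left one_pos), mul_comm]
  exact max_le (Real.one_le_exp (mul_nonneg hd'.le (hQ z))) (h.le z)
lemma Adm.one {Q : EE m → ℝ} (hQ : ∀ z, 0 ≤ Q z) {d : ℕ} (hd : 1 ≤ d) : Adm Q d (fun _ => 1) :=
  ⟨hd, Pl.const 1 d, fun z => by simpa using mul_nonneg (Nat.cast_nonneg d) (hQ z)⟩
lemma le_g {Q : EE m → ℝ} (hQ : ∀ z, 0 ≤ Q z) {d : ℕ} {f : EE m → ℂ} (h : Adm Q d f) (z : EE m) : lgm d f z ≤ gE Q z :=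
  le_ciSup (f := fun x : {x : ℕ × (EE m → ℂ) // Adm Q x.1 x.2} => lgm x.1.1 x.1.2 z)
    ⟨Q z, by rintro _ ⟨x, rfl⟩; exact x.2.lgm_le hQ z⟩ ⟨(d, f), h⟩
lemma g_le {Q : EE m → ℝ} (hQ : ∀ z, 0 ≤ Q z) {z : EE m} {c : ℝ}
    (h : ∀ d f, Adm Q d f → 1 ≤ ‖f z‖ → Real.log ‖f z‖ / d ≤ c) : gE Q z ≤ c := by
  have : Nonempty {x : ℕ × (EE m → ℂ) // Adm Q x.1 x.2} := ⟨⟨(1, _), Adm.one hQ le_rfl⟩⟩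
  refine ciSup_le fun x => ?_
  rcases le_total ‖x.1.2 z‖ 1 with h1 | h1
  · rw [lgm, max_eq_left h1]
    simpa using h 1 _ (Adm.one hQ le_rfl) (by simp)
  · rw [lgm, max_eq_right h1]; exact h _ _ x.2 h1
lemma g_nn {Q : EE m → ℝ} (hQ : ∀ z, 0 ≤ Q z) (z : EE m) : 0 ≤ gE Q z :=
  (lgm_nonneg _ _ z).trans (le_g hQ (Adm.one hQ le_rfl) z)
lemma g_le' {Q : EE m → ℝ} (hQ : ∀ z, 0 ≤ Q z) {z : EE m} {c : ℝ}
    (h : ∀ d f, Adm Q d f → lgm d f z ≤ c) : gE Q z ≤ c :=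
  g_le hQ fun d f a b => by have := h d f a; rwa [lgm, max_eq_right b] at this
lemma QH.gGC (h : QH M K O Q k) (hM : 0 ≤ M) (hK : PBW M K) : GC (M + 1) (gE Q.1) := by
  have hup : ∀ z, gE Q.1 z ≤ M + 1 + Real.log (1 + ‖z‖) := fun z => g_le' h.nn fun d f hf =>
    hK.le hM hf.d1 hf.pl (fun x hx => by simpa [h.zero x hx] using hf.le x) z
  have hlb : LB (gE Q.1) := by
    refine ⟨?_, fun r => ⟨M + 1 + Real.log (1 + r), fun z hz => ?_⟩⟩
    · refine LowerSemicontinuous.measurable ?_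
      exact lowerSemicontinuous_ciSup (fun z => ⟨Q.1 z, by rintro _ ⟨x, rfl⟩; exact x.2.lgm_le h.nn z⟩)
        fun x => (lgm_cont _ x.2.pl.cont).lowerSemicontinuous
    · rw [abs_of_nonneg (g_nn h.nn z)]
      linarith [hup z, log1_mono hz]
  exact ⟨hlb, fun a b => g_le' h.nn fun d f hf => ((hf.pl.inLs hf.d1).sub a b).trans
    (cm_mono (hf.pl.inLs hf.d1).lb hlb fun ζ _ => le_g h.nn hf _), g_nn h.nn, hup⟩
lemma QH.g_le_Q (h : QH M K O Q k) (z : EE m) : gE Q.1 z ≤ Q.1 z := g_le' h.nn fun _ _ hf => hf.lgm_le h.nn z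
lemma QH.g_mid (h : QH M K O Q k) (z y : EE m) : gE Q.1 (z + y) + gE Q.1 (z - y) ≤ 2 * gE Q.1 z + 2 * k * ‖y‖ ^ 2 := by
  rw [← le_sub_iff_add_le]
  refine g_le h.nn fun d f hf f1 => ?_
  rw [le_sub_iff_add_le, ← le_sub_iff_add_le']
  refine g_le h.nn fun e q hq q1 => ?_
  have hd : (0 : ℝ) < d := by exact_mod_cast hf.d1
  have he : (0 : ℝ) < e := by exact_mod_cast hq.d1
  set c : ℝ := d * e * (2 * k * ‖y‖ ^ 2)
  have hA : Adm Q.1 (2 * (d * e)) (fun w => (Real.exp (-c) : ℂ) * ((f (w + y)) ^ e * (q (w + -y)) ^ d)) := by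
    refine ⟨by nlinarith [hf.d1, hq.d1, Nat.mul_le_mul hf.d1 hq.d1], ?_, fun w => ?_⟩
    · exact ((Pl.const _ 0).mul (((hf.pl.shift y).pow e).mul ((hq.pl.shift (-y)).pow d))).mono (by rw [mul_comm e d]; omega)
    · rw [norm_mul, norm_mul, norm_pow, norm_pow, Complex.norm_real, Real.norm_of_nonneg (Real.exp_pos _).le]
      calc _ ≤ Real.exp (-c) * (Real.exp (d * Q.1 (w + y)) ^ e * Real.exp (e * Q.1 (w + -y)) ^ d) := by
            gcongr
            · exact hf.le _
            · exact hq.le _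
        _ ≤ _ := by
            rw [← Real.exp_nat_mul, ← Real.exp_nat_mul, ← Real.exp_add, ← Real.exp_add, Real.exp_le_exp]
            have := (abs_le.1 (h.mid w y)).2
            rw [← sub_eq_add_neg]
            push_cast
            simp only [c]
            nlinarith [mul_pos hd he]
  have h1 := le_g h.nn hA z
  have h2 : Real.log ‖(Real.exp (-c) : ℂ) * ((f (z + y)) ^ e * (q (z + -y)) ^ d)‖ = -c + (e * Real.log ‖f (z+y)‖ + d * Real.log ‖q (z - y)‖) := by
    rw [norm_mul, norm_mul, norm_pow, norm_pow, Complex.norm_real, Real.norm_of_nonneg (Real.exp_pos _).le, ← sub_eq_add_neg,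
      Real.log_mul (by positivity) (by positivity), Real.log_exp, Real.log_mul (by positivity) (by positivity), Real.log_pow, Real.log_pow]
  have h3 : Real.log ‖(Real.exp (-c) : ℂ) * ((f (z + y)) ^ e * (q (z + -y)) ^ d)‖ ≤ 2 * (d * e) * gE Q.1 z := by
    rw [lgm, div_le_iff₀ (by push_cast; positivity)] at h1
    have h4 : gE Q.1 z * ((2 * (d * e) : ℕ) : ℝ) = 2 * (d * e) * gE Q.1 z := by push_cast; ring
    refine le_trans (Real.log_le_log ?_ (le_max_right _ _)) (h1.trans_eq h4)
    rw [norm_pos_iff]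
    refine mul_ne_zero (by simp) (mul_ne_zero (pow_ne_zero _ ?_) (pow_ne_zero _ ?_)) <;> rw [← norm_pos_iff]
    · linarith
    · rw [← sub_eq_add_neg]; linarith
  rw [h2] at h3
  have a1 : Real.log ‖f (z + y)‖ = d * (Real.log ‖f (z + y)‖ / d) := by field_simp
  have a2 : Real.log ‖q (z - y)‖ = e * (Real.log ‖q (z - y)‖ / e) := by field_simp
  rw [a1, a2] at h3
  refine le_of_mul_le_mul_left (a := (d * e : ℝ)) ?_ (by positivity)
  simp only [c] at h3
  linarith
end
end
section
variable {m : ℕ}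
lemma krn_up : ∃ C : ℝ, 0 < C ∧ ∀ y : EE m, krn y ≤ C := by
  obtain ⟨C, hC⟩ := krn_lb.bdd (m := m) 1
  refine ⟨1 + |C|, by positivity, fun y => ?_⟩
  rcases le_total ‖y‖ 1 with h | h
  · linarith [le_abs_self (krn y), hC y h, le_abs_self C]
  · rw [krn_supp y h]; positivity
lemma krn_low : ∃ c : ℝ, 0 < c ∧ ∀ y : EE m, ‖y‖ ≤ 1/2 → c ≤ krn y := by
  obtain ⟨y, hy, h⟩ := (isCompact_closedBall (0 : EE m) (1/2)).exists_isMinOn ⟨0, by simp⟩ (krn_smooth (m := m)).continuous.continuousOn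
  refine ⟨krn y, mul_pos (inv_pos.2 krn0_pos) (Real.smoothTransition.pos_of_pos ?_), fun x hx => h (by simpa using hx)⟩
  have : ‖y‖ ≤ 1/2 := by simpa using hy
  nlinarith [norm_nonneg y]
lemma mol_neg' (τ : ℝ) (u : EE m → ℝ) (z : EE m) : mol (-τ) u z = mol τ u z := by
  unfold mol
  rw [← integral_neg_eq_self]
  simp [krn_neg]
lemma mol_mid {u : EE m → ℝ} (hu : LB u) {τ c : ℝ} (hτ : 0 ≤ τ) {x : EE m}
    (h : ∀ y, ‖y‖ ≤ τ → u (x + y) + u (x - y) ≤ 2 * u x + 2 * c) : mol τ u x ≤ u x + c := by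
  have h1 : mol τ u x + mol (-τ) u x ≤ ∫ y, krn (m := m) y * (2 * u x + 2 * c) := by
    unfold mol
    rw [← integral_add (mol_int hu τ x) (mol_int hu (-τ) x)]
    refine integral_mono ((mol_int hu τ x).add (mol_int hu (-τ) x)) ((krn_lb.int (R := 1) fun y hy => krn_supp y hy.le).mul_const _) fun y => ?_
    change krn y * u (x + τ • y) + krn y * u (x + -τ • y) ≤ _
    rw [← mul_add]
    rcases le_total ‖y‖ 1 with h1 | h1
    · refine mul_le_mul_of_nonneg_left ?_ (krn_nonneg y)
      rw [neg_smul, ← sub_eq_add_neg]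
      refine h _ ?_
      rw [norm_smul, Real.norm_of_nonneg hτ]; nlinarith
    · simp [krn_supp y h1]
  rw [mol_neg', integral_mul_const, krn_one] at h1
  linarith
lemma SD2 (ψ : RS m) {C : ℝ} (h : ∀ x v, |D2 ψ x v v| ≤ C * ‖v‖ ^ 2) (w s : EE m) : |ψ.1 (w + s) + ψ.1 (w - s) - 2 * ψ.1 w| ≤ C * ‖s‖ ^ 2 := by
  have a1 := SD1 ψ w s fun t _ => (abs_le.1 (h _ s)).1
  have a2 := SD1' ψ w s fun t _ => (abs_le.1 (h _ s)).2
  have a3 := SD1 ψ w (-s) fun t _ => (abs_le.1 (h _ (-s))).1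
  have a4 := SD1' ψ w (-s) fun t _ => (abs_le.1 (h _ (-s))).2
  simp only [map_neg, norm_neg, ← sub_eq_add_neg] at a3 a4
  rw [abs_le]; constructor <;> linarith
lemma krn_SD : ∃ C : ℝ, 0 ≤ C ∧ ∀ w s : EE m, |krn (w + s) + krn (w - s) - 2 * krn w| ≤ C * ‖s‖ ^ 2 := by
  set ψ : RS m := ⟨krn, krn_smooth⟩
  have hψ : HasCompactSupport ψ.1 := HasCompactSupport.intro (isCompact_closedBall (0 : EE m) 1) fun y hy => krn_supp y (by simp at hy; exact hy.le)
  have hc : HasCompactSupport (D2 ψ) := hψ.fderiv ℝ |>.fderiv ℝ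
  obtain ⟨C, hC⟩ := (((cd_fd (cd_fd (RS.cd ψ))).continuous).bounded_above_of_compact_support hc)
  refine ⟨C, (norm_nonneg _).trans (hC 0), SD2 ψ fun x v => ?_⟩
  rw [← Real.norm_eq_abs, pow_two, ← mul_assoc]
  exact ((D2 ψ x).le_opNorm₂ v v).trans (by gcongr; exact hC x)
section
variable {M : ℝ} {K O : Set (EE m)} {Q : RS m} {k : ℝ}
lemma QH.quad (h : QH M K O Q k) (hg : LB (gE Q.1)) (sg : SubM (gE Q.1)) : ∃ C : ℝ, 0 < C ∧ ∀ x, gE Q.1 x = Q.1 x →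
    ∀ w, Q.1 w - gE Q.1 w ≤ C * dist w x ^ 2 := by
  obtain ⟨κ, k0, hκ⟩ := krn_low (m := m)
  obtain ⟨L, l0, hL⟩ := krn_up (m := m)
  set N := Module.finrank ℝ (EE m)
  have hk := h.k0
  have hQ := (RS.ct Q).lb
  set H : EE m → ℝ := fun z => Q.1 z + (-1) * gE Q.1 z
  have hH : LB H := hQ.add (hg.smul (-1))
  have H0 : ∀ z, 0 ≤ H z := fun z => by simp only [H]; linarith [h.g_le_Q z]
  set E := 4 ^ N * L / κ
  have hE : 0 < E := by positivity
  refine ⟨E * (k * 16) + 2 * k, by positivity, fun x hx w => ?_⟩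
  set r := dist w x
  rcases (dist_nonneg : 0 ≤ dist w x).eq_or_lt with h0 | hr
  · rw [dist_eq_zero.1 h0.symm, hx]; simp; positivity
  change 0 < r at hr
  have e1 : mol (4 * r) H x ≤ k * (4 * r) ^ 2 := by
    simp only [H]
    rw [mol_add hQ (hg.smul (-1)), mol_smul]
    have := le_mol hg sg (4 * r) x
    have := mol_mid hQ (x := x) (τ := 4 * r) (c := k * (4 * r) ^ 2) (by positivity) fun y hy => by
      have := (abs_le.1 (h.mid x y)).2
      have : k * ‖y‖ ^ 2 ≤ k * (4 * r) ^ 2 := by gcongr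
      linarith
    linarith
  have e2 : H w ≤ mol r H w + 2 * k * r ^ 2 := by
    have := mol_mid (hH.smul (-1)) (x := w) (τ := r) (c := 2 * k * r ^ 2) hr.le fun y hy => by
      have q1 := (abs_le.1 (h.mid w y)).1
      have q2 := h.g_mid w y
      have : k * ‖y‖ ^ 2 ≤ k * r ^ 2 := by gcongr
      simp only [H]
      linarith
    rw [mol_smul] at this
    linarith
  have e3 : mol r H w ≤ E * mol (4 * r) H x := by
    have i1 : ∀ (ρ : ℝ) (x : EE m), 0 < ρ → Integrable fun y => H y * ((ρ ^ N)⁻¹ * krn (ρ⁻¹ • (x - y))) := fun ρ x hρ => by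
      refine (hH.mul (Continuous.lb ?_)).int (R := ‖x‖ + ρ) fun y hy => ?_
      · have := (krn_smooth (m := m)).continuous; fun_prop
      · rw [krn_supp, mul_zero, mul_zero]
        rw [norm_smul, norm_inv, Real.norm_of_nonneg hρ.le, ← div_eq_inv_mul, one_le_div hρ]
        have := norm_sub_norm_le y x
        rw [norm_sub_rev]; linarith
    rw [mol_eq_conv hr, mol_eq_conv (by positivity), ← integral_const_mul]
    refine integral_mono (i1 r w hr) ((i1 (4 * r) x (by positivity)).const_mul _) fun y => ?_
    change H y * ((r ^ N)⁻¹ * krn (r⁻¹ • (w - y))) ≤ E * (H y * (((4 * r) ^ N)⁻¹ * krn ((4 * r)⁻¹ • (x - y))))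
    rw [mul_left_comm E]
    refine mul_le_mul_of_nonneg_left ?_ (H0 y)
    rcases le_or_gt r ‖w - y‖ with c | c
    · rw [krn_supp, mul_zero]
      · have := krn_nonneg ((4 * r)⁻¹ • (x - y)); positivity
      · rwa [norm_smul, norm_inv, Real.norm_of_nonneg hr.le, ← div_eq_inv_mul, one_le_div hr]
    · have c1 := hκ ((4 * r)⁻¹ • (x - y)) (by
        rw [norm_smul, norm_inv, Real.norm_of_nonneg (by positivity), ← div_eq_inv_mul, div_le_iff₀ (by positivity)]
        have : ‖x - y‖ ≤ ‖x - w‖ + ‖w - y‖ := by simpa using norm_add_le (x - w) (w - y)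
        have : ‖x - w‖ = r := by rw [← dist_eq_norm, dist_comm]
        linarith)
      calc _ ≤ (r ^ N)⁻¹ * L := by gcongr; exact hL _
        _ = E * (((4 * r) ^ N)⁻¹ * κ) := by simp only [E, mul_pow]; field_simp
        _ ≤ _ := by gcongr
  have : H w = Q.1 w - gE Q.1 w := by simp only [H]; ring
  nlinarith
lemma QH.dens (h : QH M K O Q k) (hg : LB (gE Q.1)) (sg : SubM (gE Q.1)) :
    ∀ᵐ z ∂volume.restrict {z | gE Q.1 z = Q.1 z}, ∀ ε > 0, ∀ᶠ τ in 𝓝[>] (0:ℝ), ∀ w, dist w z ≤ 2 * τ → Q.1 w - gE Q.1 w ≤ ε * τ ^ 2 := by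
  obtain ⟨C, C0, hC⟩ := h.quad hg sg
  set D := {z | gE Q.1 z = Q.1 z}
  have key : ∀ᵐ z ∂volume.restrict D, ∀ n : ℕ, ∀ᶠ τ in 𝓝[>] (0:ℝ), ∀ w, dist w z ≤ 2 * τ → Q.1 w - gE Q.1 w ≤ C * ((n + 1 : ℝ)⁻¹ * τ) ^ 2 := by
    rw [ae_all_iff]
    intro n
    filter_upwards [IsUnifLocDoublingMeasure.ae_tendsto_measure_inter_div (volume : Measure (EE m)) D (2 * (n + 1))] with z hz
    have hb : ∀ τ : ℝ, ∃ w, dist w z ≤ 2 * |τ| ∧ ((∃ w, dist w z ≤ 2 * |τ| ∧ C * ((n + 1 : ℝ)⁻¹ * τ) ^ 2 < Q.1 w - gE Q.1 w) → C * ((n + 1 : ℝ)⁻¹ * τ) ^ 2 < Q.1 w - gE Q.1 w) := fun τ => by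
      by_cases h : ∃ w, dist w z ≤ 2 * |τ| ∧ C * ((n + 1 : ℝ)⁻¹ * τ) ^ 2 < Q.1 w - gE Q.1 w
      · obtain ⟨w, h1, h2⟩ := h; exact ⟨w, h1, fun _ => h2⟩
      · exact ⟨z, by simp, fun h' => absurd h' h⟩
    choose w w1 w2 using hb
    have n0 : (0:ℝ) < (n + 1 : ℝ) := by positivity
    have h2 := hz w (fun τ => (n + 1 : ℝ)⁻¹ * τ) (l := 𝓝[>] 0) ?_ ?_
    · filter_upwards [h2.eventually (lt_mem_nhds (zero_lt_one : (0:ℝ≥0∞) < 1)), self_mem_nhdsWithin] with τ t1 t0 x hx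
      rw [mem_Ioi] at t0
      have : (D ∩ closedBall (w τ) ((n + 1 : ℝ)⁻¹ * τ)).Nonempty := by
        by_contra hne
        rw [not_nonempty_iff_eq_empty] at hne
        rw [hne] at t1; simp at t1
      obtain ⟨y, y1, y2⟩ := this
      by_contra hx'
      have := w2 τ ⟨x, by rwa [abs_of_pos t0], not_le.1 hx'⟩
      have := hC y y1 (w τ)
      have : C * dist (w τ) y ^ 2 ≤ C * ((n + 1 : ℝ)⁻¹ * τ) ^ 2 := by
        gcongr; rw [dist_comm]; exact y2
      linarith
    · refine tendsto_nhdsWithin_iff.2 ⟨?_, ?_⟩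
      · have : Tendsto (fun τ : ℝ => (n + 1 : ℝ)⁻¹ * τ) (𝓝 0) (𝓝 ((n + 1 : ℝ)⁻¹ * 0)) := tendsto_id.const_mul _
        rw [mul_zero] at this
        exact this.mono_left nhdsWithin_le_nhds
      · filter_upwards [self_mem_nhdsWithin] with τ t0
        rw [mem_Ioi] at t0 ⊢; positivity
    · filter_upwards [self_mem_nhdsWithin] with τ t0
      rw [mem_Ioi] at t0
      rw [mem_closedBall, dist_comm]
      refine (w1 τ).trans (le_of_eq ?_)
      rw [abs_of_pos t0]; field_simp
  filter_upwards [key] with z hz ε hε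
  obtain ⟨n, hn⟩ := exists_nat_gt (C / ε)
  filter_upwards [hz n] with τ ht w hw
  refine (ht w hw).trans ?_
  rw [mul_pow, ← mul_assoc]
  gcongr
  rw [inv_pow, ← div_eq_mul_inv, div_le_iff₀ (by positivity)]
  rw [div_lt_iff₀ hε] at hn
  nlinarith [mul_pos hε hε, (Nat.cast_nonneg n : (0:ℝ) ≤ n), mul_nonneg hε.le (Nat.cast_nonneg n : (0:ℝ) ≤ n), mul_nonneg hε.le (sq_nonneg (n:ℝ))]
end
end
section
variable {m : ℕ}
lemma sd_h : ∃ C : ℝ, 0 ≤ C ∧ ∀ (u : EE m → ℝ), LB u → ∀ (z : EE m) (τ e : ℝ), 0 ≤ e → (∀ y, ‖y‖ ≤ 2 → |u (z + τ • y)| ≤ e) →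
    ∀ s, ‖s‖ ≤ 1 → mol τ u (z + τ • s) + mol τ u (z - τ • s) - 2 * mol τ u z ≤ C * e * ‖s‖ ^ 2 := by
  obtain ⟨C, C0, hC⟩ := krn_SD (m := m)
  refine ⟨C * volume.real (closedBall (0 : EE m) 2), by positivity, fun u hu z τ e e0 he s hs => ?_⟩
  set U : EE m → ℝ := fun y => u (z + τ • y)
  have hU : LB U := hu.shift z τ
  have h1 : ∀ s, mol τ u (z + τ • s) = ∫ y, U y * krn (s - y) := fun s => by
    have := mol_eq_conv one_pos U s
    simp only [one_pow, inv_one, one_mul, one_smul] at this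
    rw [← this]; simp only [mol, U, smul_add, add_assoc, one_smul]
  have i1 : ∀ s, Integrable fun y => U y * krn (s - y) := fun s => by
    refine (hU.mul (Continuous.lb ?_)).int (R := ‖s‖ + 1) fun y hy => ?_
    · have := (krn_smooth (m := m)).continuous; fun_prop
    · rw [krn_supp, mul_zero]
      have := norm_sub_norm_le y s
      rw [norm_sub_rev]; linarith
  have h2 := h1 (-s)
  have h3 := h1 0
  rw [smul_neg, ← sub_eq_add_neg] at h2
  rw [smul_zero, add_zero] at h3
  have j1 : Integrable fun y => U y * krn (s - y) + U y * krn (-s - y) := (i1 s).add (i1 (-s))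
  rw [h1 s, h2, h3, ← integral_const_mul, ← integral_add (i1 _) (i1 _), ← integral_sub j1 ((i1 _).const_mul 2)]
  have h4 : ∫ y, (closedBall (0 : EE m) 2).indicator (fun _ => e * (C * ‖s‖ ^ 2)) y = C * volume.real (closedBall (0 : EE m) 2) * e * ‖s‖ ^ 2 := by
    rw [integral_indicator_const _ measurableSet_closedBall, smul_eq_mul]; ring
  rw [← h4]
  refine integral_mono (j1.sub ((i1 _).const_mul 2)) ((integrable_indicator_iff measurableSet_closedBall).2 (integrableOn_const (by exact measure_closedBall_lt_top.ne))) fun y => ?_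
  change U y * krn (s - y) + U y * krn (-s - y) - 2 * (U y * krn (0 - y)) ≤ _
  by_cases hy : ‖y‖ ≤ 2
  · rw [indicator_of_mem (by simpa using hy)]
    have e1 := hC (-y) s
    rw [show -y + s = s - y by abel, show -y - s = -s - y by abel, show -y = 0 - y by simp] at e1
    calc _ = U y * (krn (s - y) + krn (-s - y) - 2 * krn (0 - y)) := by ring
      _ ≤ |U y| * |krn (s - y) + krn (-s - y) - 2 * krn (0 - y)| := by rw [← abs_mul]; exact le_abs_self _
      _ ≤ _ := mul_le_mul (he y hy) e1 (abs_nonneg _) e0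
  · rw [indicator_of_notMem (by simpa using hy)]
    push Not at hy
    have := norm_sub_norm_le y s
    have := norm_sub_norm_le y (-s)
    rw [norm_neg] at this
    rw [krn_supp (s - y) (by rw [norm_sub_rev]; linarith), krn_supp (-s - y) (by rw [norm_sub_rev]; linarith), krn_supp (0 - y) (by simp; linarith)]
    simp
set_option maxSynthPendingDepth 3 in
lemma clm_ev {E : Type*} [NormedAddCommGroup E] [NormedSpace ℝ E] {u : E → ℝ} (h : ContDiff ℝ ∞ u) (z : E) {ε : ℝ} (hε : 0 < ε) :
    ∃ δ > 0, ∀ x, dist x z < δ → ∀ v w, |fderiv ℝ (fderiv ℝ u) x v w - fderiv ℝ (fderiv ℝ u) z v w| ≤ ε * ‖v‖ * ‖w‖ := by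
  have hc : Continuous (fderiv ℝ (fderiv ℝ u)) := ((h.fderiv_right (m := ∞) le_rfl).fderiv_right (m := ∞) le_rfl).continuous
  obtain ⟨δ, δ0, hδ⟩ := Metric.continuous_iff.1 hc z ε hε
  refine ⟨δ, δ0, fun x hx v w => ?_⟩
  have h1 := hδ x hx
  rw [dist_eq_norm] at h1
  have h2 := ((fderiv ℝ (fderiv ℝ u) x - fderiv ℝ (fderiv ℝ u) z).le_opNorm₂ v w)
  rw [_root_.sub_apply, _root_.sub_apply, Real.norm_eq_abs] at h2
  refine h2.trans ?_
  gcongr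
lemma D2_ev (Q : RS m) (z : EE m) {ε : ℝ} (hε : 0 < ε) : ∃ δ > 0, ∀ x, dist x z < δ → ∀ v w, |D2 Q x v w - D2 Q z v w| ≤ ε * ‖v‖ * ‖w‖ :=
  clm_ev (RS.cd Q) z hε
lemma sd_Q (Q : RS m) (z : EE m) {ε : ℝ} (hε : 0 < ε) : ∃ δ > 0, ∀ (τ : ℝ) (s : EE m), 0 ≤ τ → τ + ‖s‖ < δ →
    D2 Q z s s - ε * ‖s‖ ^ 2 ≤ mol τ Q.1 (z + s) + mol τ Q.1 (z - s) - 2 * mol τ Q.1 z := by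
  obtain ⟨δ, δ0, hδ⟩ := D2_ev Q z hε
  refine ⟨δ, δ0, fun τ s hτ hs => ?_⟩
  have hQ := (RS.ct Q).lb
  have a : ∀ s : EE m, LB fun w => Q.1 (w + s) := fun s => by have := RS.ct Q; exact Continuous.lb (by fun_prop)
  have b : ∀ s : EE m, mol τ Q.1 (z + s) = mol τ (fun w => Q.1 (w + s)) z := fun s => by
    simp only [mol]; congr 1; funext y; rw [add_right_comm]
  have h1 : mol τ (fun w => Q.1 (w + s) + Q.1 (w + -s) + (-2) * Q.1 w) z = mol τ Q.1 (z + s) + mol τ Q.1 (z - s) - 2 * mol τ Q.1 z := by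
    rw [mol_add ((a s).add (a (-s))) (hQ.smul (-2)), mol_add (a s) (a (-s)), mol_smul, ← b, ← b, ← sub_eq_add_neg z s]; ring
  rw [← h1]
  refine le_mol' (((a s).add (a (-s))).add (hQ.smul (-2))) hτ fun w hw => ?_
  have key : ∀ x, dist x z < δ → D2 Q z s s - ε * ‖s‖ ^ 2 ≤ D2 Q x s s := fun x hx => by
    have h3 := (abs_le.1 (hδ x hx s s)).1
    nlinarith
  have dd : ∀ t ∈ Icc (0:ℝ) 1, ∀ s' : EE m, ‖s'‖ = ‖s‖ → dist (w + t • s') z < δ := fun t ht s' hs' => by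
    calc dist (w + t • s') z ≤ dist (w + t • s') w + dist w z := dist_triangle _ _ _
      _ ≤ ‖s‖ + τ := by
        refine add_le_add ?_ hw
        rw [dist_eq_norm, add_sub_cancel_left, norm_smul, Real.norm_of_nonneg ht.1, hs']
        nlinarith [norm_nonneg s, ht.2]
      _ < δ := by linarith
  have e1 := SD1 Q w s fun t ht => key _ (dd t ht s rfl)
  have e2 := SD1 Q w (-s) (c := D2 Q z s s - ε * ‖s‖ ^ 2) fun t ht => by
    have := key _ (dd t ht (-s) (norm_neg s))
    simpa using this
  rw [map_neg] at e2
  linarith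
lemma D2_low (u : RS m) (z : EE m) {q : EE m → ℝ} (hq : ∀ (t : ℝ) v, q (t • v) = t ^ 2 * q v) {δ : ℝ} (hδ : 0 < δ)
    (h : ∀ s, ‖s‖ < δ → q s ≤ u.1 (z + s) + u.1 (z - s) - 2 * u.1 z) (v : EE m) : q v ≤ D2 u z v v := by
  refine le_of_forall_pos_le_add fun η hη => ?_
  obtain ⟨ρ, ρ0, hρ⟩ := peano u z (ε := η / (2 * (‖v‖ ^ 2 + 1))) (by positivity)
  obtain ⟨t, t0, ht⟩ : ∃ t : ℝ, 0 < t ∧ t * ‖v‖ < min δ ρ := by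
    refine ⟨min δ ρ / (2 * (‖v‖ + 1)), by positivity, ?_⟩
    rw [div_mul_eq_mul_div, div_lt_iff₀ (by positivity)]
    have : 0 < min δ ρ := by positivity
    nlinarith [norm_nonneg v]
  have n1 : ‖t • v‖ = t * ‖v‖ := by rw [norm_smul, Real.norm_of_nonneg t0.le]
  have a1 := h (t • v) (by rw [n1]; exact ht.trans_le (min_le_left _ _))
  have a2 := (abs_le.1 (hρ (t • v) (by rw [n1]; exact ht.trans_le (min_le_right _ _)))).2
  have a3 := (abs_le.1 (hρ (-(t • v)) (by rw [norm_neg, n1]; exact ht.trans_le (min_le_right _ _)))).2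
  rw [← sub_eq_add_neg, norm_neg] at a3
  simp only [map_neg, _root_.neg_apply, neg_neg] at a3
  rw [hq] at a1
  have a4 : D2 u z (t • v) (t • v) = t ^ 2 * D2 u z v v := by simp; ring
  rw [a4, n1] at a2 a3
  have a5 : η / (2 * (‖v‖ ^ 2 + 1)) * (t * ‖v‖) ^ 2 ≤ t ^ 2 * (η / 2) := by
    rw [div_mul_eq_mul_div, div_le_iff₀ (by positivity)]
    nlinarith [mul_pos (pow_pos t0 2) hη]
  refine le_of_mul_le_mul_left (a := t ^ 2) ?_ (by positivity)
  linarith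
section
variable {M : ℝ} {K O : Set (EE m)} {Q : RS m} {k : ℝ}
lemma QH.lev (h : QH M K O Q k) (hg : LB (gE Q.1)) (sg : SubM (gE Q.1)) {z : EE m} (hz : gE Q.1 z = Q.1 z) (b : EE m) : 0 ≤ Lv Q z b :=
  touch hg sg Q z one_pos (fun _ _ => h.g_le_Q _) hz b
lemma QH.pd (h : QH M K O Q k) (hg : LB (gE Q.1)) (sg : SubM (gE Q.1)) {z : EE m} (hz : gE Q.1 z = Q.1 z) : (Hz (Q + (1/4:ℝ) • nsq) z).PosDef :=
  Hz_pd _ _ fun b hb => by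
    rw [Lv_add, Lv_smul, Lv_nsq]
    have := h.lev hg sg hz b
    positivity
lemma QH.MA_low (h : QH M K O Q k) (hg : GC (M + 1) (gE Q.1)) (B : ℝ) :
    ∀ᵐ z ∂volume.restrict {z | gE Q.1 z = Q.1 z}, ‖z‖ ^ 2 + 1 < B → ∀ᶠ τ in 𝓝[>] (0:ℝ),
      MA (Q + (1/4:ℝ) • nsq) z ≤ MA (V B (ms τ 0 (gE Q.1))) z := by
  obtain ⟨C, C0, hC⟩ := sd_h (m := m)
  have hD : MeasurableSet {z | gE Q.1 z = Q.1 z} := measurableSet_eq_fun hg.lb.meas (RS.ct Q).measurable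
  filter_upwards [h.dens hg.lb hg.sub, ae_restrict_mem hD] with z hz zD hzB
  obtain ⟨δ, δ0, hδ⟩ := sd_Q Q z (ε := 1/4) (by norm_num)
  filter_upwards [hz (1 / (4 * (C + 1))) (by positivity), Ioo_mem_nhdsGT (half_pos δ0)] with τ ht ht0
  have τ0 := ht0.1
  set g := gE Q.1
  set H : EE m → ℝ := fun z => Q.1 z + (-1) * g z
  have hQ := (RS.ct Q).lb
  have hH : LB H := hQ.add (hg.lb.smul (-1))
  set u : RS m := ⟨mol τ g, mol_smooth hg.lb τ0⟩
  have hu : ∀ w, u.1 w = mol τ Q.1 w - mol τ H w := fun w => by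
    simp only [H]; rw [mol_add hQ (hg.lb.smul (-1)), mol_smul]; change mol τ g w = _; ring
  have low := D2_low u z (q := fun s => D2 Q z s s - 1/2 * ‖s‖ ^ 2) (fun t v => by
      simp only [map_smul, _root_.smul_apply, norm_smul, mul_pow, smul_eq_mul, Real.norm_eq_abs, sq_abs]; ring)
    (δ := min (δ / 2) τ) (by positivity) fun s hs => by
      have s1 := hs.trans_le (min_le_left _ _)
      have s2 := hs.trans_le (min_le_right _ _)
      have q1 := hδ τ s τ0.le (by linarith [ht0.2])
      have q2 := hC H hH z τ (1 / (4 * (C + 1)) * τ ^ 2) (by positivity) (fun y hy => by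
        have : H (z + τ • y) = Q.1 (z + τ • y) - g (z + τ • y) := by simp only [H]; ring
        rw [this, abs_of_nonneg (by linarith [h.g_le_Q (z + τ • y)])]
        refine ht _ ?_
        rw [dist_eq_norm, add_sub_cancel_left, norm_smul, Real.norm_of_nonneg τ0.le]; nlinarith) (τ⁻¹ • s) (by
        rw [norm_smul, norm_inv, Real.norm_of_nonneg τ0.le, ← div_eq_inv_mul, div_le_one τ0]; exact s2.le)
      rw [smul_inv_smul₀ τ0.ne', norm_smul, norm_inv, Real.norm_of_nonneg τ0.le] at q2
      have q3 : C * (1 / (4 * (C + 1)) * τ ^ 2) * (τ⁻¹ * ‖s‖) ^ 2 ≤ 1/4 * ‖s‖ ^ 2 := by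
        have : C * (1 / (4 * (C + 1)) * τ ^ 2) * (τ⁻¹ * ‖s‖) ^ 2 = C / (C + 1) * (1/4 * ‖s‖ ^ 2) := by field_simp
        rw [this]
        have : C / (C + 1) ≤ 1 := by rw [div_le_one (by positivity)]; linarith
        nlinarith [sq_nonneg ‖s‖]
      simp only [hu]
      linarith
  have hVD : D2 (V B (ms τ 0 g)) z = D2 (u + (1/2:ℝ) • nsq) z := by
    have e1 : ∀ᶠ w in 𝓝 z, ‖w‖ ^ 2 + 1 < B := (by fun_prop : Continuous fun w : EE m => ‖w‖ ^ 2 + 1).continuousAt.eventually (gt_mem_nhds hzB)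
    have e2 : (V B (ms τ 0 g)).1 =ᶠ[𝓝 z] fun w => (u + (1/2:ℝ) • nsq).1 w + (gm 1 - 1) := by
      filter_upwards [e1] with w hw
      have hw0 : 0 ≤ mol τ g w := le_mol' hg.lb τ0.le fun y _ => hg.nn y
      rw [V_near (f := ms τ 0 g) ((mol_smooth hg.lb τ0).add contDiff_const) (by simpa [ms] using hw0) hw.le]
      change mol τ g w + 0 + _ + _ = mol τ g w + (1/2:ℝ) * ‖w‖ ^ 2 + _
      ring
    unfold D2
    have e3 := e2.fderiv (𝕜 := ℝ)
    rw [e3.fderiv_eq]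
    congr 1; funext w
    rw [fderiv_add_const]
  have hL : ∀ b, 0 ≤ Lv (V B (ms τ 0 g) - (Q + (1/4:ℝ) • nsq)) z b := fun b => by
    have : Lv (V B (ms τ 0 g)) z b = Lv (u + (1/2:ℝ) • nsq) z b := by simp only [Lv, hVD]
    rw [Lv_sub, this, Lv_add, Lv_add, Lv_smul, Lv_smul, Lv_nsq]
    have l1 := low b
    have l2 := low (Complex.I • b)
    simp only [norm_smul, Complex.norm_I, one_mul] at l2
    simp only [Lv]
    linarith
  have := det_mono (h.pd hg.lb hg.sub zD) (Hz_psd _ _ hL)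
  rwa [← Hz_add, add_sub_cancel] at this
end
end
section
variable {m : ℕ} {M k B : ℝ} {K O : Set (EE m)} {Q : RS m}
lemma QH.DO (h : QH M K O Q k) (hg : GC (M + 1) (gE Q.1)) : {z | gE Q.1 z = Q.1 z} ⊆ O := fun z hz => by
  by_contra hO
  have := h.off z hO
  have h2 := hg.up z
  rw [show gE Q.1 z = Q.1 z from hz] at h2
  linarith
theorem QH.mass (h : QH M K O Q k) (hM : 0 ≤ M) (hg : GC (M + 1) (gE Q.1)) (hB : 0 ≤ B) (hOB : ∀ z ∈ O, ‖z‖ ^ 2 + 1 < B)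
    {c : ℝ} (hc : c < ∫ z in {z | gE Q.1 z = Q.1 z}, MA (Q + (1/4:ℝ) • nsq) z) :
    ∃ φ, PP (RR (M + 1) B) (MM (M + 1) B) (pB B) φ ∧ c ≤ ∫ z in O, MA φ z := by
  set D := {z | gE Q.1 z = Q.1 z}
  have hDO : D ⊆ O := h.DO hg
  have hD : MeasurableSet D := measurableSet_eq_fun hg.lb.meas (RS.ct Q).measurable
  set F := MA (Q + (1/4:ℝ) • nsq)
  have hF0 : ∀ z ∈ D, 0 ≤ F z := fun z hz => (Complex.le_def.1 (h.pd hg.lb hg.sub hz).det_pos.le).1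
  have hI : ∀ u : RS m, IntegrableOn (MA u) O := fun u =>
    ((MA_cont u).continuousOn.integrableOn_compact (isCompact_closedBall (0 : EE m) B)).mono_set fun z hz => by
      rw [mem_closedBall_zero_iff]; nlinarith [hOB z hz, sq_nonneg (‖z‖ - 1)]
  have t0 : ∀ n : ℕ, (0:ℝ) < 1 / ((n:ℝ) + 1) := fun n => by positivity
  have t1 : ∀ n : ℕ, 1 / ((n:ℝ) + 1) ≤ 1 := fun n => by rw [div_le_one (by positivity)]; linarith [n.cast_nonneg (α := ℝ)]
  set φ : ℕ → RS m := fun n => V B (ms (1 / ((n:ℝ) + 1)) 0 (gE Q.1))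
  have hφ : ∀ n, PP (RR (M + 1) B) (MM (M + 1) B) (pB B) (φ n) := fun n => V_PP (by linarith) hB (hg.ms (t0 n) (t1 n))
  have hφ0 : ∀ n z, 0 ≤ MA (φ n) z := fun n z => (Complex.le_def.1 ((hφ n).pd z).det_pos.le).1
  have lim : Tendsto (fun n => ∫ z in D, min (MA (φ n) z) (F z)) atTop (𝓝 (∫ z in D, F z)) := by
    refine tendsto_integral_of_dominated_convergence F (fun n => ((MA_cont _).min (MA_cont _)).aestronglyMeasurable) ((hI _).mono_set hDO) (fun n => ?_) ?_
    · filter_upwards [ae_restrict_mem hD] with z hz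
      rw [Real.norm_of_nonneg (le_min (hφ0 n z) (hF0 z hz))]
      exact min_le_right _ _
    · filter_upwards [h.MA_low hg B, ae_restrict_mem hD] with z hz zD
      have h1 : Tendsto (fun n : ℕ => 1 / ((n:ℝ) + 1)) atTop (𝓝[>] 0) :=
        tendsto_nhdsWithin_iff.2 ⟨tendsto_one_div_add_atTop_nhds_zero_nat, Eventually.of_forall t0⟩
      refine tendsto_const_nhds.congr' ?_
      filter_upwards [h1.eventually (hz (hOB z (hDO zD)))] with n hn
      exact (min_eq_right hn).symm
  obtain ⟨n, hn⟩ := (lim.eventually (lt_mem_nhds hc)).exists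
  refine ⟨φ n, hφ n, hn.le.trans ?_⟩
  calc _ ≤ ∫ z in D, MA (φ n) z := by
        have i1 := (hI (φ n)).mono_set hDO
        have i2 : IntegrableOn F D := (hI _).mono_set hDO
        exact integral_mono (i1.inf i2) i1 fun z => min_le_left _ _
    _ ≤ _ := setIntegral_mono_set (hI _) (Eventually.of_forall (hφ0 n)) (Eventually.of_forall hDO)
end
section
variable {m : ℕ} {M k B : ℝ} {K O : Set (EE m)} {Q : RS m}
lemma ii_clin (T : EE m →ₗ[ℂ] EE m) (hT : LinearMap.det T ≠ 0) {f : EE m → ℝ} (hf : Integrable f) : Integrable fun y => f (T y) := by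
  have hd : LinearMap.det (T.restrictScalars ℝ) = ‖LinearMap.det T‖ ^ 2 := by
    rw [LinearMap.det_restrictScalars, Algebra.norm_complex_apply, Complex.normSq_eq_norm_sq]
  have hd0 : LinearMap.det (T.restrictScalars ℝ) ≠ 0 := by rw [hd]; simpa using hT
  have h1 := Measure.map_linearMap_addHaar_eq_smul_addHaar (μ := (volume : Measure (EE m))) hd0
  have hm : Measurable (T.restrictScalars ℝ) := (LinearMap.toContinuousLinearMap (T.restrictScalars ℝ)).continuous.measurable
  have h2 : Integrable f (Measure.map (T.restrictScalars ℝ) volume) := by rw [h1]; exact hf.smul_measure ENNReal.ofReal_ne_top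
  exact h2.comp_measurable hm
lemma sq_sub {H : EE m → ℂ} (hH : Differentiable ℂ H) : SubM fun y => ‖H y‖ ^ 2 := fun a b => by
  set G : ℂ → ℂ := fun ζ => H (a + ζ • b) ^ 2
  have hG : Differentiable ℂ G := (hH.comp (by fun_prop : Differentiable ℂ fun ζ : ℂ => a + ζ • b)).pow 2
  have h1 : Real.circleAverage G 0 1 = G 0 := DiffContOnCl.circleAverage hG.diffContOnCl
  have h2 : ‖G 0‖ = ‖H a‖ ^ 2 := by simp [G]
  change ‖H a‖ ^ 2 ≤ Real.circleAverage (fun ζ : ℂ => ‖H (a + ζ • b)‖ ^ 2) 0 1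
  rw [← h2, ← h1, Real.circleAverage, Real.circleAverage, norm_smul, Real.norm_of_nonneg (by positivity), smul_eq_mul]
  refine mul_le_mul_of_nonneg_left ?_ (by positivity)
  refine (intervalIntegral.norm_integral_le_integral_norm (by positivity)).trans_eq ?_
  simp [G]
def wt (d : ℕ) (Q : RS m) (p : EE m → ℂ) (w : EE m) : ℝ := ‖p w‖ ^ 2 * Real.exp (-(2 * d * Q.1 w))
lemma wt_cont (d : ℕ) {p : EE m → ℂ} (hp : Continuous p) : Continuous (wt d Q p) := by
  have := RS.ct Q; unfold wt; fun_prop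
lemma ell {C : ℝ} (hC : ∀ y : EE m, krn y ≤ C) {d : ℕ} {p : EE m → ℂ} (hp : Differentiable ℂ p) {z : EE m} {T : EE m →ₗ[ℂ] EE m}
    (hT : LinearMap.det T ≠ 0) {R : ℝ} (hTR : ∀ y, ‖y‖ ≤ 1 → ‖z + T y‖ < R) {P : EE m → ℂ} (hP : Differentiable ℂ P) (P0 : P 0 = 0) {κ : ℝ}
    (hQ : ∀ y, ‖y‖ ≤ 1 → Q.1 (z + T y) ≤ Q.1 z + (P y).re + κ) :
    wt d Q p z ≤ C * Real.exp (2 * d * κ) / ‖LinearMap.det T‖ ^ 2 * ∫ w in ball 0 R, wt d Q p w := by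
  have hT' : Differentiable ℂ T := (LinearMap.toContinuousLinearMap T).differentiable
  set H : EE m → ℂ := fun y => p (z + T y) * Complex.exp (-(d * P y))
  have hH : Differentiable ℂ H := (hp.comp ((differentiable_const z).add hT')).mul ((hP.const_mul _).neg.cexp)
  have h1 := le_mol (u := fun y => ‖H y‖ ^ 2) (hH.continuous.norm.pow 2).lb (sq_sub hH) 1 0
  have h2 : ‖H 0‖ ^ 2 = ‖p z‖ ^ 2 := by simp [H, P0]
  simp only [h2, mol, zero_add, one_smul] at h1
  set f : EE m → ℝ := (ball 0 R).indicator (wt d Q p)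
  have fi : Integrable f := (integrable_indicator_iff measurableSet_ball).2 (((wt_cont d hp.continuous).continuousOn.integrableOn_compact
    (isCompact_closedBall (0 : EE m) R)).mono_set ball_subset_closedBall)
  have f0 : ∀ y, 0 ≤ f y := fun y => indicator_nonneg (fun _ _ => by unfold wt; positivity) _
  have hlin : ∫ y, f (z + T y) = (‖LinearMap.det T‖ ^ 2)⁻¹ * ∫ w in ball 0 R, wt d Q p w := by
    rw [int_clin T hT (fun y => f (z + y)), integral_add_left_eq_self f z, integral_indicator measurableSet_ball]
  have hfi : Integrable fun y => f (z + T y) := ii_clin T hT (fi.comp_add_left z)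
  have h3 : ∫ y, krn y * ‖H y‖ ^ 2 ≤ ∫ y, C * Real.exp (2 * d * κ) * Real.exp (2 * d * Q.1 z) * f (z + T y) := by
    refine integral_mono_of_nonneg (Eventually.of_forall fun y => mul_nonneg (krn_nonneg y) (by positivity)) (hfi.const_mul _) (Eventually.of_forall fun y => ?_)
    have C0 : 0 ≤ C := (krn_nonneg y).trans (hC y)
    change krn y * ‖H y‖ ^ 2 ≤ C * Real.exp (2 * d * κ) * Real.exp (2 * d * Q.1 z) * f (z + T y)
    rcases le_total 1 ‖y‖ with hy | hy
    · rw [krn_supp y hy, zero_mul]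
      have := f0 (z + T y); positivity
    · have e1 : f (z + T y) = wt d Q p (z + T y) := indicator_of_mem (by simpa using hTR y hy) _
      rw [e1, wt, mul_assoc, mul_assoc]
      refine mul_le_mul (hC y) ?_ (by positivity) C0
      have e2 : ‖H y‖ ^ 2 = ‖p (z + T y)‖ ^ 2 * Real.exp (-(2 * d * (P y).re)) := by
        simp only [H, norm_mul, Complex.norm_exp, mul_pow]
        rw [← Real.exp_nat_mul]; congr 2; simp; ring
      rw [e2, show Real.exp (2 * d * κ) * (Real.exp (2 * d * Q.1 z) * (‖p (z + T y)‖ ^ 2 * Real.exp (-(2 * d * Q.1 (z + T y))))) =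
        ‖p (z + T y)‖ ^ 2 * Real.exp (2 * d * κ + 2 * d * Q.1 z + -(2 * d * Q.1 (z + T y))) by rw [Real.exp_add, Real.exp_add]; ring]
      refine mul_le_mul_of_nonneg_left (Real.exp_le_exp.2 ?_) (by positivity)
      have := mul_le_mul_of_nonneg_left (hQ y hy) (by positivity : (0:ℝ) ≤ 2 * d)
      linarith
  rw [integral_const_mul, hlin] at h3
  rw [wt]
  have h4 := mul_le_mul_of_nonneg_right (h1.trans h3) (Real.exp_pos (-(2 * d * Q.1 z))).le
  refine h4.trans_eq ?_
  rw [Real.exp_neg]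
  field_simp
lemma crude (h : QH M K O Q k) {C : ℝ} (hC : ∀ y : EE m, krn y ≤ C) {d : ℕ} (hd : 1 ≤ d) {p : EE m → ℂ} (hp : Differentiable ℂ p) {z : EE m}
    {R : ℝ} (hR : ‖z‖ + 1 < R) : wt d Q p z ≤ C * Real.exp (2 * k) * (d : ℝ) ^ m * ∫ w in ball 0 R, wt d Q p w := by
  have hd' : (0:ℝ) < d := by exact_mod_cast hd
  set t : ℝ := (Real.sqrt d)⁻¹
  have t0 : 0 < t := by positivity
  have t1 : t ≤ 1 := inv_le_one_of_one_le₀ (Real.one_le_sqrt.2 (by exact_mod_cast hd))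
  have t2 : t ^ 2 = (d : ℝ)⁻¹ := by rw [inv_pow, Real.sq_sqrt hd'.le]
  set T : EE m →ₗ[ℂ] EE m := (t : ℂ) • LinearMap.id
  have hT : LinearMap.det T = (t : ℂ) ^ m := by rw [LinearMap.det_smul]; simp
  have nT : ∀ y, ‖T y‖ = t * ‖y‖ := fun y => by simp [T, norm_smul, abs_of_pos t0]
  set L : EE m →L[ℂ] ℂ := StrongDual.extendRCLike (𝕜 := ℂ) (fderiv ℝ Q.1 z)
  have hL : ∀ y, (L y).re = fderiv ℝ Q.1 z y := fun y => StrongDual.re_extendRCLike_apply (𝕜 := ℂ) (fderiv ℝ Q.1 z) y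
  have := ell (Q := Q) (κ := k / d) hC (d := d) hp (z := z) (T := T) (by rw [hT]; exact pow_ne_zero _ (by exact_mod_cast t0.ne'))
    (R := R) (fun y hy => (norm_add_le _ _).trans_lt (by rw [nT]; nlinarith [norm_nonneg y]))
    (P := fun y => L (T y)) (L.differentiable.comp (LinearMap.toContinuousLinearMap T).differentiable) (by simp) (fun y hy => by
      have e1 := (abs_le.1 (h.tay z (T y))).2
      rw [nT, mul_pow, t2] at e1
      rw [hL]
      have : k * ((d:ℝ)⁻¹ * ‖y‖ ^ 2) ≤ k / d := by
        rw [div_eq_mul_inv]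
        have := h.k0
        refine mul_le_mul_of_nonneg_left (mul_le_of_le_one_right (by positivity) (pow_le_one₀ (norm_nonneg _) hy)) (by positivity)
      linarith)
  refine this.trans_eq ?_
  rw [hT, norm_pow, Complex.norm_of_nonneg t0.le, ← pow_mul, mul_comm m 2, pow_mul, t2, inv_pow, div_inv_eq_mul]
  congr 4; field_simp
lemma bil (D : EE m →L[ℝ] EE m →L[ℝ] ℝ) (hD : ∀ v w, D v w = D w v) : ∃ S : EE m →L[ℂ] EE m →L[ℂ] ℂ,
    ∀ v, (S v v).re = (D v v - D (Complex.I • v) (Complex.I • v)) / 4 := by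
  have sp : ∀ (c : ℂ) (v : EE m), c • v = c.re • v + c.im • Complex.I • v := fun c v => by
    conv_lhs => rw [← Complex.re_add_im c, add_smul, mul_smul]
    rfl
  set f : EE m → EE m → ℂ := fun v w => (1/4:ℂ) * ((D v w : ℂ) - D (Complex.I • v) (Complex.I • w) - Complex.I * (D v (Complex.I • w) + D (Complex.I • v) w))
  have fs : ∀ v w, f v w = f w v := fun v w => by
    simp only [f]; rw [hD v w, hD (Complex.I • v) (Complex.I • w), hD v (Complex.I • w), hD (Complex.I • v) w]; ring
  have fa : ∀ v v' w, f (v + v') w = f v w + f v' w := fun v v' w => by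
    simp only [f, smul_add, map_add, _root_.add_apply, Complex.ofReal_add]; ring
  have fc : ∀ (c : ℂ) v w, f (c • v) w = c • f v w := fun c v w => by
    have e : Complex.I • c • v = c.re • Complex.I • v - c.im • v := by
      rw [sp c v, smul_add, smul_comm Complex.I c.im, smul_comm Complex.I c.re, smul_smul Complex.I Complex.I, Complex.I_mul_I, neg_one_smul, smul_neg, sub_eq_add_neg]
    simp only [f]
    rw [e, sp c v]
    simp only [map_add, map_sub, map_smul, _root_.add_apply, _root_.sub_apply, _root_.smul_apply, smul_eq_mul, Complex.ofReal_add, Complex.ofReal_sub, Complex.ofReal_mul]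
    conv_rhs => rw [← Complex.re_add_im c]
    linear_combination (1/4:ℂ) * (-(c.im:ℂ) * (D v w : ℂ) * 0 + (c.im:ℂ) * ((D v (Complex.I • w) : ℂ) + D (Complex.I • v) w)) * Complex.I_sq
  refine ⟨(LinearMap.mk₂ ℂ f fa fc (fun v w w' => by rw [fs, fa, fs w, fs w']) (fun c v w => by rw [fs, fc, fs w])).toContinuousBilinearMap, fun v => ?_⟩
  rw [LinearMap.toContinuousBilinearMap_apply, LinearMap.mk₂_apply]
  simp [f]; ring
lemma exT (P : Matrix (Fin m) (Fin m) ℂ) (hP : P.PosDef) : ∃ T : EE m →ₗ[ℂ] EE m, LinearMap.det T ≠ 0 ∧ (‖LinearMap.det T‖ ^ 2)⁻¹ = P.det.re ∧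
    ∀ y : EE m, star (T y : Fin m → ℂ) ⬝ᵥ (P *ᵥ (T y : Fin m → ℂ)) = ((‖y‖ ^ 2 : ℝ) : ℂ) := by
  obtain ⟨B, hB⟩ := psd_root P hP.posSemidef
  have hu : IsUnit B.det := by
    have := (Matrix.isUnit_iff_isUnit_det _).1 hP.isUnit
    rw [hB, det_mul] at this
    exact isUnit_of_mul_isUnit_right this
  have hd : LinearMap.det (Matrix.toEuclideanLin B⁻¹) = B.det⁻¹ := by
    rw [Matrix.toEuclideanLin_eq_toLin_orthonormal, LinearMap.det_toLin, det_nonsing_inv, Ring.inverse_eq_inv']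
  refine ⟨Matrix.toEuclideanLin B⁻¹, ?_, ?_, fun y => ?_⟩
  · rw [hd]; exact inv_ne_zero hu.ne_zero
  · rw [hd, hB, det_mul, det_conjTranspose, norm_inv, inv_pow, inv_inv, ← Complex.normSq_eq_norm_sq, ← Complex.ofReal_re (Complex.normSq _), Complex.normSq_eq_conj_mul_self]
    rfl
  · have e : ((Matrix.toEuclideanLin B⁻¹ y : EE m) : Fin m → ℂ) = B⁻¹ *ᵥ (y : Fin m → ℂ) := rfl
    rw [e, hB, mulVec_mulVec, Matrix.mul_assoc, mul_nonsing_inv B hu, Matrix.mul_one, star_mulVec, dotProduct_mulVec, vecMul_vecMul, ← conjTranspose_mul, mul_nonsing_inv B hu, conjTranspose_one, vecMul_one, EuclideanSpace.norm_sq_eq]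
    push_cast
    refine Finset.sum_congr rfl fun i _ => ?_
    rw [Pi.star_apply, RCLike.star_def, Complex.conj_mul']
lemma sharp (h : QH M K O Q k) (hg : GC (M + 1) (gE Q.1)) {C : ℝ} (hC : ∀ y : EE m, krn y ≤ C) {z : EE m} (hz : gE Q.1 z = Q.1 z)
    {R : ℝ} (hR : ‖z‖ + 1 < R) : ∀ᶠ d : ℕ in atTop, ∀ p : EE m → ℂ, Differentiable ℂ p →
    wt d Q p z ≤ C * Real.exp 2 * (d : ℝ) ^ m * MA (Q + (1/4:ℝ) • nsq) z * ∫ w in ball 0 R, wt d Q p w := by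
  obtain ⟨T, T0, Td, hT⟩ := exT _ (h.pd hg.lb hg.sub hz)
  obtain ⟨S, hS⟩ := bil (D2 Q z) (D2_symm Q z)
  obtain ⟨δ, δ0, hδ⟩ := peano Q z (ε := 1/4) (by norm_num)
  set L : EE m →L[ℂ] ℂ := StrongDual.extendRCLike (𝕜 := ℂ) (fderiv ℝ Q.1 z)
  have hL : ∀ y, (L y).re = fderiv ℝ Q.1 z y := fun y => StrongDual.re_extendRCLike_apply (𝕜 := ℂ) (fderiv ℝ Q.1 z) y
  set N := ‖LinearMap.toContinuousLinearMap T‖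
  have hN : ∀ y, ‖T y‖ ≤ N * ‖y‖ := (LinearMap.toContinuousLinearMap T).le_opNorm
  have hlim : Tendsto (fun d : ℕ => (Real.sqrt d)⁻¹ * N) atTop (𝓝 (0 * N)) :=
    (tendsto_inv_atTop_zero.comp (Real.tendsto_sqrt_atTop.comp tendsto_natCast_atTop_atTop)).mul_const N
  rw [zero_mul] at hlim
  filter_upwards [eventually_ge_atTop 1, hlim.eventually (gt_mem_nhds (lt_min δ0 one_pos))] with d hd hdN p hp
  have hd' : (0:ℝ) < d := by exact_mod_cast hd
  set t : ℝ := (Real.sqrt d)⁻¹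
  have t0 : 0 < t := by positivity
  have t2 : t ^ 2 = (d : ℝ)⁻¹ := by rw [inv_pow, Real.sq_sqrt hd'.le]
  set U : EE m →ₗ[ℂ] EE m := (t : ℂ) • T
  have hU : LinearMap.det U = (t : ℂ) ^ m * LinearMap.det T := by rw [LinearMap.det_smul]; simp
  have nU : ∀ y, ‖y‖ ≤ 1 → ‖U y‖ < min δ 1 := fun y hy => by
    refine lt_of_le_of_lt ?_ hdN
    simp only [U, LinearMap.smul_apply, norm_smul, Complex.norm_of_nonneg t0.le]
    exact mul_le_mul_of_nonneg_left ((hN y).trans (mul_le_of_le_one_right (norm_nonneg _) hy)) t0.le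
  have dU : Differentiable ℂ U := (LinearMap.toContinuousLinearMap U).differentiable
  have := ell (Q := Q) (κ := 1 / d) hC (d := d) hp (z := z) (T := U) (by rw [hU]; exact mul_ne_zero (pow_ne_zero _ (by exact_mod_cast t0.ne')) T0)
    (R := R) (fun y hy => (norm_add_le _ _).trans_lt (by have := (nU y hy).trans_le (min_le_right _ _); linarith))
    (P := fun y => L (U y) + S (U y) (U y)) ((L.differentiable.comp dU).add ((S.differentiable.comp dU).clm_apply dU)) (by simp) (fun y hy => by
      have e1 := (abs_le.1 (hδ (U y) ((nU y hy).trans_le (min_le_left _ _)))).2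
      have e2 := hT y
      rw [Hz_form] at e2
      have e3 : Lv (Q + (1/4:ℝ) • nsq) z (U y) = t ^ 2 * ‖y‖ ^ 2 := by
        have e4 : Lv (Q + (1/4:ℝ) • nsq) z (T y) = ‖y‖ ^ 2 := by exact_mod_cast e2
        rw [← e4]
        change Lv _ z ((t : ℂ) • T y) = _
        rw [Complex.coe_smul]
        simp only [Lv, smul_comm Complex.I t, map_smul, _root_.smul_apply, smul_eq_mul]; ring
      rw [Lv_add, Lv_smul, Lv_nsq, t2, Lv] at e3
      rw [Complex.add_re, hL, hS]
      have : (d:ℝ)⁻¹ * ‖y‖ ^ 2 ≤ 1 / d := by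
        rw [one_div]
        exact mul_le_of_le_one_right (by positivity) (pow_le_one₀ (norm_nonneg _) hy)
      linarith)
  refine this.trans_eq ?_
  rw [hU, norm_mul, mul_pow, norm_pow, Complex.norm_of_nonneg t0.le, ← pow_mul, mul_comm m 2, pow_mul, t2, inv_pow,
    show 2 * (d:ℝ) * (1 / d) = 2 by field_simp, MA, ← Td]
  field_simp
end
section
variable {m : ℕ} {M k B : ℝ} {K O : Set (EE m)} {Q : RS m}
section
variable {s : ℕ}
def mon (α : Fin m → Fin (s + 1)) (z : EE m) : ℂ := ∏ i, z i ^ (α i : ℕ)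
def pc (c : (Fin m → Fin (s + 1)) → ℂ) (z : EE m) : ℂ := ∑ α, c α * mon α z
lemma mon_pl (α : Fin m → Fin (s + 1)) : Pl (m * s) (mon α) := by
  have := Pl.prod (m := m) Finset.univ (f := fun i z => (z i + 0) ^ (α i : ℕ)) fun i _ => (Pl.coord i 0).pow (α i : ℕ)
  simp only [add_zero, mul_one] at this
  refine Pl.mono this ?_
  calc _ ≤ ∑ _i : Fin m, s := Finset.sum_le_sum fun i _ => Nat.lt_succ_iff.1 (α i).2
    _ = _ := by simp
lemma pc_pl (c : (Fin m → Fin (s + 1)) → ℂ) : Pl (m * s) (pc c) :=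
  Pl.sum _ fun α _ => by simpa using (Pl.const (c α) 0).mul (mon_pl α)
lemma pc_ne {c : (Fin m → Fin (s + 1)) → ℂ} (hc : c ≠ 0) {R : ℝ} (hR : 0 < R) : ∃ z : EE m, ‖z‖ < R ∧ pc c z ≠ 0 := by
  by_contra hn
  push Not at hn
  set j : (Fin m → Fin (s + 1)) → (Fin m →₀ ℕ) := fun α => Finsupp.equivFunOnFinite.symm fun i => (α i : ℕ)
  have hj : Function.Injective j := fun α β h => by
    have := Finsupp.equivFunOnFinite.symm.injective h
    funext i; exact Fin.ext (congrFun this i)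
  set q : MvPolynomial (Fin m) ℂ := ∑ α, MvPolynomial.monomial (j α) (c α)
  have hq : ∀ x : Fin m → ℂ, MvPolynomial.eval x q = pc c (WithLp.toLp 2 x) := fun x => by
    simp only [q, map_sum, pc, mon, MvPolynomial.eval_monomial]
    refine Finset.sum_congr rfl fun α _ => ?_
    rw [Finsupp.prod_fintype _ _ (by simp)]; rfl
  have h1 : IsOpen {x : Fin m → ℂ | ‖(WithLp.toLp 2 x : EE m)‖ < R} := isOpen_lt (by fun_prop) continuous_const
  obtain ⟨ε, ε0, hε⟩ := Metric.isOpen_iff.1 h1 0 (by simpa using hR)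
  have q0 : q = 0 := by
    refine MvPolynomial.funext_set (fun _ => ball (0:ℂ) ε) (fun _ => infinite_of_mem_nhds 0 (ball_mem_nhds 0 ε0)) fun x hx => ?_
    rw [hq, map_zero]
    refine hn _ (hε ?_)
    rw [mem_ball_zero_iff, pi_norm_lt_iff ε0]
    exact fun i => by simpa using hx i (mem_univ i)
  apply hc
  funext α
  have h2 : MvPolynomial.coeff (j α) q = c α := by
    simp only [q, MvPolynomial.coeff_sum, MvPolynomial.coeff_monomial, hj.eq_iff]
    simp
  rw [← h2, q0]; simp
theorem bergman (s : ℕ) {R : ℝ} (hR : 0 < R) : ∃ β : EE m → ℝ, Continuous β ∧ (∀ z, 0 ≤ β z) ∧ ∫ z in ball 0 R, β z = ((s:ℝ) + 1) ^ m ∧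
    ∀ z A, 0 ≤ A → (∀ p, Pl (m * s) p → wt (m * s) Q p z ≤ A * ∫ w in ball 0 R, wt (m * s) Q p w) → β z ≤ A := by
  set d := m * s
  set W : EE m → ℝ := fun w => Real.exp (-(2 * d * Q.1 w))
  have Wc : Continuous W := by have := RS.ct Q; fun_prop
  have ec : ∀ α : Fin m → Fin (s + 1), Continuous (mon (m := m) α) := fun α => (mon_pl α).cont
  set g : (Fin m → Fin (s + 1)) → (Fin m → Fin (s + 1)) → EE m → ℂ := fun α β w => star (mon α w) * mon β w * W w
  have gi : ∀ α β, IntegrableOn (g α β) (ball 0 R) := fun α β => by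
    have : Continuous (g α β) := by have := ec α; have := ec β; fun_prop
    exact (this.continuousOn.integrableOn_compact (isCompact_closedBall (0 : EE m) R)).mono_set ball_subset_closedBall
  have wi : ∀ p : EE m → ℂ, Continuous p → IntegrableOn (wt d Q p) (ball 0 R) := fun p hp =>
    ((wt_cont d hp).continuousOn.integrableOn_compact (isCompact_closedBall (0 : EE m) R)).mono_set ball_subset_closedBall
  set G : Matrix (Fin m → Fin (s + 1)) (Fin m → Fin (s + 1)) ℂ := fun α β => ∫ w in ball 0 R, g α β w
  have hG : ∀ c, star c ⬝ᵥ (G *ᵥ c) = ((∫ w in ball 0 R, wt d Q (pc c) w : ℝ) : ℂ) := fun c => by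
    have e1 : ∀ w, ((wt d Q (pc c) w : ℝ) : ℂ) = ∑ α, ∑ β, star (c α) * c β * g α β w := fun w => by
      have : ((wt d Q (pc c) w : ℝ) : ℂ) = star (pc c w) * pc c w * W w := by
        simp only [wt]; push_cast; rw [RCLike.star_def, Complex.conj_mul']; simp [W]
      rw [this]; simp only [pc, star_sum, g, star_mul']
      rw [Finset.sum_mul_sum, Finset.sum_mul]
      refine Finset.sum_congr rfl fun α _ => ?_
      rw [Finset.sum_mul]
      exact Finset.sum_congr rfl fun β _ => by ring
    rw [← integral_complex_ofReal]
    simp only [e1]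
    rw [integral_finsetSum _ fun α _ => integrable_finsetSum _ fun β _ => (gi α β).const_mul _]
    simp only [dotProduct, mulVec, Finset.mul_sum]
    refine Finset.sum_congr rfl fun α _ => ?_
    rw [integral_finsetSum _ fun β _ => (gi α β).const_mul _]
    refine Finset.sum_congr rfl fun β _ => ?_
    rw [integral_const_mul]; simp only [G, Pi.star_apply]; ring
  have hP : G.PosDef := by
    refine PosDef.of_dotProduct_mulVec_pos ?_ fun c hc => ?_
    · ext α β
      rw [conjTranspose_apply]
      simp only [G, RCLike.star_def]
      rw [← integral_conj]
      congr 1; funext w; simp only [g, map_mul, RCLike.star_def, Complex.conj_conj, Complex.conj_ofReal]; ring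
    · rw [hG]
      have : 0 < ∫ w in ball 0 R, wt d Q (pc c) w := by
        have pcc : Continuous (pc (m := m) c) := (pc_pl c).cont
        rw [setIntegral_pos_iff_support_of_nonneg_ae (Eventually.of_forall fun w => by simp only [wt, Pi.zero_apply]; positivity) (wi _ pcc)]
        refine IsOpen.measure_pos _ (((wt_cont d pcc).isOpen_support).inter isOpen_ball) ?_
        obtain ⟨z, h1, h2⟩ := pc_ne hc hR
        refine ⟨z, ?_, by simpa using h1⟩
        rw [Function.mem_support, wt]; positivity
      exact_mod_cast this
  obtain ⟨B, hB⟩ := psd_root G hP.posSemidef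
  have hu : IsUnit B.det := by
    have := (Matrix.isUnit_iff_isUnit_det _).1 hP.isUnit
    rw [hB, det_mul] at this
    exact isUnit_of_mul_isUnit_right this
  have key : ∀ a, (∫ w in ball 0 R, wt d Q (pc (B⁻¹ *ᵥ a)) w) = ∑ j, ‖a j‖ ^ 2 := fun a => by
    have := hG (B⁻¹ *ᵥ a)
    rw [hB, mulVec_mulVec, Matrix.mul_assoc, mul_nonsing_inv B hu, Matrix.mul_one, star_mulVec, dotProduct_mulVec, vecMul_vecMul, ← conjTranspose_mul, mul_nonsing_inv B hu, conjTranspose_one, vecMul_one] at this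
    have h2 : star a ⬝ᵥ a = ((∑ j, ‖a j‖ ^ 2 : ℝ) : ℂ) := by
      push_cast
      refine Finset.sum_congr rfl fun i _ => ?_
      rw [Pi.star_apply, RCLike.star_def, Complex.conj_mul']
    rw [h2] at this
    exact_mod_cast this.symm
  set pj : (Fin m → Fin (s + 1)) → EE m → ℂ := fun j => pc (B⁻¹ *ᵥ Pi.single j 1)
  have pjc : ∀ j, Continuous (pj j) := fun j => (pc_pl _).cont
  have lin : ∀ a z, pc (B⁻¹ *ᵥ a) z = ∑ j, a j * pj j z := fun a z => by
    simp only [pj, pc, mulVec_single_one, mulVec, dotProduct, Finset.sum_mul, Finset.mul_sum, col_apply]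
    rw [Finset.sum_comm]
    exact Finset.sum_congr rfl fun α _ => Finset.sum_congr rfl fun β _ => by ring
  refine ⟨fun z => ∑ j, wt d Q (pj j) z, continuous_finsetSum _ fun j _ => wt_cont d (pjc j), fun z => Finset.sum_nonneg fun j _ => by unfold wt; positivity, ?_, fun z A hA h => ?_⟩
  · rw [integral_finsetSum _ fun j _ => wi _ (pjc j)]
    have : ∀ j, (∫ w in ball 0 R, wt d Q (pj j) w) = 1 := fun j => by
      rw [key, Finset.sum_eq_single j (fun i _ hi => by simp [hi]) (by simp)]; simp
    simp [this]
  · set S : ℝ := ∑ j, ‖pj j z‖ ^ 2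
    have e0 : ∑ j, wt d Q (pj j) z = S * W z := by simp only [wt, S, Finset.sum_mul, W]
    change ∑ j, wt d Q (pj j) z ≤ A
    rw [e0]
    have h1 := h _ (pc_pl (B⁻¹ *ᵥ fun j => star (pj j z)))
    rw [key, wt, lin] at h1
    have e1 : ∑ j, star (pj j z) * pj j z = (S : ℂ) := by
      simp only [S]; push_cast
      exact Finset.sum_congr rfl fun j _ => by rw [RCLike.star_def, Complex.conj_mul']
    have S0 : 0 ≤ S := Finset.sum_nonneg fun j _ => by positivity
    simp only [e1, norm_star, Complex.norm_of_nonneg S0] at h1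
    rcases S0.eq_or_lt with h0 | h0
    · rw [← h0]; simpa using hA
    · change S ^ 2 * W z ≤ A * S at h1
      nlinarith
end
end
section
variable {m : ℕ} {M k B : ℝ} {K O : Set (EE m)} {Q : RS m}
lemma glob (h : QH M K O Q k) (hM : 0 ≤ M) (hK : PBW M K) (hKO : K ⊆ O) {R : ℝ} (hO : ∀ z ∈ O, ‖z‖ + 1 < R) {C : ℝ} (hC : ∀ y : EE m, krn y ≤ C)
    {d : ℕ} (hd : 1 ≤ d) {p : EE m → ℂ} (hp : Pl d p) (z : EE m) :
    wt d Q p z ≤ C * Real.exp (2 * k) * (d : ℝ) ^ m * Real.exp (-(2 * d * (Q.1 z - gE Q.1 z))) * ∫ w in ball 0 R, wt d Q p w := by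
  set I := ∫ w in ball 0 R, wt d Q p w
  have I0 : 0 ≤ I := integral_nonneg fun w => by simp only [wt, Pi.zero_apply]; positivity
  have C0 : 0 ≤ C := (krn_nonneg 0).trans (hC 0)
  set A := C * Real.exp (2 * k) * (d : ℝ) ^ m * I
  have A0 : 0 ≤ A := by positivity
  have hd' : (0:ℝ) < d := by exact_mod_cast hd
  suffices hs : ‖p z‖ ^ 2 ≤ A * Real.exp (2 * d * gE Q.1 z) by
    rw [wt, show -(2 * d * (Q.1 z - gE Q.1 z)) = 2 * d * gE Q.1 z + -(2 * d * Q.1 z) by ring, Real.exp_add]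
    calc _ ≤ A * Real.exp (2 * d * gE Q.1 z) * Real.exp (-(2 * d * Q.1 z)) := mul_le_mul_of_nonneg_right hs (by positivity)
      _ = _ := by simp only [A]; ring
  rw [← div_le_iff₀ (by positivity)]
  refine le_of_forall_gt_imp_ge_of_dense fun A' hA' => ?_
  rw [div_le_iff₀ (by positivity)]
  have A'0 : 0 < A' := A0.trans_lt hA'
  set r := Real.sqrt A'
  have r0 : 0 < r := Real.sqrt_pos.2 A'0
  have r2 : r ^ 2 = A' := Real.sq_sqrt A'0.le
  set q : EE m → ℂ := fun w => ((r : ℂ))⁻¹ * p w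
  have nq : ∀ w, ‖q w‖ = ‖p w‖ / r := fun w => by simp [q, abs_of_pos r0]; ring
  have hq : Pl d q := by simpa [q] using (Pl.const ((r : ℂ))⁻¹ 0).mul hp
  have onO : ∀ w ∈ O, ‖q w‖ ≤ Real.exp (d * Q.1 w) := fun w hw => by
    have e := (crude h hC hd hp.diff (hO w hw)).trans hA'.le
    rw [wt, Real.exp_neg, ← div_eq_mul_inv, div_le_iff₀ (by positivity)] at e
    rw [nq, div_le_iff₀ r0]
    refine le_of_sq_le_sq (e.trans_eq ?_) (by positivity)
    rw [mul_pow, r2, ← Real.exp_nat_mul, mul_comm]; congr 2; push_cast; ring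
  have hA : Adm Q.1 d q := ⟨hd, hq, fun w => by
    by_cases hw : w ∈ O
    · exact onO w hw
    · have e1 := hK.le hM hd hq (fun x hx => by simpa [h.zero x hx] using onO x (hKO hx)) w
      have e2 := h.off w hw
      rw [lgm, div_le_iff₀ hd'] at e1
      have e3 : Real.log (max 1 ‖q w‖) ≤ d * Q.1 w := by nlinarith
      rw [Real.log_le_iff_le_exp (lt_max_of_lt_left one_pos)] at e3
      exact (le_max_right _ _).trans e3⟩
  have e1 := le_g h.nn hA z
  rw [lgm, div_le_iff₀ hd', Real.log_le_iff_le_exp (lt_max_of_lt_left one_pos)] at e1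
  have e2 := (le_max_right _ _).trans e1
  rw [nq, div_le_iff₀ r0] at e2
  have e3 := pow_le_pow_left₀ (norm_nonneg _) e2 2
  refine e3.trans_eq ?_
  rw [mul_pow, r2, ← Real.exp_nat_mul, mul_comm]; congr 2; push_cast; ring
lemma berg_low (hm : 1 ≤ m) (h : QH M K O Q k) (hM : 0 ≤ M) (hK : PBW M K) (hKO : K ⊆ O) {r : ℝ} (hO : O ⊆ closedBall 0 r) {C : ℝ} (hC : ∀ y : EE m, krn y ≤ C) :
    1 / (m : ℝ) ^ m ≤ C * Real.exp 2 * ∫ z in {z | gE Q.1 z = Q.1 z}, MA (Q + (1/4:ℝ) • nsq) z := by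
  have hg := h.gGC hM hK
  set D := {z | gE Q.1 z = Q.1 z}
  have hDO : D ⊆ O := h.DO hg
  have hD : MeasurableSet D := measurableSet_eq_fun hg.lb.meas (RS.ct Q).measurable
  set F := MA (Q + (1/4:ℝ) • nsq)
  have hF0 : ∀ z ∈ D, 0 ≤ F z := fun z hz => (Complex.le_def.1 (h.pd hg.lb hg.sub hz).det_pos.le).1
  set R := |r| + 2
  have hOR : ∀ z ∈ O, ‖z‖ + 1 < R := fun z hz => by
    have : ‖z‖ ≤ r := by simpa using hO hz
    linarith [le_abs_self r]
  have hDR : D ⊆ ball 0 R := fun z hz => by have := hOR z (hDO hz); rw [mem_ball_zero_iff]; linarith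
  have C0 : 0 ≤ C := (krn_nonneg 0).trans (hC 0)
  choose β βc β0 βi βm using fun s : ℕ => bergman (Q := Q) (s + 1) (R := R) (by positivity)
  set E : ℝ := C * Real.exp 2
  set C1 := C * Real.exp (2 * k)
  set dd : ℕ → ℕ := fun s => m * (s + 1)
  have dd1 : ∀ s, 1 ≤ dd s := fun s => Nat.mul_pos hm (Nat.succ_pos s)
  have dp : ∀ s, (0:ℝ) < (dd s : ℝ) ^ m := fun s => pow_pos (by exact_mod_cast dd1 s) m
  have dlim : Tendsto dd atTop atTop := tendsto_atTop_mono (fun s => (Nat.le_succ s).trans (Nat.le_mul_of_pos_left _ hm)) tendsto_id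
  have b1 : ∀ s z, β s z / (dd s : ℝ) ^ m ≤ C1 * Real.exp (-(2 * dd s * (Q.1 z - gE Q.1 z))) := fun s z => by
    rw [div_le_iff₀ (dp s)]
    refine βm s z _ (by positivity) fun p hp => (glob h hM hK hKO hOR hC (dd1 s) hp z).trans_eq ?_
    simp only [C1, dd]; ring
  have b2 : ∀ z ∈ D, ∀ᶠ s in atTop, β s z / (dd s : ℝ) ^ m ≤ E * F z := fun z hz => by
    filter_upwards [dlim.eventually (sharp h hg hC hz (hOR z (hDO hz)))] with s hs
    rw [div_le_iff₀ (dp s)]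
    refine βm s z _ (by have := hF0 z hz; positivity) fun p hp => (hs p hp.diff).trans_eq ?_
    simp only [E, F, dd]; ring
  set f : ℕ → EE m → ℝ := fun s z => max (β s z / (dd s : ℝ) ^ m - E * D.indicator F z) 0
  have ci : ∀ {g : EE m → ℝ}, Continuous g → IntegrableOn g (ball 0 R) := fun {g} hg =>
    (hg.continuousOn.integrableOn_compact (isCompact_closedBall (0 : EE m) R)).mono_set ball_subset_closedBall
  have iF : IntegrableOn (D.indicator F) (ball 0 R) := (ci (MA_cont _)).indicator hD
  have ib : ∀ s, IntegrableOn (fun z => β s z / (dd s : ℝ) ^ m) (ball 0 R) := fun s => ci ((βc s).div_const _)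
  have iff' : ∀ s, IntegrableOn (fun z => β s z / (dd s : ℝ) ^ m - E * D.indicator F z) (ball 0 R) := fun s => (ib s).sub (iF.const_mul E)
  have lim : Tendsto (fun s => ∫ z in ball 0 R, f s z) atTop (𝓝 (∫ z in ball (0 : EE m) R, (0:ℝ))) := by
    refine tendsto_integral_of_dominated_convergence (fun _ => C1) (fun s => ((iff' s).sup (integrable_zero _ _ _)).aestronglyMeasurable) (ci continuous_const) (fun s => Eventually.of_forall fun z => ?_) (Eventually.of_forall fun z => ?_)
    · rw [Real.norm_of_nonneg (le_max_right _ _)]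
      refine max_le ?_ (by positivity)
      have e1 := b1 s z
      have e2 : Real.exp (-(2 * dd s * (Q.1 z - gE Q.1 z))) ≤ 1 := Real.exp_le_one_iff.2 (neg_nonpos.2 (mul_nonneg (by positivity) (sub_nonneg.2 (h.g_le_Q z))))
      have e3 : 0 ≤ E * D.indicator F z := mul_nonneg (by positivity) (indicator_nonneg hF0 z)
      have : 0 ≤ C1 := by positivity
      nlinarith
    · by_cases hz : z ∈ D
      · refine tendsto_const_nhds.congr' ?_
        filter_upwards [b2 z hz] with s hs
        simp only [f, indicator_of_mem hz]
        rw [max_eq_right (by linarith)]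
      · have hpos : 0 < Q.1 z - gE Q.1 z := sub_pos.2 (lt_of_le_of_ne (h.g_le_Q z) hz)
        have l1 : Tendsto (fun s => C1 * Real.exp (-(2 * dd s * (Q.1 z - gE Q.1 z)))) atTop (𝓝 (C1 * 0)) := by
          refine (Real.tendsto_exp_neg_atTop_nhds_zero.comp ?_).const_mul C1
          exact ((tendsto_natCast_atTop_atTop.comp dlim).const_mul_atTop two_pos).atTop_mul_const hpos
        rw [mul_zero] at l1
        refine squeeze_zero (fun s => le_max_right _ _) (fun s => ?_) l1
        simp only [f, indicator_of_notMem hz, mul_zero, sub_zero]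
        exact max_le (b1 s z) (by positivity)
  rw [integral_zero] at lim
  have low : ∀ s, 1 / (m : ℝ) ^ m - E * ∫ z in D, F z ≤ ∫ z in ball 0 R, f s z := fun s => by
    have e1 : ∫ z in ball 0 R, (β s z / (dd s : ℝ) ^ m - E * D.indicator F z) = ((s:ℝ) + 1 + 1) ^ m / (dd s : ℝ) ^ m - E * ∫ z in D, F z := by
      rw [integral_sub (ib s) (iF.const_mul E), integral_div, integral_const_mul, setIntegral_indicator hD, inter_eq_self_of_subset_right hDR, βi]
      push_cast; rfl
    have e2 : 1 / (m : ℝ) ^ m ≤ ((s:ℝ) + 1 + 1) ^ m / (dd s : ℝ) ^ m := by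
      have m0 : (0:ℝ) < m := by exact_mod_cast hm
      rw [div_le_div_iff₀ (by positivity) (dp s), one_mul, ← mul_pow]
      refine pow_le_pow_left₀ (by positivity) ?_ m
      simp only [dd]; push_cast; nlinarith
    calc _ ≤ _ := sub_le_sub_right e2 _
      _ = _ := e1.symm
      _ ≤ _ := integral_mono (iff' s) ((iff' s).sup (integrable_zero _ _ _)) fun z => le_max_left _ _
  have := ge_of_tendsto' lim low
  linarith
theorem mass_low (hm : 1 ≤ m) : ∃ c0 : ℝ, 0 < c0 ∧ ∀ (M B r : ℝ) (K O : Set (EE m)), 0 ≤ M → 0 ≤ B → IsCompact K → PBW M K → IsOpen O → K ⊆ O →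
    O ⊆ closedBall 0 r → (∀ x ∈ K, ‖x‖ ^ 2 + 1 < B) → ∃ φ, PP (RR (M + 1) B) (MM (M + 1) B) (pB B) φ ∧ c0 ≤ ∫ z in O, MA φ z := by
  obtain ⟨C, C0, hC⟩ := krn_up (m := m)
  have m0 : (0:ℝ) < m := by exact_mod_cast hm
  refine ⟨1 / (m : ℝ) ^ m / (C * Real.exp 2) / 2, by positivity, fun M B r K O hM hB hKc hK hO hKO hOr hKB => ?_⟩
  set O' := O ∩ {z | ‖z‖ ^ 2 + 1 < B}
  have hO' : IsOpen O' := hO.inter (isOpen_lt (by fun_prop) continuous_const)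
  have hKO' : K ⊆ O' := fun x hx => ⟨hKO hx, hKB x hx⟩
  have hOr' : O' ⊆ closedBall 0 r := inter_subset_left.trans hOr
  obtain ⟨Q, k, h⟩ := exQ hKc hO' hKO' hOr' hM
  have b := berg_low hm h hM hK hKO' hOr' hC
  rw [← div_le_iff₀' (by positivity)] at b
  have p0 : 0 < 1 / (m : ℝ) ^ m / (C * Real.exp 2) := by positivity
  obtain ⟨φ, h1, h2⟩ := h.mass hM (h.gGC hM hK) hB (fun z hz => hz.2) (c := 1 / (m : ℝ) ^ m / (C * Real.exp 2) / 2) (by linarith)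
  refine ⟨φ, h1, h2.trans ?_⟩
  exact setIntegral_mono_set (((MA_cont φ).continuousOn.integrableOn_compact (isCompact_closedBall (0 : EE m) r)).mono_set hOr)
    (Eventually.of_forall h1.pd.ma) (Eventually.of_forall inter_subset_left)
end
section
variable {m : ℕ}
def serS (Q : ℕ → MvPolynomial (Fin m) ℂ) : MvPowerSeries (Fin (m + 1)) ℂ :=
  fun I => MvPolynomial.coeff (Finsupp.tail I) (Q (∑ i, I i))
lemma serS_term (Q : ℕ → MvPolynomial (Fin m) ℂ) (k : ℕ) {I : Fin (m + 1) → ℕ} (hI : I ∈ Finset.Nat.antidiagonalTuple (m + 1) k) :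
    MvPowerSeries.coeff (Finsupp.equivFunOnFinite.symm I) (serS Q) = MvPolynomial.coeff (Finsupp.equivFunOnFinite.symm (Fin.tail I)) (Q k) := by
  rw [Finset.Nat.mem_antidiagonalTuple] at hI
  change MvPolynomial.coeff (Finsupp.tail (Finsupp.equivFunOnFinite.symm I)) (Q (∑ i, (Finsupp.equivFunOnFinite.symm I) i)) = _
  simp only [Finsupp.equivFunOnFinite_symm_apply_apply, hI]
  rfl
lemma tdeg_sum {q : MvPolynomial (Fin m) ℂ} {s : Fin m →₀ ℕ} (hs : q.coeff s ≠ 0) : ∑ i, s i ≤ q.totalDegree := by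
  have := MvPolynomial.le_totalDegree (MvPolynomial.mem_support_iff.2 hs)
  rwa [Finsupp.sum_fintype _ _ (fun _ => rfl)] at this
lemma line_ne {Q : ℕ → MvPolynomial (Fin m) ℂ} {k : ℕ} (hk : (Q k).totalDegree ≤ k) (v : EE (m + 1)) (hv : v 0 ≠ 0) :
    lineCoeff (serS Q) v k = v 0 ^ k * MvPolynomial.eval (fun j => v j.succ / v 0) (Q k) := by
  rw [lineCoeff, MvPolynomial.eval_eq', Finset.mul_sum]
  symm
  have dg : ∀ s ∈ (Q k).support, ∑ i, s i ≤ k := fun s hs => (tdeg_sum (MvPolynomial.mem_support_iff.1 hs)).trans hk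
  refine Finset.sum_of_injOn (fun s : Fin m →₀ ℕ => (Fin.cons (k - ∑ i, s i) s : Fin (m + 1) → ℕ)) ?_ ?_ ?_ ?_
  · intro s _ t _ h
    exact DFunLike.coe_injective (Fin.cons_injective2 h).2
  · intro s hs
    rw [Finset.mem_coe, Finset.Nat.mem_antidiagonalTuple, Fin.sum_cons, Nat.sub_add_cancel (dg s hs)]
  · intro I hI hn
    rw [serS_term Q k hI]
    have : MvPolynomial.coeff (Finsupp.equivFunOnFinite.symm (Fin.tail I)) (Q k) = 0 := by
      by_contra h
      refine hn ⟨_, Finset.mem_coe.2 (MvPolynomial.mem_support_iff.2 h), ?_⟩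
      rw [Finset.Nat.mem_antidiagonalTuple, Fin.sum_univ_succ] at hI
      conv_rhs => rw [← Fin.cons_self_tail I]
      simp only [Finsupp.equivFunOnFinite_symm_apply_apply, Fin.tail]
      congr 1
      omega
    rw [this, zero_mul]
  · intro s hs
    rw [serS_term Q k (by rw [Finset.Nat.mem_antidiagonalTuple, Fin.sum_cons, Nat.sub_add_cancel (dg s hs)])]
    have e : Finsupp.equivFunOnFinite.symm (Fin.tail (Fin.cons (k - ∑ i, s i) s : Fin (m + 1) → ℕ)) = s := by ext; simp
    rw [e, Fin.prod_univ_succ]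
    simp only [Fin.cons_zero, Fin.cons_succ, div_pow, Finset.prod_div_distrib, Finset.prod_pow_eq_pow_sum]
    rw [mul_left_comm]
    congr 1
    rw [mul_div_assoc', div_eq_iff (pow_ne_zero _ hv), mul_right_comm, ← pow_add, Nat.sub_add_cancel (dg s hs)]
lemma line_zero {Q : ℕ → MvPolynomial (Fin m) ℂ} {k : ℕ} (hk : Q k = 0 ∨ (Q k).totalDegree < k) (v : EE (m + 1)) (hv : v 0 = 0) :
    lineCoeff (serS Q) v k = 0 := by
  refine Finset.sum_eq_zero fun I hI => ?_
  rw [serS_term Q k hI]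
  rcases eq_or_ne (I 0) 0 with h | h
  · rcases hk with hk | hk
    · simp [hk]
    · rw [Finset.Nat.mem_antidiagonalTuple, Fin.sum_univ_succ, h, zero_add] at hI
      by_cases hc : MvPolynomial.coeff (Finsupp.equivFunOnFinite.symm (Fin.tail I)) (Q k) = 0
      · simp [hc]
      · have := tdeg_sum hc
        simp only [Finsupp.equivFunOnFinite_symm_apply_apply, Fin.tail] at this
        omega
  · rw [Finset.prod_eq_zero (Finset.mem_univ 0) (by rw [hv, zero_pow h]), mul_zero]
lemma nPBW {M : ℝ} {K : Set (EE m)} (h : ¬ PBW M K) : ∃ d, 1 ≤ d ∧ ∃ f : EE m → ℂ, Pl d f ∧ (∀ x ∈ K, ‖f x‖ ≤ 1) ∧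
    ∃ z, ‖z‖ ≤ 1 ∧ Real.exp (d * M) < ‖f z‖ := by
  simp only [PBW, not_forall, not_le] at h
  obtain ⟨d, f, hf, hK, z, hz, hl⟩ := h
  rcases Nat.eq_zero_or_pos d with rfl | hd
  · obtain ⟨p, hp, rfl⟩ := hf
    rw [Nat.le_zero, MvPolynomial.totalDegree_eq_zero_iff_eq_C] at hp
    rw [hp] at hK hl
    simp only [MvPolynomial.eval_C, CharP.cast_eq_zero, zero_mul, Real.exp_zero] at hK hl
    refine ⟨1, le_rfl, fun _ => ((Real.exp M + 1 : ℝ) : ℂ), Pl.const _ _, fun x hx => absurd (hK x hx) (not_le.2 hl), 0, by simp, ?_⟩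
    rw [Complex.norm_real, Real.norm_of_nonneg (by positivity)]
    simp
  · exact ⟨d, hd, f, hf, hK, z, hz, hl⟩
theorem ser_main {F : Set (EE (m + 1))} {c : ℕ → Set (EE m)}
    (hc : dirSet F = ⋃ k, c k) (hn : ∀ j : ℕ, ¬ PBW j ((⋃ k ∈ Finset.range (j + 1), c k) ∩ closedBall 0 j)) :
    ∃ S : MvPowerSeries (Fin (m + 1)) ℂ, (∀ v ∈ F, HasPosRadius (lineCoeff S v)) ∧ ¬ ConvUnifNearZero S := by
  set K : ℕ → Set (EE m) := fun j => (⋃ k ∈ Finset.range (j + 1), c k) ∩ closedBall 0 j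
  have key : ∀ j, ∃ᶠ D in atTop, ∃ q : MvPolynomial (Fin m) ℂ, q.totalDegree < D ∧ (∀ x ∈ K j, ‖MvPolynomial.eval (fun i => x i) q‖ ≤ 1) ∧
      ∃ z : EE m, ‖z‖ ≤ 1 ∧ Real.exp (((D : ℝ) - 1) * j) < ‖MvPolynomial.eval (fun i => z i) q‖ := fun j => by
    obtain ⟨d, hd, f, hf, hK, z, hz, hl⟩ := nPBW (hn j)
    refine frequently_atTop.2 fun N => ⟨(N + 1) * d + 1, by nlinarith, ?_⟩
    obtain ⟨q, hq, e⟩ := hf.pow (N + 1)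
    have e' := fun z => congrFun e z
    refine ⟨q, by omega, fun x hx => ?_, z, hz, ?_⟩
    · rw [← e' x, norm_pow]; exact pow_le_one₀ (norm_nonneg _) (hK x hx)
    · rw [← e' z, norm_pow]
      refine lt_of_eq_of_lt ?_ (pow_lt_pow_left₀ hl (Real.exp_pos _).le N.succ_ne_zero)
      rw [← Real.exp_nat_mul]; push_cast; ring_nf
  obtain ⟨φ, hφ, h⟩ := extraction_forall_of_frequently key
  choose q hq hK x hx hl using h
  set Q : ℕ → MvPolynomial (Fin m) ℂ := Function.extend φ q 0
  have Qφ : ∀ j, Q (φ j) = q j := fun j => hφ.injective.extend_apply q _ j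
  have Q0 : ∀ k, (¬ ∃ j, φ j = k) → Q k = 0 := fun k hk => Function.extend_apply' q _ k hk
  have hQ : ∀ k, Q k = 0 ∨ (Q k).totalDegree < k := fun k => by
    by_cases hk : ∃ j, φ j = k
    · obtain ⟨j, rfl⟩ := hk
      right; rw [Qφ]; exact hq j
    · exact Or.inl (Q0 k hk)
  have hQ' : ∀ k, (Q k).totalDegree ≤ k := fun k => by
    rcases hQ k with h | h
    · simp [h]
    · exact h.le
  refine ⟨serS Q, fun v hv => ?_, ?_⟩
  · by_cases h0 : v 0 = 0
    · refine ⟨1, one_pos, ?_⟩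
      simp only [line_zero (hQ _) v h0, norm_zero, zero_mul]
      exact summable_zero
    set w : EE m := WithLp.toLp 2 (fun j : Fin m => v j.succ / v 0)
    have hw : w ∈ dirSet F := mem_iUnion.2 ⟨0, v, hv, h0, fun j => by simp [w]⟩
    rw [hc, mem_iUnion] at hw
    obtain ⟨k0, hk0⟩ := hw
    obtain ⟨j0, hj0⟩ := exists_nat_ge ‖w‖
    have hwK : ∀ j, max k0 j0 ≤ j → w ∈ K j := fun j hj => by
      refine ⟨mem_biUnion (Finset.mem_coe.2 (Finset.mem_range.2 (by omega : k0 < j + 1))) hk0, ?_⟩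
      rw [mem_closedBall_zero_iff]
      exact hj0.trans (by exact_mod_cast (le_max_right _ _).trans hj)
    have n0 : 0 < ‖v 0‖ := norm_pos_iff.2 h0
    refine ⟨1 / (2 * ‖v 0‖), by positivity, ?_⟩
    refine summable_geometric_two.of_norm_bounded_eventually_nat ?_
    filter_upwards [eventually_ge_atTop (φ (max k0 j0))] with k hk
    have e1 : ‖MvPolynomial.eval (fun j : Fin m => v j.succ / v 0) (Q k)‖ ≤ 1 := by
      by_cases hj : ∃ j, φ j = k
      · obtain ⟨j, rfl⟩ := hj
        rw [Qφ]
        exact hK j w (hwK j (hφ.le_iff_le.1 hk))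
      · simp [Q0 k hj]
    rw [line_ne (hQ' k) v h0, Real.norm_of_nonneg (by positivity), norm_mul, norm_pow, one_div, mul_inv, mul_pow, one_div]
    have e2 : ‖v 0‖ ^ k * (‖v 0‖⁻¹) ^ k = 1 := by rw [← mul_pow, mul_inv_cancel₀ n0.ne', one_pow]
    calc _ = (‖v 0‖ ^ k * (‖v 0‖⁻¹) ^ k) * (2⁻¹ ^ k * ‖MvPolynomial.eval (fun j : Fin m => v j.succ / v 0) (Q k)‖) := by ring
      _ ≤ _ := by rw [e2, one_mul]; exact mul_le_of_le_one_right (by positivity) e1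
  · rintro ⟨r, hr, g, hg⟩
    have hg := Metric.tendstoUniformlyOn_iff.1 hg (1/2) (by norm_num)
    obtain ⟨N, hN⟩ := eventually_atTop.1 hg
    set t := r / 4
    have t0 : 0 < t := by positivity
    have : ∀ᶠ j : ℕ in atTop, 1 ≤ t * Real.exp ((j:ℝ) / 2) := by
      have : Tendsto (fun j : ℕ => t * Real.exp ((j:ℝ) / 2)) atTop atTop :=
        (Real.tendsto_exp_atTop.comp (tendsto_natCast_atTop_atTop.atTop_div_const two_pos)).const_mul_atTop t0
      exact this.eventually_ge_atTop 1
    obtain ⟨j, hj, hj2⟩ := (this.and (eventually_ge_atTop (N + 2))).exists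
    have kj : j ≤ φ j := hφ.le_apply
    set k := φ j
    set z : EE (m + 1) := WithLp.toLp 2 (Fin.cons (t : ℂ) fun i => (t : ℂ) * x j i)
    have z0 : z 0 = t := rfl
    have zs : ∀ i, z (Fin.succ i) = t * x j i := fun i => rfl
    have hz : z ∈ ball (0 : EE (m + 1)) r := by
      rw [mem_ball_zero_iff]
      have e : ‖z‖ ^ 2 = t ^ 2 + t ^ 2 * ‖x j‖ ^ 2 := by
        rw [EuclideanSpace.norm_sq_eq, EuclideanSpace.norm_sq_eq, Fin.sum_univ_succ, Finset.mul_sum]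
        simp [z0, zs, mul_pow]
      have : ‖z‖ ^ 2 ≤ (2 * t) ^ 2 := by
        rw [e]
        have := hx j
        have : ‖x j‖ ^ 2 ≤ 1 := pow_le_one₀ (norm_nonneg _) this
        nlinarith [sq_nonneg t]
      have := abs_le_of_sq_le_sq this (by positivity)
      have := (abs_le.1 (abs_le_of_sq_le_sq ‹‖z‖ ^ 2 ≤ (2 * t) ^ 2› (by positivity))).2
      simp only [t] at this ⊢
      linarith
    have d1 := hN k (by omega) z hz
    have d2 := hN (k + 1) (by omega) z hz
    have e : partialSum (serS Q) (k + 1) z - partialSum (serS Q) k z = lineCoeff (serS Q) z k := by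
      rw [partialSum, Finset.sum_range_succ, partialSum, add_sub_cancel_left, lineCoeff]
    have d3 : ‖lineCoeff (serS Q) z k‖ < 1 := by
      rw [← e, ← dist_eq_norm]
      have := dist_triangle_left (partialSum (serS Q) (k + 1) z) (partialSum (serS Q) k z) (g z)
      linarith
    have tc : (t : ℂ) ≠ 0 := by exact_mod_cast t0.ne'
    rw [line_ne (hQ' k) z (by rw [z0]; exact tc)] at d3
    have : (fun i : Fin m => z i.succ / z 0) = fun i => x j i := by
      funext i; rw [z0, zs, mul_div_cancel_left₀ _ tc]
    rw [this, Qφ, z0, norm_mul, norm_pow, Complex.norm_real, Real.norm_of_nonneg t0.le] at d3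
    have e3 : (1:ℝ) ≤ t ^ k * Real.exp (((k : ℝ) - 1) * j) := by
      calc (1:ℝ) ≤ (t * Real.exp ((j:ℝ) / 2)) ^ k := one_le_pow₀ hj
        _ = t ^ k * Real.exp (k * ((j:ℝ) / 2)) := by rw [mul_pow, Real.exp_nat_mul]
        _ ≤ _ := by
          refine mul_le_mul_of_nonneg_left (Real.exp_le_exp.2 ?_) (by positivity)
          have : (2:ℝ) ≤ k := by exact_mod_cast (by omega : 2 ≤ k)
          have : (0:ℝ) ≤ j := by positivity
          nlinarith
    have := mul_lt_mul_of_pos_left (hl j) (pow_pos t0 k)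
    linarith
end
section
variable {m : ℕ}
def Fam (Y : Set (EE m)) (f : EE m → ℝ) : Prop := InLs 1 f ∧ (∀ z, 0 ≤ f z) ∧ ∀ x ∈ Y, f x = 0
lemma zero_lelong : (fun _ : EE m => (0 : EReal)) ∈ LelongClass m := by
  refine ⟨⟨upperSemicontinuous_const, ⟨0, by simp⟩, fun _ => by simp, fun a b r _ => ?_⟩, 0, fun z => ?_⟩
  · simp [circleLineMean, erealIntegral, erealToENNReal]
  · rw [zero_add]; exact EReal.coe_nonneg.2 (log1_nonneg z)
lemma nreg {E : Set (EE m)} {a : EE m} (h : ¬ LRegularAt E a) :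
    ∃ n : ℕ, ∀ δ > 0, ∃ z, dist z a < δ ∧ ∃ f, Fam E f ∧ 1 / ((n : ℝ) + 1) ≤ f z := by
  have h0 : ∀ z, 0 ≤ extremalFn E z := fun z => le_sSup ⟨_, zero_lelong, fun _ _ => le_rfl, rfl⟩
  have h1 : 0 ≤ extremalFnStar E a := by
    rw [extremalFnStar, ← limsup_const (f := 𝓝 a) (0 : EReal)]
    exact limsup_le_limsup (Eventually.of_forall h0)
  obtain ⟨c, c0, hc⟩ := EReal.lt_iff_exists_real_btwn.1 (lt_of_le_of_ne h1 (Ne.symm h))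
  have c0 : 0 < c := by exact_mod_cast c0
  obtain ⟨n, hn⟩ := exists_nat_one_div_lt c0
  refine ⟨n, fun δ hδ => ?_⟩
  have := (frequently_lt_of_lt_limsup (by isBoundedDefault) hc).and_eventually (ball_mem_nhds a hδ)
  obtain ⟨z, hz, hd⟩ := this.exists
  obtain ⟨_, ⟨u, hu, hE, rfl⟩, hl⟩ := lt_sSup_iff.1 hz
  obtain ⟨i1, i2⟩ := lelong_max hu
  refine ⟨z, hd, _, ⟨i1, fun z => ?_, fun x hx => ?_⟩, ?_⟩
  · have := i2 z ▸ le_max_right (u z) 0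
    exact_mod_cast this
  · simp [max_eq_right (hE x hx)]
  · have : (c : EReal) ≤ ((max (u z) 0).toReal : EReal) := by rw [i2]; exact hl.le.trans (le_max_left _ _)
    exact hn.le.trans (by exact_mod_cast this)
lemma Fam.gc {Y : Set (EE m)} {f : EE m → ℝ} (h : Fam Y f) {M T A : ℝ} (hM : ∀ z ∈ ball (0 : EE m) 1, f z ≤ M) (hT : 1 ≤ T) (hA : M + 1 ≤ T * A) :
    GC A (fun z => T⁻¹ * f z) ∧ UpperSemicontinuous (fun z => T⁻¹ * f z) ∧ ∀ x ∈ Y, T⁻¹ * f x = 0 := by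
  have T0 : 0 < T := by linarith
  have i := h.1.smul (t := T⁻¹) (by positivity)
  refine ⟨⟨i.lb, i.sub, fun z => mul_nonneg (by positivity) (h.2.1 z), fun z => ?_⟩, i.usc, fun x hx => by rw [h.2.2 x hx, mul_zero]⟩
  rw [inv_mul_le_iff₀ T0]
  nlinarith [BW1 h.1 hM z, log1_nonneg z]
lemma BWa (a : EE m) {s : ℝ} (hs : 0 < s) : ∃ C : ℝ, 0 ≤ C ∧ ∀ f : EE m → ℝ, InLs 1 f → ∀ M, (∀ z, dist z a ≤ s → f z ≤ M) → ∀ z ∈ ball (0 : EE m) 1, f z ≤ M + C := by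
  have p : 0 ≤ (1 + ‖a‖) / s := by positivity
  have l0 : 0 ≤ Real.log (1 + (1 + ‖a‖) / s) := Real.log_nonneg (by linarith)
  refine ⟨_, l0, fun f h M hM z hz => ?_⟩
  rcases le_total (dist z a) s with hd | hd
  · linarith [hM z hd]
  · have hd' : s ≤ ‖z - a‖ := by rwa [← dist_eq_norm]
    have := BW (h.comp zero_le_one a) hs (M := M) (fun w hw => hM _ (by simp [dist_eq_norm, hw])) hd'
    rw [sub_add_cancel] at this
    refine this.trans (add_le_add le_rfl (Real.log_le_log (div_pos (hs.trans_le hd') hs) ?_))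
    rw [mem_ball_zero_iff] at hz
    have : ‖z - a‖ / s ≤ (1 + ‖a‖) / s := by
      gcongr; linarith [norm_sub_le z a]
    linarith
def Xs (Y : Set (EE m)) (B : ℝ) (n : ℕ) : Set (EE m) :=
  {a | a ∈ Y ∧ ‖a‖ ^ 2 + 1 < B ∧ ∀ δ > 0, ∃ z, dist z a < δ ∧ ∃ f, Fam Y f ∧ 1 / ((n : ℝ) + 1) ≤ f z}
lemma cov (Y : Set (EE m)) {A B : ℝ} (n : ℕ) (hA : 1 ≤ A) (hB : 0 ≤ B) {η : ℝ} (hη : 0 < η) :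
    ∃ O : Set (EE m), IsOpen O ∧ Xs Y B n ⊆ O ∧ O ⊆ closedBall 0 (RR A B) ∧
      ∀ φ, PP (RR A B) (MM A B) (pB B) φ → ∫ z in O, MA φ z ≤ η := by
  have A0 : 0 ≤ A := by linarith
  by_cases hb : ∃ M, ∀ f, Fam Y f → ∀ z ∈ ball (0 : EE m) 1, f z ≤ M
  · obtain ⟨M, hM⟩ := hb
    set T := |M| + 1
    have hT : 1 ≤ T := by simp [T]
    have T0 : 0 < T := by linarith
    refine null_lemma A0 hB (X := Xs Y B n) (fun x hx => hx.2.1) (ε := T⁻¹ * (1 / ((n : ℝ) + 1))) (by positivity) (fun a ha δ hδ => ?_) hη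
    obtain ⟨z, hz, f, hf, hl⟩ := ha.2.2 δ hδ
    obtain ⟨g1, g2, g3⟩ := hf.gc (hM f hf) hT (A := A) (by have := le_abs_self M; simp only [T]; nlinarith [abs_nonneg M])
    exact ⟨z, hz, _, ⟨g1, g2, fun x hx => g3 x hx.1⟩, by gcongr⟩
  · push Not at hb
    refine null_lemma A0 hB (X := Xs Y B n) (fun x hx => hx.2.1) (ε := 1 / 8) (by positivity) (fun a ha δ hδ => ?_) hη
    obtain ⟨C, C0, hC⟩ := BWa a (half_pos hδ)
    obtain ⟨f, hf, z1, hz1, hl⟩ := hb (4 * C + 4)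
    obtain ⟨D, hD⟩ := hf.1.up
    have bd : BddAbove (f '' ball 0 1) := by
      refine ⟨D + 1 * Real.log (1 + 1), ?_⟩
      rintro _ ⟨z, hz, rfl⟩
      exact (hD z).trans (by have := log1_mono (mem_ball_zero_iff.1 hz).le; linarith)
    set M := sSup (f '' ball 0 1)
    have hM : ∀ z ∈ ball (0 : EE m) 1, f z ≤ M := fun z hz => le_csSup bd (mem_image_of_mem _ hz)
    have M1 : 4 * C + 4 < M := hl.trans_le (hM z1 hz1)
    obtain ⟨z, hz, hz2⟩ : ∃ z, dist z a ≤ δ / 2 ∧ M / 4 < f z := by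
      by_contra! hcon
      have : M ≤ M / 4 + C := by
        refine csSup_le ⟨_, mem_image_of_mem _ hz1⟩ ?_
        rintro _ ⟨z, hz, rfl⟩
        exact hC f hf.1 (M / 4) hcon z hz
      linarith
    obtain ⟨g1, g2, g3⟩ := hf.gc hM (T := 2 * M) (by linarith) (A := A) (by nlinarith)
    refine ⟨z, by linarith, _, ⟨g1, g2, fun x hx => g3 x hx.1⟩, ?_⟩
    rw [inv_mul_eq_div, le_div_iff₀ (by linarith)]
    linarith
lemma un_le {ι : Type*} {r : ℝ} {O : ι → Set (EE m)} (ho : ∀ i, IsOpen (O i)) (hO : ∀ i, O i ⊆ closedBall 0 r) {g : EE m → ℝ} (gc : Continuous g) (g0 : ∀ z, 0 ≤ g z)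
    (t : Finset ι) : ∫ z in ⋃ i ∈ t, O i, g z ≤ ∑ i ∈ t, ∫ z in O i, g z := by
  have gi := gc.continuousOn.integrableOn_compact (μ := volume) (isCompact_closedBall (0 : EE m) r)
  classical
  induction t using Finset.induction_on with
  | empty => simp
  | insert a s ha ih =>
    rw [Finset.set_biUnion_insert, Finset.sum_insert ha]
    have s1 : ⋃ i ∈ s, O i ⊆ closedBall 0 r := iUnion₂_subset fun i _ => hO i
    have om : MeasurableSet (⋃ i ∈ s, O i) := (isOpen_iUnion fun i => isOpen_iUnion fun _ => ho i).measurableSet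
    rw [← union_sdiff_self, setIntegral_union disjoint_sdiff_self_right (om.diff (ho a).measurableSet) (gi.mono_set (hO a))
      (gi.mono_set (sdiff_subset.trans s1))]
    refine add_le_add le_rfl (le_trans ?_ ih)
    exact setIntegral_mono_set (gi.mono_set s1) (Eventually.of_forall g0) (Eventually.of_forall sdiff_subset)
theorem no_PBW (hm : 1 ≤ m) {F : Set (EE (m + 1))} (hreg : ¬ ∃ v, GeneratesRegularLeaf F v) {K : Set (EE m)} (hKc : IsCompact K) (hK : K ⊆ dirSet F)
    {M : ℝ} (hM : 0 ≤ M) : ¬ PBW M K := by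
  intro hP
  obtain ⟨c0, hc0, hmass⟩ := mass_low hm
  obtain ⟨R, hR⟩ := hKc.isBounded.exists_norm_le
  set B := R ^ 2 + 2
  have hB : 0 ≤ B := by positivity
  have hKB : ∀ x ∈ K, ‖x‖ ^ 2 + 1 < B := fun x hx => by
    have := pow_le_pow_left₀ (norm_nonneg x) (hR x hx) 2
    simp only [B]; linarith
  set ι := Fin (m + 1) × ℕ × ℕ × ℕ
  set Y : ι → Set (EE m) := fun i => dirSetI F i.1 ∩ ball (TopologicalSpace.denseSeq (EE m) i.2.1) (1 / ((i.2.2.1 : ℝ) + 1))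
  obtain ⟨ε, ε0, c, hε, hc⟩ := posSumOfEncodable (half_pos hc0) ι
  choose O Oo OX Or Oi using fun i : ι => cov (Y i) (A := M + 1) i.2.2.2 (by linarith) hB (ε0 i)
  have hKO : K ⊆ ⋃ i, O i := fun a ha => by
    obtain ⟨i, v, hv, hv0, hav⟩ := mem_iUnion.1 (hK ha)
    have hnr : ¬ LocallyLRegularAt (dirSetI F i) a := fun h => hreg ⟨v, subset_closure hv, i, hv0, by
      convert h using 1
      ext j; exact (hav j).symm⟩
    simp only [LocallyLRegularAt, not_forall] at hnr
    obtain ⟨r, hr, hnr⟩ := hnr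
    obtain ⟨n, hn⟩ := nreg hnr
    obtain ⟨l, hl⟩ := exists_nat_one_div_lt (half_pos hr)
    obtain ⟨k, hk⟩ := (TopologicalSpace.denseRange_denseSeq (EE m)).exists_dist_lt a (Nat.one_div_pos_of_nat (α := ℝ) (n := l))
    refine mem_iUnion.2 ⟨(i, k, l, n), OX _ ⟨⟨⟨v, hv, hv0, hav⟩, hk⟩, hKB a ha, fun δ hδ => ?_⟩⟩
    obtain ⟨z, hz, f, hf, hfl⟩ := hn δ hδ
    refine ⟨z, hz, f, ⟨hf.1, hf.2.1, fun x hx => hf.2.2 x ⟨hx.1, ?_⟩⟩, hfl⟩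
    have h1 : dist x (TopologicalSpace.denseSeq (EE m) k) < 1 / ((l : ℝ) + 1) := hx.2
    have := dist_triangle_right x a (TopologicalSpace.denseSeq (EE m) k)
    rw [mem_ball]
    linarith
  obtain ⟨t, ht⟩ := hKc.elim_finite_subcover O Oo hKO
  obtain ⟨φ, p1, p2⟩ := hmass M B (RR (M + 1) B) K (⋃ i ∈ t, O i) hM hB hKc hP (isOpen_biUnion fun i _ => Oo i) ht (iUnion₂_subset fun i _ => Or i) hKB
  have h1 := un_le Oo Or (MA_cont φ) p1.pd.ma t
  have h2 : ∑ i ∈ t, ∫ z in O i, MA φ z ≤ ∑ i ∈ t, ε i := Finset.sum_le_sum fun i _ => Oi i φ p1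
  have h3 := sum_le_hasSum t (fun i _ => (ε0 i).le) hε
  linarith
theorem final_main {m : ℕ} (hm : 1 ≤ m)
    (F : Set (EuclideanSpace ℂ (Fin (m + 1))))
    (hFσ : ∃ c : ℕ → Set (EuclideanSpace ℂ (Fin m)),
      (∀ k, IsClosed (c k)) ∧ dirSet F = ⋃ k, c k)
    (hreg : ¬ ∃ v, GeneratesRegularLeaf F v) :
    ∃ S : MvPowerSeries (Fin (m + 1)) ℂ,
      (∀ v ∈ F, HasPosRadius (lineCoeff S v)) ∧ ¬ ConvUnifNearZero S := by
  obtain ⟨c, hc, e⟩ := hFσ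
  refine ser_main e fun j => no_PBW hm hreg ?_ ?_ (Nat.cast_nonneg j)
  · exact (isCompact_closedBall _ _).inter_left ((Finset.range (j + 1)).finite_toSet.isClosed_biUnion fun k _ => hc k)
  · rw [e]
    exact inter_subset_left.trans (iUnion₂_subset fun k _ => subset_iUnion c k)
end
end

/-- If the direction set `F'` is an `F_σ` set and `S₀(F)` has no regular leaf, then
`S₀(F)` is not normal. -/
theorem not_normal_of_no_regular_leaf {m : ℕ} (hm : 1 ≤ m)
    (F : Set (EuclideanSpace ℂ (Fin (m + 1)))) (hFne : F.Nonempty)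
    (hFsub : F ⊆ Metric.sphere (0 : EuclideanSpace ℂ (Fin (m + 1))) 1)
    (hFσ : ∃ c : ℕ → Set (EuclideanSpace ℂ (Fin m)),
      (∀ k, IsClosed (c k)) ∧ dirSet F = ⋃ k, c k)
    (hreg : ¬ ∃ v, GeneratesRegularLeaf F v) :
    ∃ S : MvPowerSeries (Fin (m + 1)) ℂ,
      (∀ v ∈ F, HasPosRadius (lineCoeff S v)) ∧ ¬ ConvUnifNearZero S := by
  exact final_main hm F hFσ hreg

end
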